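/- There exists a set 𝒢 ⊆ [0,1]² which contains a residual subset of [0,1]² and whose complement in [0,1]² has Lebesgue measure zero, with the following property. Let f and g be C³ multicritical circle maps with the same irrational rotation number ρ, such that f has exactly one critical point c₀ and g has exactly two critical points c₁ and c₂. Let α be the μ_g-measure of the positively oriented open arc from c₁ to c₂ (so the two connected components of S¹∖{c₁,c₂} have μ_g-measures α and 1−α). If (ρ,α)∈𝒢, then every circle homeomorphism h with h∘f=g∘h and h(c₀)=c₁ fails to be quasisymmetric. Moreover, the set {ρ : (ρ,α)∈𝒢 for some α} contains 𝔼_∞. -/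

import Mathlib

noncomputable section

open Set Filter MeasureTheory Topology

/-- The circle `ℝ/ℤ`. -/
abbrev S1 := AddCircle (1 : ℝ)

/-- `F` is an (orientation-preserving) lift of the circle map `f`. -/
def IsLift (f : S1 → S1) (F : ℝ → ℝ) : Prop :=
  StrictMono F ∧ Function.Surjective F ∧ (∀ x : ℝ, F (x + 1) = F x + 1) ∧
    ∀ x : ℝ, f (x : S1) = (F x : S1)

/-- `f` is an orientation-preserving circle homeomorphism. -/
def IsCircleHomeo (f : S1 → S1) : Prop := ∃ F : ℝ → ℝ, IsLift f F

/-- `f` has rotation number `ρ ∈ [0,1)`: some lift of `f` has translation number `ρ`. -/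
def HasRotNum (f : S1 → S1) (ρ : ℝ) : Prop :=
  ∃ F : ℝ → ℝ, IsLift f F ∧ Tendsto (fun n : ℕ => F^[n] 0 / (n : ℝ)) atTop (𝓝 ρ)

/-- The lift `F` has a non-flat (power-law) critical point at `c`:
on a neighbourhood `W` of `c`, `F y = F c + φ(y)|φ(y)|^(d-1)` for a `C³` diffeomorphism `φ`
with `φ c = 0`. -/
def NonFlatAt (F : ℝ → ℝ) (c : ℝ) : Prop :=
  ∃ d : ℝ, 1 < d ∧ ∃ W : Set ℝ, IsOpen W ∧ c ∈ W ∧ ∃ φ : ℝ → ℝ,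
    ContDiffOn ℝ 3 φ W ∧ InjOn φ W ∧ (∀ y ∈ W, deriv φ y ≠ 0) ∧ φ c = 0 ∧
    ∀ y ∈ W, F y = F c + φ y * |φ y| ^ (d - 1)

/-- `f` is a `C^k` unicritical circle map: an orientation-preserving `C^k` circle
homeomorphism whose only critical point is `c`, and it is non-flat. -/
def Unicritical (f : S1 → S1) (c : S1) (k : ℕ∞) : Prop :=
  ∃ (F : ℝ → ℝ) (x₀ : ℝ), IsLift f F ∧ ContDiff ℝ k F ∧ (x₀ : S1) = c ∧
    {x : ℝ | deriv F x = 0} = {x : ℝ | ∃ m : ℤ, x = x₀ + m} ∧ NonFlatAt F x₀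

/-- `f` is a `C^k` bi-critical circle map: an orientation-preserving `C^k` circle
homeomorphism with exactly two critical points `c₁ ≠ c₂`, both non-flat. -/
def Bicritical (f : S1 → S1) (c₁ c₂ : S1) (k : ℕ∞) : Prop :=
  c₁ ≠ c₂ ∧ ∃ (F : ℝ → ℝ) (x₁ x₂ : ℝ), IsLift f F ∧ ContDiff ℝ k F ∧
    (x₁ : S1) = c₁ ∧ (x₂ : S1) = c₂ ∧
    {x : ℝ | deriv F x = 0} =
      {x : ℝ | ∃ m : ℤ, x = x₁ + m} ∪ {x : ℝ | ∃ m : ℤ, x = x₂ + m} ∧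
    NonFlatAt F x₁ ∧ NonFlatAt F x₂

/-- `h` is a quasisymmetric (orientation-preserving) circle homeomorphism. -/
def QuasiSymm (h : S1 → S1) : Prop :=
  ∃ H : ℝ → ℝ, IsLift h H ∧ ∃ M : ℝ, 1 < M ∧ ∀ x t : ℝ, 0 < t →
    1 / M ≤ (H (x + t) - H x) / (H x - H (x - t)) ∧
      (H (x + t) - H x) / (H x - H (x - t)) ≤ M

/-- The length (in `[0,1)`) of the positively oriented arc from `x` to `y`. -/
def arcLen (x y : S1) : ℝ := (AddCircle.equivIco 1 0 (y - x) : ℝ)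

/-- The positively oriented open arc from `x` to `y` on the circle. -/
def posArc (x y : S1) : Set S1 := (fun t : ℝ => x + (t : S1)) '' Ioo 0 (arcLen x y)

/-- The Gauss map `G(ρ) = {1/ρ}`, `G(0) = 0`. -/
def gaussMap (ρ : ℝ) : ℝ := if ρ = 0 then 0 else Int.fract (1 / ρ)

/-- The fiber maps `T_ρ : [-1,1] → [-1,1]` of the skew product. -/
def fiberMap (ρ α : ℝ) : ℝ :=
  if ρ = 0 then 0
  else if α ≤ 0 then -α
  else if α ≤ ρ * gaussMap ρ then -α / (ρ * gaussMap ρ)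
  else Int.fract ((1 - α) / ρ)

/-- The skew product `T(ρ,α) = (G(ρ), T_ρ(α))`. -/
def skewProd (p : ℝ × ℝ) : ℝ × ℝ := (gaussMap p.1, fiberMap p.1 p.2)

/-- The rectangle `R = [0,1] × [-1,1]`. -/
def Rect : Set (ℝ × ℝ) := Icc (0 : ℝ) 1 ×ˢ Icc (-1 : ℝ) 1

/-- `M = ([0,1] ∖ ℚ) × [-1,1]`. -/
def Mset : Set (ℝ × ℝ) := {p | p ∈ Rect ∧ Irrational p.1}

/-- The `n`-th partial quotient of the continued fraction expansion of `θ`: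
`a_n(θ) = ⌊1 / Gⁿ(θ)⌋`. -/
def pquot (θ : ℝ) (n : ℕ) : ℕ := ⌊1 / gaussMap^[n] θ⌋₊

/-- The set `𝔼_∞` of irrational numbers in `(0,1)` all of whose partial quotients are even
and tend to infinity. -/
def Einf : Set ℝ :=
  {θ | θ ∈ Ioo (0 : ℝ) 1 ∧ Irrational θ ∧ (∀ n, Even (pquot θ n)) ∧
    Tendsto (fun n => pquot θ n) atTop atTop}

/-- The square `[0,1]²`. -/
def Sq : Set (ℝ × ℝ) := Icc (0 : ℝ) 1 ×ˢ Icc (0 : ℝ) 1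

/-- `ρ` admits infinitely many very good rational approximations from below. -/
def WellApproxBelow (ρ : ℝ) : Prop :=
  ∀ ε : ℝ, 0 < ε → ∀ N : ℕ, ∃ r : ℚ, N ≤ r.den ∧ 0 < ρ - r ∧ (r.den : ℝ) ^ 2 * (ρ - r) < ε

/-- The pairs `(ρ, α)` for which some return time `q ≥ K` is `K`-isolated. -/
def isolatedPairs (K : ℕ) : Set (ℝ × ℝ) :=
  {z | ∃ q : ℕ, K ≤ q ∧ ∃ p : ℤ, 0 < q * z.1 - p ∧
    (∀ i : ℕ, 0 < i → i < q → 2 * K * (q * z.1 - p) < ‖((i * z.1 : ℝ) : S1)‖) ∧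
    ∀ i : ℕ, i < q → K * (q * z.1 - p) < ‖((z.2 + i * z.1 : ℝ) : S1)‖}

theorem exists_rat_den_ge {x : ℝ} (hx : Irrational x) (N : ℕ) :
    ∃ r : ℚ, N ≤ r.den ∧ |x - r| ≤ 1 / (r.den : ℝ) ^ 2 := by
  have h1 := hx.eventually_forall_le_dist_cast_rat_of_den_le N
  have h2 : Tendsto (fun n : ℕ => 1 / ((n : ℝ) + 1)) atTop (𝓝 0) :=
    tendsto_one_div_add_atTop_nhds_zero_nat
  have h3 : Tendsto (fun n : ℕ => 2 * (1 / ((n : ℝ) + 1))) atTop (𝓝 0) := by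
    simpa using h2.const_mul 2
  obtain ⟨n, hn, hn0⟩ := ((h3.eventually h1).and (eventually_gt_atTop 0)).exists
  obtain ⟨r, hr, hrn⟩ := Real.exists_rat_abs_sub_le_and_den_le x hn0
  have hd : (1 : ℝ) ≤ r.den := by exact_mod_cast r.den_pos
  have hdn : (r.den : ℝ) ≤ n := by exact_mod_cast hrn
  refine ⟨r, ?_, hr.trans ?_⟩
  · by_contra hlt
    have := hn r (by omega)
    rw [Real.dist_eq] at this
    have h4 : 1 / (((n : ℝ) + 1) * r.den) ≤ 1 / ((n : ℝ) + 1) := by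
      apply one_div_le_one_div_of_le (by positivity)
      nlinarith
    have h5 : (0 : ℝ) < 1 / ((n : ℝ) + 1) := by positivity
    linarith
  · apply one_div_le_one_div_of_le (by positivity)
    nlinarith

theorem ae_exists_rat_below (ε : ℝ) (hε : 0 < ε) (hε1 : ε ≤ 1) (N : ℕ) :
    ∀ᵐ ρ : ℝ, ∃ r : ℚ, N ≤ r.den ∧ 0 < ρ - r ∧ (r.den : ℝ) ^ 2 * (ρ - r) < ε := by
  set s : Set ℝ :=
    {ρ | ∃ r : ℚ, N ≤ r.den ∧ 0 < ρ - r ∧ (r.den : ℝ) ^ 2 * (ρ - r) < ε}ᶜ with hs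
  have hopen : IsOpen sᶜ := by
    rw [hs, compl_compl]
    have : {ρ : ℝ | ∃ r : ℚ, N ≤ r.den ∧ 0 < ρ - r ∧ (r.den : ℝ) ^ 2 * (ρ - r) < ε} =
        ⋃ r : ℚ, {ρ : ℝ | N ≤ r.den ∧ 0 < ρ - r ∧ (r.den : ℝ) ^ 2 * (ρ - r) < ε} := by
      ext; simp
    rw [this]
    refine isOpen_iUnion fun r => ?_
    refine isOpen_const.inter (IsOpen.inter ?_ ?_)
    · exact isOpen_lt (f := fun _ => (0 : ℝ)) (g := fun ρ : ℝ => ρ - r)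
        (by fun_prop) (by fun_prop)
    · exact isOpen_lt (f := fun ρ : ℝ => (r.den : ℝ) ^ 2 * (ρ - r)) (g := fun _ => ε)
        (by fun_prop) (by fun_prop)
  have hms : MeasurableSet s := hopen.measurableSet.of_compl
  filter_upwards [Besicovitch.ae_tendsto_measure_inter_div_of_measurableSet volume hms,
    (Set.countable_range ((↑) : ℚ → ℝ)).ae_notMem volume] with x hx hxi
  have hxirr : Irrational x := hxi
  by_contra hcon
  have hxs : x ∈ s := hcon
  rw [indicator_of_mem hxs] at hx
  have hlt : ENNReal.ofReal (1 - ε / 4) < 1 := by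
    rw [ENNReal.ofReal_lt_one]; linarith
  have hev := hx.eventually (lt_mem_nhds (show ENNReal.ofReal (1 - ε / 4) < (1 : ℝ → ENNReal) x from hlt))
  rw [eventually_nhdsWithin_iff, Metric.eventually_nhds_iff] at hev
  obtain ⟨δ, hδ, hball⟩ := hev
  obtain ⟨M, hM⟩ := exists_nat_gt (2 / δ)
  obtain ⟨r, hrN, hr⟩ := exists_rat_den_ge hxirr (max N (M + 1))
  have hd1 : (1 : ℝ) ≤ r.den := by exact_mod_cast r.den_pos
  have hdM : (M : ℝ) ≤ r.den := by
    have : M ≤ r.den := by have := le_max_right N (M + 1); omega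
    exact_mod_cast this
  set D : ℝ := (r.den : ℝ) with hD
  have hR : 0 < 2 / D ^ 2 := by positivity
  have hRδ : 2 / D ^ 2 < δ := by
    rw [div_lt_iff₀ (by positivity)]
    rw [div_lt_iff₀ hδ] at hM
    have h1 : M * δ ≤ D * δ := by gcongr
    have h2 : D * δ ≤ D ^ 2 * δ := by
      have : D ≤ D ^ 2 := by nlinarith
      gcongr
    linarith
  have key := hball (y := 2 / D ^ 2) (by rw [Real.dist_eq, sub_zero, abs_of_pos hR]; exact hRδ) hR
  rw [Real.volume_closedBall] at key
  have hsub : s ∩ Metric.closedBall x (2 / D ^ 2) ⊆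
      Metric.closedBall x (2 / D ^ 2) \ Ioo (r : ℝ) (r + ε / D ^ 2) := by
    rintro y ⟨hys, hyb⟩
    refine ⟨hyb, fun hy => hys ⟨r, (le_max_left _ _).trans hrN, by linarith [hy.1], ?_⟩⟩
    have h2 := hy.2
    have : y - r < ε / D ^ 2 := by linarith
    rw [lt_div_iff₀ (by positivity)] at this
    linarith
  have hsub2 : Ioo (r : ℝ) (r + ε / D ^ 2) ⊆ Metric.closedBall x (2 / D ^ 2) := by
    intro y hy
    rw [Metric.mem_closedBall, Real.dist_eq]
    have h1 := abs_le.1 hr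
    have h3 : ε / D ^ 2 ≤ 1 / D ^ 2 := by gcongr
    have h4 : 2 / D ^ 2 = 1 / D ^ 2 + 1 / D ^ 2 := by ring
    have h5 : (0 : ℝ) < 1 / D ^ 2 := by positivity
    rw [abs_le]
    constructor <;> linarith [hy.1, hy.2, h1.1, h1.2]
  have hmeas : volume (s ∩ Metric.closedBall x (2 / D ^ 2)) ≤
      ENNReal.ofReal ((1 - ε / 4) * (2 * (2 / D ^ 2))) := by
    refine (measure_mono hsub).trans ?_
    rw [measure_sdiff hsub2 measurableSet_Ioo.nullMeasurableSet (by simp),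
      Real.volume_closedBall, Real.volume_Ioo, ← ENNReal.ofReal_sub _ (by
        have : 0 < ε / D ^ 2 := by positivity
        linarith)]
    apply ENNReal.ofReal_le_ofReal
    apply le_of_eq
    field_simp
    ring
  have hle : volume (s ∩ Metric.closedBall x (2 / D ^ 2)) / ENNReal.ofReal (2 * (2 / D ^ 2)) ≤
      ENNReal.ofReal (1 - ε / 4) := by
    apply ENNReal.div_le_of_le_mul
    rw [← ENNReal.ofReal_mul (by linarith)]
    exact hmeas
  exact absurd key (not_lt.2 hle)

theorem ae_wellApproxBelow : ∀ᵐ ρ : ℝ, WellApproxBelow ρ := by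
  have h : ∀ᵐ ρ : ℝ, ∀ k N : ℕ, ∃ r : ℚ, N ≤ r.den ∧ 0 < ρ - r ∧
      (r.den : ℝ) ^ 2 * (ρ - r) < 1 / ((k : ℝ) + 1) := by
    rw [ae_all_iff]; intro k
    rw [ae_all_iff]; intro N
    refine ae_exists_rat_below _ (by positivity) ?_ N
    rw [div_le_one (by positivity)]
    linarith [(Nat.cast_nonneg k : (0 : ℝ) ≤ k)]
  filter_upwards [h] with ρ hρ ε hε N
  obtain ⟨k, hk⟩ := exists_nat_one_div_lt hε
  obtain ⟨r, h1, h2, h3⟩ := hρ k N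
  exact ⟨r, h1, h2, h3.trans hk⟩

theorem isOpen_isolatedPairs (K : ℕ) : IsOpen (isolatedPairs K) := by
  have : isolatedPairs K = ⋃ q : ℕ, ⋃ _ : K ≤ q, ⋃ p : ℤ,
      ({z : ℝ × ℝ | 0 < q * z.1 - p} ∩
      ((⋂ i ∈ Finset.Ioo 0 q,
        {z : ℝ × ℝ | 2 * K * (q * z.1 - p) < ‖((i * z.1 : ℝ) : S1)‖}) ∩
      ⋂ i ∈ Finset.range q, {z : ℝ × ℝ | K * (q * z.1 - p) < ‖((z.2 + i * z.1 : ℝ) : S1)‖})) := by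
    ext z
    simp [isolatedPairs, and_imp]
  rw [this]
  have hc : Continuous ((↑) : ℝ → S1) := AddCircle.continuous_mk' 1
  refine isOpen_iUnion fun q => isOpen_iUnion fun _ => isOpen_iUnion fun p => ?_
  refine (isOpen_lt (by fun_prop) (by fun_prop)).inter (IsOpen.inter ?_ ?_)
  · refine isOpen_biInter_finset fun i _ => isOpen_lt (by fun_prop) ?_
    exact (hc.comp (by fun_prop)).norm
  · refine isOpen_biInter_finset fun i _ => isOpen_lt (by fun_prop) ?_
    exact (hc.comp (by fun_prop)).norm

theorem norm_coe_le_abs_sub_int (x : ℝ) (m : ℤ) : ‖(x : S1)‖ ≤ |x - m| := by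
  rw [UnitAddCircle.norm_eq]
  exact round_le x m

theorem lt_norm_mul_of_coprime {ρ : ℝ} {r : ℚ} {K : ℝ} (h0 : 0 < ρ - r)
    (h1 : (K + 1) * ((r.den : ℝ) ^ 2 * (ρ - r)) < 1) {i : ℕ} (hi : 0 < i) (hir : i < r.den) :
    K * (r.den * ρ - r.num) < ‖((i * ρ : ℝ) : S1)‖ := by
  rw [UnitAddCircle.norm_eq]
  set m := round (i * ρ)
  have hq : (0 : ℝ) < r.den := by exact_mod_cast r.den_pos
  have hr : (r : ℝ) = r.num / r.den := by exact_mod_cast (Rat.num_div_den r).symm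
  set β := r.den * ρ - r.num with hβ
  have hβρ : ρ - r = β / r.den := by rw [hr, hβ]; field_simp
  have hβ0 : 0 < β := by
    rw [hβρ] at h0
    exact (div_pos_iff_of_pos_right hq).1 h0
  have h2 : (K + 1) * (r.den * β) < 1 := by
    rw [hβρ] at h1
    have : (r.den : ℝ) ^ 2 * (β / r.den) = r.den * β := by field_simp
    rwa [this] at h1
  have hne : (i : ℤ) * r.num - m * r.den ≠ 0 := by
    intro h
    have hdvd : (r.den : ℤ) ∣ r.num * i := ⟨m, by linarith⟩
    have hco : IsCoprime (r.den : ℤ) r.num := by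
      rw [Int.isCoprime_iff_gcd_eq_one, Int.gcd_comm]
      exact r.reduced
    have := Int.le_of_dvd (by exact_mod_cast hi) (hco.dvd_of_dvd_mul_left hdvd)
    omega
  have habs : (1 : ℝ) ≤ |(i : ℝ) * r.num - m * r.den| := by
    exact_mod_cast Int.one_le_abs hne
  have hid : i * ρ - m = ((i : ℝ) * r.num - m * r.den) / r.den + i / r.den * β := by
    rw [hβ]; field_simp; ring
  have hiq : (i : ℝ) / r.den * β ≤ β := by
    have : (i : ℝ) / r.den ≤ 1 := by
      rw [div_le_one hq]; exact_mod_cast hir.le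
    nlinarith
  have hiq0 : 0 ≤ (i : ℝ) / r.den * β := by positivity
  have h3 : 1 / (r.den : ℝ) ≤ |((i : ℝ) * r.num - m * r.den) / r.den| := by
    rw [abs_div, abs_of_pos hq]; gcongr
  have h4 : |((i : ℝ) * r.num - m * r.den) / r.den| - β ≤ |i * ρ - m| := by
    rw [hid]
    have := abs_sub_abs_le_abs_sub (((i : ℝ) * r.num - m * r.den) / r.den)
      (-(i / r.den * β))
    rw [sub_neg_eq_add, abs_neg, abs_of_nonneg hiq0] at this
    linarith
  have h5 : (K + 1) * β < 1 / r.den := by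
    rw [lt_div_iff₀ hq]; linarith
  linarith

theorem ae_mem_isolatedPairs {ρ : ℝ} (h : WellApproxBelow ρ) (K : ℕ) :
    volume {α : ℝ | α ∈ Ioc (0 : ℝ) 1 ∧ (ρ, α) ∉ isolatedPairs K} = 0 := by
  refine le_antisymm (le_of_forall_pos_le_add fun η hη => ?_) bot_le
  rw [zero_add]
  by_cases hη' : η = ⊤
  · rw [hη']; exact le_top
  have hη0 : 0 < η.toReal := ENNReal.toReal_pos hη.ne' hη'
  have hK : (0 : ℝ) ≤ K := Nat.cast_nonneg K
  obtain ⟨r, hrK, h0, h1⟩ := h (min (1 / (2 * K + 1)) (η.toReal / (2 * K + 1)))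
    (by positivity) K
  have h2 := h1.trans_le (min_le_left _ _)
  have h3 := h1.trans_le (min_le_right _ _)
  rw [lt_div_iff₀ (by positivity)] at h2 h3
  have hq : (0 : ℝ) < r.den := by exact_mod_cast r.den_pos
  have hr : (r : ℝ) = r.num / r.den := by exact_mod_cast (Rat.num_div_den r).symm
  set β := r.den * ρ - r.num with hβ
  have hβρ : ρ - r = β / r.den := by rw [hr, hβ]; field_simp
  have hβ0 : 0 < β := by
    rw [hβρ] at h0
    exact (div_pos_iff_of_pos_right hq).1 h0
  have hsub : {α : ℝ | α ∈ Ioc (0 : ℝ) 1 ∧ (ρ, α) ∉ isolatedPairs K} ⊆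
      ⋃ i ∈ Finset.range r.den, ((↑) : ℝ → S1) ⁻¹'
        (Metric.closedBall ((-(i * ρ) : ℝ) : S1) (K * β)) ∩ Ioc (0 : ℝ) 1 := by
    rintro α ⟨hα, hα2⟩
    by_contra hcon
    apply hα2
    refine ⟨r.den, hrK, r.num, hβ0, fun i hi hir => ?_, fun i hi => ?_⟩
    · exact lt_norm_mul_of_coprime (K := 2 * K) h0 (by linarith) hi hir
    · by_contra hle
      apply hcon
      rw [mem_iUnion₂]
      refine ⟨i, Finset.mem_range.2 hi, ?_, hα⟩
      rw [mem_preimage, Metric.mem_closedBall, dist_eq_norm, ← AddCircle.coe_sub]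
      rw [sub_neg_eq_add]
      exact not_lt.1 hle
  refine (measure_mono hsub).trans ((measure_biUnion_finset_le _ _).trans ?_)
  have hi : ∀ i ∈ Finset.range r.den, volume (((↑) : ℝ → S1) ⁻¹'
        (Metric.closedBall ((-(i * ρ) : ℝ) : S1) (K * β)) ∩ Ioc (0 : ℝ) 1) ≤
        ENNReal.ofReal (2 * (K * β)) := by
    intro i _
    have hmp := (AddCircle.measurePreserving_mk 1 0).measure_preimage
      (Metric.isClosed_closedBall (x := ((-(i * ρ) : ℝ) : S1)) (ε := K * β)).measurableSet.nullMeasurableSet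
    rw [AddCircle.volume_closedBall, zero_add, Measure.restrict_apply] at hmp
    · exact hmp.le.trans (ENNReal.ofReal_le_ofReal (min_le_right _ _))
    · exact Metric.isClosed_closedBall.measurableSet.preimage (AddCircle.continuous_mk' 1).measurable
  refine (Finset.sum_le_sum hi).trans ?_
  rw [Finset.sum_const, Finset.card_range, nsmul_eq_mul, ← ENNReal.ofReal_natCast,
    ← ENNReal.ofReal_mul (by positivity), ← ENNReal.ofReal_toReal hη']
  apply ENNReal.ofReal_le_ofReal
  have : (r.den : ℝ) ^ 2 * (ρ - r) = r.den * β := by rw [hβρ]; field_simp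
  rw [this] at h3
  nlinarith [mul_pos hq hβ0]

/-- The full-measure residual set of pairs isolated at all orders. -/
def goodPairs : Set (ℝ × ℝ) := Sq ∩ ⋂ K, isolatedPairs K

theorem volume_sq_diff_isolatedPairs (K : ℕ) : volume (Sq \ isolatedPairs K) = 0 := by
  have hSq : MeasurableSet Sq := (isClosed_Icc.prod isClosed_Icc).measurableSet
  have hms : MeasurableSet (Sq \ isolatedPairs K) :=
    hSq.diff (isOpen_isolatedPairs K).measurableSet
  rw [Measure.volume_eq_prod, Measure.measure_prod_null hms]
  filter_upwards [ae_wellApproxBelow] with ρ hρ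
  refine measure_mono_null (t := {0} ∪ {α : ℝ | α ∈ Ioc (0 : ℝ) 1 ∧ (ρ, α) ∉ isolatedPairs K})
    ?_ (measure_union_null (by simp) (ae_mem_isolatedPairs hρ K))
  rintro α ⟨hα, hα2⟩
  by_cases h0 : α = 0
  · exact Or.inl h0
  · exact Or.inr ⟨⟨lt_of_le_of_ne hα.2.1 (Ne.symm h0), hα.2.2⟩, hα2⟩

theorem volume_sq_diff_goodPairs : volume (Sq \ goodPairs) = 0 := by
  have : Sq \ goodPairs ⊆ ⋃ K, Sq \ isolatedPairs K := by
    rintro z ⟨hz, hz2⟩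
    by_contra hcon
    refine hz2 ⟨hz, mem_iInter.2 fun K => ?_⟩
    by_contra hK
    exact hcon (mem_iUnion.2 ⟨K, hz, hK⟩)
  exact measure_mono_null this (measure_iUnion_null volume_sq_diff_isolatedPairs)

theorem goodPairs_residual : (Subtype.val ⁻¹' goodPairs : Set ↥Sq) ∈ residual ↥Sq := by
  have h : (⋂ K, (Subtype.val ⁻¹' isolatedPairs K : Set ↥Sq)) ∈ residual ↥Sq := by
    refine countable_iInter_mem.2 fun K => ?_
    refine residual_of_dense_open ((isOpen_isolatedPairs K).preimage continuous_subtype_val) ?_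
    rw [dense_iff_inter_open]
    rintro V hV ⟨x, hx⟩
    obtain ⟨O, hO, rfl⟩ := isOpen_induced_iff.1 hV
    have hcl : (x : ℝ × ℝ) ∈ closure (Ioo (0 : ℝ) 1 ×ˢ Ioo (0 : ℝ) 1) := by
      rw [closure_prod_eq, closure_Ioo zero_ne_one]
      exact x.2
    have hne : (O ∩ Ioo (0 : ℝ) 1 ×ˢ Ioo (0 : ℝ) 1).Nonempty := mem_closure_iff.1 hcl O hO hx
    have hpos := (hO.inter (isOpen_Ioo.prod isOpen_Ioo)).measure_pos volume hne
    by_contra hcon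
    refine hpos.ne' (measure_mono_null ?_ (volume_sq_diff_isolatedPairs K))
    rintro z ⟨hzO, hz⟩
    have hzS : z ∈ Sq := ⟨Ioo_subset_Icc_self hz.1, Ioo_subset_Icc_self hz.2⟩
    exact ⟨hzS, fun hzK => hcon ⟨⟨z, hzS⟩, hzO, hzK⟩⟩
  refine mem_of_superset h fun x hx => ⟨x.2, ?_⟩
  rw [mem_iInter] at hx ⊢
  exact hx

theorem gaussMap_irrational {θ : ℝ} (h : Irrational θ) :
    Irrational (gaussMap θ) ∧ gaussMap θ ∈ Ioo (0 : ℝ) 1 := by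
  have h0 : θ ≠ 0 := h.ne_zero
  have hirr : Irrational (gaussMap θ) := by
    rw [gaussMap, if_neg h0, Int.fract, one_div]
    exact h.inv.sub_intCast _
  refine ⟨hirr, lt_of_le_of_ne ?_ hirr.ne_zero.symm, ?_⟩ <;> rw [gaussMap, if_neg h0]
  · exact Int.fract_nonneg _
  · exact Int.fract_lt_one _

theorem gaussMap_iterate_irrational {θ : ℝ} (h : Irrational θ) (h1 : θ ∈ Ioo (0 : ℝ) 1) (n : ℕ) :
    Irrational (gaussMap^[n] θ) ∧ gaussMap^[n] θ ∈ Ioo (0 : ℝ) 1 := by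
  induction n with
  | zero => exact ⟨h, h1⟩
  | succ n ih =>
    rw [Function.iterate_succ_apply']
    exact gaussMap_irrational ih.1

theorem pquot_add_gaussMap {θ : ℝ} (h : Irrational θ) (h1 : θ ∈ Ioo (0 : ℝ) 1) (n : ℕ) :
    gaussMap^[n] θ * (pquot θ n + gaussMap^[n + 1] θ) = 1 := by
  obtain ⟨hi, hm⟩ := gaussMap_iterate_irrational h h1 n
  rw [Function.iterate_succ_apply', pquot, gaussMap, if_neg hi.ne_zero,
    natCast_floor_eq_intCast_floor (by have := hm.1; positivity), Int.floor_add_fract,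
    mul_one_div_cancel hi.ne_zero]

theorem exists_convergents {θ : ℝ} (h : Irrational θ) (h1 : θ ∈ Ioo (0 : ℝ) 1) (n : ℕ) :
    ∃ a b a' b' : ℤ, ∃ D : ℝ, 0 < b ∧ (pquot θ n : ℤ) ≤ b' ∧ 0 < D ∧
      a * b' - a' * b = (-1) ^ (n + 1) ∧ b * θ - a = (-1) ^ n * D ∧
      b' * θ - a' = (-1) ^ (n + 1) * (D * gaussMap^[n + 1] θ) ∧
      b' * D + b * (D * gaussMap^[n + 1] θ) = 1 := by
  induction n with
  | zero =>
    have h2 := pquot_add_gaussMap h h1 0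
    refine ⟨0, 1, 1, pquot θ 0, θ, one_pos, le_rfl, h1.1, by simp, by simp, ?_, ?_⟩
    · simp only [Function.iterate_zero, id_eq] at h2
      push_cast
      linear_combination h2
    · simp only [Function.iterate_zero, id_eq] at h2
      push_cast
      linear_combination h2
  | succ n ih =>
    obtain ⟨a, b, a', b', D, hb, hb', hD, hdet, hA, hA', hs⟩ := ih
    have h2 := pquot_add_gaussMap h h1 (n + 1)
    obtain ⟨hi, hm⟩ := gaussMap_iterate_irrational h h1 (n + 1)
    have hpos : 0 < pquot θ n := by
      rw [pquot, Nat.floor_pos]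
      have := (gaussMap_iterate_irrational h h1 n).2
      rw [le_div_iff₀ this.1]
      linarith [this.2]
    have hb'0 : 0 < b' := by omega
    refine ⟨a', b', pquot θ (n + 1) * a' + a, pquot θ (n + 1) * b' + b,
      D * gaussMap^[n + 1] θ, hb'0, ?_, mul_pos hD hm.1, ?_, hA', ?_, ?_⟩
    · nlinarith [Int.natCast_nonneg (pquot θ (n + 1))]
    · rw [pow_succ]; linear_combination (-1) * hdet
    · push_cast
      rw [pow_succ, pow_succ]
      rw [pow_succ] at hA'
      linear_combination hA + pquot θ (n + 1) * hA' - (-1) ^ n * D * h2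
    · push_cast
      linear_combination hs + b' * D * h2

theorem wellApproxBelow_of_mem_Einf {θ : ℝ} (hθ : θ ∈ Einf) : WellApproxBelow θ := by
  obtain ⟨h1, h, -, htend⟩ := hθ
  intro ε hε N
  obtain ⟨k, hk⟩ := exists_nat_gt (1 / ε)
  obtain ⟨n₀, hn₀⟩ := eventually_atTop.1 (htend.eventually_ge_atTop (max N (k + 1)))
  set n := 2 * n₀ + 1 with hn
  obtain ⟨a, b, a', b', D, hb, hb', hD, hdet, hA, hA', hs⟩ := exists_convergents h h1 n
  have hN := hn₀ n (by omega)
  have hN1 := hn₀ (n + 1) (by omega)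
  have hb'0 : 0 < b' := by
    have : 0 < pquot θ n := by have := le_max_right N (k + 1); omega
    omega
  have hco : IsCoprime a' b' := by
    have he : Even (n + 1) := ⟨n₀ + 1, by omega⟩
    rw [he.neg_one_pow] at hdet
    exact ⟨-b, a, by linear_combination hdet⟩
  obtain ⟨b0, rfl⟩ : ∃ b0 : ℕ, b' = b0 := ⟨b'.toNat, by omega⟩
  have hden : ((a' : ℚ) / (b0 : ℤ)).den = b0 := by
    have := Rat.den_div_eq_of_coprime hb'0 (by
      rw [← Int.isCoprime_iff_nat_coprime]; exact hco)
    exact_mod_cast this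
  have he : Even (n + 1) := ⟨n₀ + 1, by omega⟩
  rw [he.neg_one_pow, one_mul] at hA'
  obtain ⟨hi, hm⟩ := gaussMap_iterate_irrational h h1 (n + 1)
  have hb0 : (0 : ℝ) < b0 := by exact_mod_cast hb'0
  push_cast at hA' hs
  have hsub : θ - (((a' : ℚ) / (b0 : ℤ) : ℚ) : ℝ) = D * gaussMap^[n + 1] θ / b0 := by
    rw [← hA']; push_cast; field_simp
  refine ⟨(a' : ℚ) / (b0 : ℤ), ?_, ?_, ?_⟩
  · rw [hden]
    have := le_max_left N (k + 1)
    omega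
  · rw [hsub]
    have := hm.1
    positivity
  · rw [hden, hsub]
    have h3 := pquot_add_gaussMap h h1 (n + 1)
    have h4 := (gaussMap_iterate_irrational h h1 (n + 1 + 1)).2.1
    have hbD : b0 * D ≤ 1 := by
      have : (0 : ℝ) < b * (D * gaussMap^[n + 1] θ) := by
        have hb2 : (0 : ℝ) < b := by exact_mod_cast hb
        have := hm.1
        positivity
      linarith
    have h5 : (k : ℝ) + 1 ≤ pquot θ (n + 1) := by
      have := le_max_right N (k + 1)
      exact_mod_cast this.trans hN1
    have h6 : gaussMap^[n + 1] θ * (k + 1) ≤ 1 := by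
      have := hm.1
      nlinarith
    have h7 : gaussMap^[n + 1] θ < ε := by
      rw [div_lt_iff₀ hε] at hk
      have := hm.1
      nlinarith
    have : (b0 : ℝ) ^ 2 * (D * gaussMap^[n + 1] θ / b0) = b0 * D * gaussMap^[n + 1] θ := by
      field_simp
    rw [this]
    have := hm.1
    nlinarith

theorem Einf_subset : Einf ⊆ {ρ : ℝ | ∃ α : ℝ, (ρ, α) ∈ goodPairs} := by
  intro θ hθ
  have hw := wellApproxBelow_of_mem_Einf hθ
  have hnull : volume (⋃ K, {α : ℝ | α ∈ Ioc (0 : ℝ) 1 ∧ (θ, α) ∉ isolatedPairs K}) = 0 :=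
    measure_iUnion_null fun K => ae_mem_isolatedPairs hw K
  by_contra hcon
  have hsub : Ioc (0 : ℝ) 1 ⊆ ⋃ K, {α : ℝ | α ∈ Ioc (0 : ℝ) 1 ∧ (θ, α) ∉ isolatedPairs K} := by
    intro α hα
    by_contra h
    refine hcon ⟨α, ⟨Ioo_subset_Icc_self hθ.1, Ioc_subset_Icc_self hα⟩, mem_iInter.2 fun K => ?_⟩
    by_contra hK
    exact h (mem_iUnion.2 ⟨K, hα, hK⟩)
  have := measure_mono_null hsub hnull
  simp at this

/-- A cross-ratio of four points measuring the middle gap. -/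
def drat (a b c d : ℝ) : ℝ := (d - a) * (c - b) / ((b - a) * (d - c))

/-- A cross-ratio of four points measuring the outer gaps. -/
def crat (a b c d : ℝ) : ℝ := (b - a) * (d - c) / ((c - a) * (d - b))

/-- A positive function whose logarithmic tangent Wronskian is monotone has no interior strict
peak. -/
theorem quasiconvex_of_wronskian {a d : ℝ} {u u' c c' : ℝ → ℝ}
    (hu : ∀ x ∈ Ioo a d, HasDerivAt u (u' x) x) (hc : ∀ x ∈ Ioo a d, HasDerivAt c (c' x) x)
    (hcpos : ∀ x ∈ Ioo a d, 0 < c x)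
    (hW : MonotoneOn (fun x => c x * u' x - u x * c' x) (Ioo a d))
    {x y z : ℝ} (hx : x ∈ Ioo a d) (hz : z ∈ Ioo a d) (hxy : x < y) (hyz : y < z)
    (h : u x / c x < u y / c y) : u y / c y ≤ u z / c z := by
  have hd : ∀ t ∈ Ioo a d, HasDerivAt (fun x => u x / c x)
      ((u' t * c t - u t * c' t) / c t ^ 2) t :=
    fun t ht => (hu t ht).div (hc t ht) (hcpos t ht).ne'
  have hsub : Icc x z ⊆ Ioo a d := fun t ht => ⟨hx.1.trans_le ht.1, ht.2.trans_lt hz.2⟩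
  obtain ⟨η, hη, hηe⟩ := exists_hasDerivAt_eq_slope (fun x => u x / c x)
    (fun t => (u' t * c t - u t * c' t) / c t ^ 2) hxy
    (fun t ht => (hd t (hsub ⟨ht.1, ht.2.trans hyz.le⟩)).continuousAt.continuousWithinAt)
    (fun t ht => hd t (hsub ⟨ht.1.le, (ht.2.trans hyz).le⟩))
  have hηm : η ∈ Ioo a d := hsub ⟨hη.1.le, (hη.2.trans hyz).le⟩
  have hpos : 0 < u' η * c η - u η * c' η := by
    have h1 : 0 < (u' η * c η - u η * c' η) / c η ^ 2 := by
      rw [hηe]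
      exact div_pos (by linarith) (by linarith)
    exact (div_pos_iff_of_pos_right (pow_pos (hcpos η hηm) 2)).1 h1
  obtain ⟨ζ, hζ, hζe⟩ := exists_hasDerivAt_eq_slope (fun x => u x / c x)
    (fun t => (u' t * c t - u t * c' t) / c t ^ 2) hyz
    (fun t ht => (hd t (hsub ⟨hxy.le.trans ht.1, ht.2⟩)).continuousAt.continuousWithinAt)
    (fun t ht => hd t (hsub ⟨hxy.le.trans ht.1.le, ht.2.le⟩))
  have hζm : ζ ∈ Ioo a d := hsub ⟨hxy.le.trans hζ.1.le, hζ.2.le⟩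
  have hmon := hW hηm hζm (hη.2.trans hζ.1).le
  simp only at hmon
  have h2 : 0 ≤ (u' ζ * c ζ - u ζ * c' ζ) / c ζ ^ 2 :=
    div_nonneg (by linarith) (sq_nonneg _)
  rw [hζe] at h2
  by_contra hlt
  have : (u z / c z - u y / c y) / (z - y) < 0 :=
    div_neg_of_neg_of_pos (by linarith) (by linarith)
  linarith

/-- The function `N / (√F' cos)`, with `N` affine in `F`, has no interior strict peak. -/
theorem quasiconvex_of_schwarzian {F1 F2 F3 N : ℝ → ℝ} {a d κ m r : ℝ}
    (hF1 : ∀ x, HasDerivAt F1 (F2 x) x)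
    (hF2 : ∀ x, HasDerivAt F2 (F3 x) x)
    (hpos : ∀ x ∈ Ioo a d, 0 < F1 x)
    (hS : ∀ x ∈ Ioo a d, F3 x * F1 x - 3 / 2 * F2 x ^ 2 ≤ 2 * κ ^ 2 * F1 x ^ 2)
    (hcpos : ∀ x ∈ Icc a d, 0 < Real.cos (κ * (x - m)))
    (hNpos : ∀ x ∈ Icc a d, 0 < N x) (hNd : ∀ x, HasDerivAt N (r * F1 x) x)
    {x y z : ℝ} (hx : x ∈ Ioo a d) (hz : z ∈ Ioo a d) (hxy : x < y) (hyz : y < z)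
    (h : (F1 x) ^ (-(1 / 2) : ℝ) * N x / Real.cos (κ * (x - m)) <
      (F1 y) ^ (-(1 / 2) : ℝ) * N y / Real.cos (κ * (y - m))) :
    (F1 y) ^ (-(1 / 2) : ℝ) * N y / Real.cos (κ * (y - m)) ≤
      (F1 z) ^ (-(1 / 2) : ℝ) * N z / Real.cos (κ * (z - m)) := by
  set v : ℝ → ℝ := fun x => (F1 x) ^ (-(1 / 2) : ℝ) with hv
  set v1 : ℝ → ℝ := fun x => -(1 / 2) * (F1 x) ^ (-(3 / 2) : ℝ) * F2 x with hv1
  have hvd : ∀ x ∈ Ioo a d, HasDerivAt v (v1 x) x := by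
    intro x hx
    refine ((hF1 x).rpow_const (p := -(1 / 2)) (Or.inl (hpos x hx).ne')).congr_deriv ?_
    rw [hv1]; norm_num; ring
  have hv1d : ∀ x ∈ Ioo a d, HasDerivAt v1
      (3 / 4 * (F1 x) ^ (-(5 / 2) : ℝ) * F2 x ^ 2 - 1 / 2 * (F1 x) ^ (-(3 / 2) : ℝ) * F3 x) x := by
    intro x hx
    refine ((((hF1 x).rpow_const (p := -(3 / 2)) (Or.inl (hpos x hx).ne')).const_mul
      (-(1 / 2))).mul (hF2 x)).congr_deriv ?_
    norm_num; ring
  have hr : ∀ x ∈ Ioo a d, (F1 x) ^ (-(3 / 2) : ℝ) = (F1 x) ^ (-(5 / 2) : ℝ) * F1 x ∧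
      (F1 x) ^ (-(1 / 2) : ℝ) = (F1 x) ^ (-(5 / 2) : ℝ) * F1 x ^ 2 := by
    intro x hx
    have h0 := hpos x hx
    constructor
    · rw [← Real.rpow_add_one h0.ne']; norm_num
    · rw [← Real.rpow_natCast, ← Real.rpow_add h0]; norm_num
  set u : ℝ → ℝ := fun x => v x * N x with hu
  set u1 : ℝ → ℝ := fun x => v1 x * N x + v x * (r * F1 x) with hu1
  have hud : ∀ x ∈ Ioo a d, HasDerivAt u (u1 x) x := fun x hx => (hvd x hx).mul (hNd x)
  have hu1d : ∀ x ∈ Ioo a d, HasDerivAt u1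
      ((3 / 4 * (F1 x) ^ (-(5 / 2) : ℝ) * F2 x ^ 2 - 1 / 2 * (F1 x) ^ (-(3 / 2) : ℝ) * F3 x) * N x) x := by
    intro x hx
    refine (((hv1d x hx).mul (hNd x)).add
      ((hvd x hx).mul ((hF1 x).const_mul r))).congr_deriv ?_
    simp only [hv1, hv]
    rw [(hr x hx).1, (hr x hx).2]
    ring
  set C : ℝ → ℝ := fun x => Real.cos (κ * (x - m)) with hC
  set C1 : ℝ → ℝ := fun x => -(κ * Real.sin (κ * (x - m))) with hC1
  have hlin : ∀ x, HasDerivAt (fun x => κ * (x - m)) κ x := by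
    intro x
    simpa using ((hasDerivAt_id x).sub_const m).const_mul κ
  have hCd : ∀ x, HasDerivAt C (C1 x) x := by
    intro x
    refine ((Real.hasDerivAt_cos _).comp x (hlin x)).congr_deriv ?_
    rw [hC1]; ring
  have hC1d : ∀ x, HasDerivAt C1 (-(κ ^ 2 * C x)) x := by
    intro x
    refine ((((Real.hasDerivAt_sin _).comp x (hlin x)).const_mul κ).neg).congr_deriv ?_
    rw [hC]; ring
  have hIoo : Ioo a d ⊆ Icc a d := Ioo_subset_Icc_self
  have hW : MonotoneOn (fun x => C x * u1 x - u x * C1 x) (Ioo a d) := by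
    have hWd : ∀ x ∈ Ioo a d, HasDerivAt (fun x => C x * u1 x - u x * C1 x)
        (C x * ((3 / 4 * (F1 x) ^ (-(5 / 2) : ℝ) * F2 x ^ 2
          - 1 / 2 * (F1 x) ^ (-(3 / 2) : ℝ) * F3 x) * N x) + u x * (κ ^ 2 * C x)) x := by
      intro x hx
      refine (((hCd x).mul (hu1d x hx)).sub ((hud x hx).mul (hC1d x))).congr_deriv ?_
      ring
    refine monotoneOn_of_deriv_nonneg (convex_Ioo a d)
      (fun x hx => (hWd x hx).continuousAt.continuousWithinAt) ?_ ?_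
    · rw [interior_Ioo]
      exact fun x hx => (hWd x hx).differentiableAt.differentiableWithinAt
    · rw [interior_Ioo]
      intro x hx
      rw [(hWd x hx).deriv]
      simp only [hu, hv]
      rw [(hr x hx).1, (hr x hx).2]
      have hp : 0 ≤ C x * (F1 x) ^ (-(5 / 2) : ℝ) * N x :=
        mul_nonneg (mul_nonneg (hcpos x (hIoo hx)).le (Real.rpow_nonneg (hpos x hx).le _))
          (hNpos x (hIoo hx)).le
      have := mul_nonneg hp (sub_nonneg.2 (hS x hx))
      linear_combination (1 / 2) * this
  exact quasiconvex_of_wronskian hud (fun x _ => hCd x) (fun x hx => hcpos x (hIoo hx)) hW hx hz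
    hxy hyz h

/-- If the Schwarzian derivative of `F` is bounded above by that of `tan (κ x)`, then `F` distorts
cross-ratios at least as `tan (κ x)` does. -/
theorem cross_le_tan {F F1 F2 F3 : ℝ → ℝ} {a b c d κ : ℝ} (hκ : 0 < κ)
    (hab : a < b) (hbc : b < c) (hcd : c < d) (hκd : κ * (d - a) ≤ 1)
    (hF : ∀ x, HasDerivAt F (F1 x) x) (hF1 : ∀ x, HasDerivAt F1 (F2 x) x)
    (hF2 : ∀ x, HasDerivAt F2 (F3 x) x) (hmono : StrictMono F)
    (hpos : ∀ x ∈ Ioo a d, 0 < F1 x)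
    (hS : ∀ x ∈ Ioo a d, F3 x * F1 x - 3 / 2 * F2 x ^ 2 ≤ 2 * κ ^ 2 * F1 x ^ 2)
    {g : ℝ → ℝ} (hg : g = fun x => Real.tan (κ * (x - (a + d) / 2)) / κ) :
    (g d - g a) * (g c - g b) * ((F b - F a) * (F d - F c)) ≤
      (F d - F a) * (F c - F b) * ((g b - g a) * (g d - g c)) := by
  set m := (a + d) / 2 with hm
  have hdom : ∀ x ∈ Icc a d, κ * (x - m) ∈ Ioo (-(Real.pi / 2)) (Real.pi / 2) := by
    intro x hx
    have hpi := Real.pi_gt_three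
    have h1 : |x - m| ≤ (d - a) / 2 := by
      rw [abs_le]; constructor <;> rw [hm] <;> linarith [hx.1, hx.2]
    have h2 : |κ * (x - m)| < Real.pi / 2 := by
      rw [abs_mul, abs_of_pos hκ]
      nlinarith
    exact abs_lt.1 h2
  have hcpos : ∀ x ∈ Icc a d, 0 < Real.cos (κ * (x - m)) :=
    fun x hx => Real.cos_pos_of_mem_Ioo (hdom x hx)
  have hgd : ∀ x ∈ Icc a d, HasDerivAt g (1 / Real.cos (κ * (x - m)) ^ 2) x := by
    intro x hx
    have h1 : HasDerivAt (fun x => κ * (x - m)) κ x := by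
      simpa using ((hasDerivAt_id x).sub_const m).const_mul κ
    have h2 := ((Real.hasDerivAt_tan (hcpos x hx).ne').comp x h1).div_const κ
    rw [hg]
    refine h2.congr_deriv ?_
    field_simp
  have hgmono : StrictMonoOn g (Icc a d) := by
    intro x hx y hy hxy
    rw [hg]
    refine div_lt_div_of_pos_right ?_ hκ
    exact Real.strictMonoOn_tan (hdom x hx) (hdom y hy) (by nlinarith)
  have ma : a ∈ Icc a d := ⟨le_rfl, by linarith⟩
  have mb : b ∈ Icc a d := ⟨hab.le, by linarith⟩
  have mc : c ∈ Icc a d := ⟨by linarith, hcd.le⟩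
  have md : d ∈ Icc a d := ⟨by linarith, le_rfl⟩
  have gab := hgmono ma mb hab
  have gbc := hgmono mb mc hbc
  have gcd := hgmono mc md hcd
  have fab := hmono hab
  have fbc := hmono hbc
  have fcd := hmono hcd
  by_contra hcon
  rw [not_le] at hcon
  set w1 := (F b - F a) * (g d - g b) with hw1
  set w2 := (F d - F b) * (g b - g a) with hw2
  have w1pos : 0 < w1 := mul_pos (by linarith) (by linarith)
  have w2pos : 0 < w2 := mul_pos (by linarith) (by linarith)
  set N : ℝ → ℝ := fun x => w1 * (F d - F x) + w2 * (F x - F a) with hN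
  have hNpos : ∀ x ∈ Icc a d, 0 < N x := by
    intro x hx
    have h1 : F a ≤ F x := hmono.monotone hx.1
    have h2 : F x ≤ F d := hmono.monotone hx.2
    rcases h1.eq_or_lt with h3 | h3
    · have : 0 < F d - F x := by linarith
      have h4 : 0 ≤ F x - F a := by linarith
      exact add_pos_of_pos_of_nonneg (mul_pos w1pos this) (mul_nonneg w2pos.le h4)
    · have h4 : 0 ≤ F d - F x := by linarith
      have : 0 < F x - F a := by linarith
      exact add_pos_of_nonneg_of_pos (mul_nonneg w1pos.le h4) (mul_pos w2pos this)
  have hNd : ∀ x, HasDerivAt N ((w2 - w1) * F1 x) x := by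
    intro x
    refine ((((hF x).const_sub (F d)).const_mul w1).add
      (((hF x).sub_const (F a)).const_mul w2)).congr_deriv ?_
    ring
  set E := w1 * w2 * (g d - g a) * (F d - F a) with hE
  have hEpos : 0 < E := by
    rw [hE]
    exact mul_pos (mul_pos (mul_pos w1pos w2pos) (by linarith)) (by linarith)
  set h : ℝ → ℝ := fun x => (g a * w1 * (F d - F x) + g d * w2 * (F x - F a)) / N x with hh
  have hhd : ∀ x ∈ Icc a d, HasDerivAt h (E * F1 x / N x ^ 2) x := by
    intro x hx
    refine (((((hF x).const_sub (F d)).const_mul (g a * w1)).add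
      (((hF x).sub_const (F a)).const_mul (g d * w2))).div (hNd x) (hNpos x hx).ne').congr_deriv ?_
    congr 1
    simp only [hN, hE, Pi.add_apply]
    ring
  have ha : h a = g a := by
    simp only [hh, hN, sub_self, mul_zero, add_zero]
    have : F d - F a ≠ 0 := by linarith
    field_simp
  have hd' : h d = g d := by
    simp only [hh, hN, sub_self, mul_zero, zero_add]
    have : F d - F a ≠ 0 := by linarith
    field_simp
  have hb : h b = g b := by
    rw [hh]
    simp only
    rw [div_eq_iff (hNpos b mb).ne']
    simp only [hN, hw1, hw2]
    ring
  have hc : h c < g c := by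
    rw [hh]
    simp only
    rw [div_lt_iff₀ (hNpos c mc)]
    simp only [hN, hw1, hw2]
    linear_combination hcon
  have hIoo : Ioo a d ⊆ Icc a d := Ioo_subset_Icc_self
  clear_value h E N w1 w2
  clear hcon hh hN hE hw1 hw2
  set u : ℝ → ℝ := fun x => (F1 x) ^ (-(1 / 2) : ℝ) * N x with hu
  set C : ℝ → ℝ := fun x => Real.cos (κ * (x - m)) with hC
  have hcont : ∀ {x y : ℝ}, x ∈ Icc a d → y ∈ Icc a d → Icc x y ⊆ Icc a d :=
    fun hx hy => Icc_subset_Icc hx.1 hy.2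
  have cauchy : ∀ {x y : ℝ}, x ∈ Icc a d → y ∈ Icc a d → x < y → ∃ ξ ∈ Ioo x y,
      (g y - g x) * (E * C ξ ^ 2) = (h y - h x) * (u ξ) ^ 2 := by
    intro x y hx hy hxy
    have hsub := hcont hx hy
    obtain ⟨ξ, hξ, he⟩ := exists_ratio_hasDerivAt_eq_ratio_slope h _ hxy
      (fun t ht => (hhd t (hsub ht)).continuousAt.continuousWithinAt)
      (fun t ht => hhd t (hsub (Ioo_subset_Icc_self ht))) g _
      (fun t ht => (hgd t (hsub ht)).continuousAt.continuousWithinAt)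
      (fun t ht => hgd t (hsub (Ioo_subset_Icc_self ht)))
    have hξ' : ξ ∈ Ioo a d := ⟨hx.1.trans_lt hξ.1, hξ.2.trans_le hy.2⟩
    refine ⟨ξ, hξ, ?_⟩
    have hn := (hNpos ξ (hIoo hξ')).ne'
    have hcc := (hcpos ξ (hIoo hξ')).ne'
    have hf := hpos ξ hξ'
    have hvsq : ((F1 ξ) ^ (-(1 / 2) : ℝ)) ^ 2 * F1 ξ = 1 := by
      rw [← Real.rpow_natCast, ← Real.rpow_mul hf.le, ← Real.rpow_add_one hf.ne']
      norm_num
    simp only [hu, hC]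
    field_simp at he
    linear_combination ((F1 ξ) ^ (-(1 / 2) : ℝ)) ^ 2 * he - (g y - g x) * E * Real.cos (κ * (ξ - m)) ^ 2 * hvsq
  obtain ⟨ξ1, m1, e1⟩ := cauchy ma mb hab
  obtain ⟨ξ2, m2, e2⟩ := cauchy mb mc hbc
  obtain ⟨ξ3, m3, e3⟩ := cauchy mc md hcd
  have n1 : ξ1 ∈ Ioo a d := ⟨m1.1, by linarith [m1.2]⟩
  have n2 : ξ2 ∈ Ioo a d := ⟨by linarith [m2.1], by linarith [m2.2]⟩
  have n3 : ξ3 ∈ Ioo a d := ⟨by linarith [m3.1], m3.2⟩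
  have cp := fun {x} (hx : x ∈ Ioo a d) => hcpos x (hIoo hx)
  have up : ∀ x ∈ Ioo a d, 0 < u x := fun x hx =>
    mul_pos (Real.rpow_pos_of_pos (hpos x hx) _) (hNpos x (hIoo hx))
  have r1 : (u ξ1 / C ξ1) ^ 2 = E := by
    rw [div_pow, div_eq_iff (pow_pos (cp n1) 2).ne']
    rw [ha, hb] at e1
    exact (mul_left_cancel₀ (by linarith : g b - g a ≠ 0) e1).symm
  have r2 : E < (u ξ2 / C ξ2) ^ 2 := by
    rw [div_pow, lt_div_iff₀ (pow_pos (cp n2) 2)]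
    rw [hb] at e2
    have : (g c - g b) * (E * C ξ2 ^ 2) < (g c - g b) * u ξ2 ^ 2 := by
      rw [e2]
      exact mul_lt_mul_of_pos_right (by linarith) (pow_pos (up ξ2 n2) 2)
    exact lt_of_mul_lt_mul_left this (by linarith)
  have r3 : (u ξ3 / C ξ3) ^ 2 < E := by
    rw [div_pow, div_lt_iff₀ (pow_pos (cp n3) 2)]
    rw [hd'] at e3
    have : (g d - g c) * u ξ3 ^ 2 < (g d - g c) * (E * C ξ3 ^ 2) := by
      rw [e3]
      exact mul_lt_mul_of_pos_right (by linarith) (pow_pos (up ξ3 n3) 2)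
    exact lt_of_mul_lt_mul_left this (by linarith)
  have p1 : 0 < u ξ1 / C ξ1 := div_pos (up _ n1) (cp n1)
  have p2 : 0 < u ξ2 / C ξ2 := div_pos (up _ n2) (cp n2)
  have p3 : 0 < u ξ3 / C ξ3 := div_pos (up _ n3) (cp n3)
  have l12 : u ξ1 / C ξ1 < u ξ2 / C ξ2 := lt_of_pow_lt_pow_left₀ 2 p2.le (by linarith)
  have l32 : u ξ3 / C ξ3 < u ξ2 / C ξ2 := lt_of_pow_lt_pow_left₀ 2 p2.le (by linarith)
  have := quasiconvex_of_schwarzian hF1 hF2 hpos hS hcpos hNpos hNd n1 n3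
    (m1.2.trans m2.1) (m2.2.trans m3.1) l12
  linarith

theorem exp_neg_le_one_sub {y : ℝ} (h0 : 0 ≤ y) (h1 : y ≤ 1 / 2) : Real.exp (-(2 * y)) ≤ 1 - y := by
  rw [Real.exp_neg, inv_le_comm₀ (Real.exp_pos _) (by linarith)]
  have h2 := Real.add_one_le_exp (2 * y)
  refine le_trans ?_ h2
  rw [inv_le_iff_one_le_mul₀ (by linarith)]
  nlinarith

theorem tan_slope_bounds {a d κ : ℝ} (hκ : 0 < κ) (hκd : κ * (d - a) ≤ 1)
    {x y : ℝ} (hx : a ≤ x) (hy : y ≤ d) (hxy : x < y) :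
    y - x ≤ Real.tan (κ * (y - (a + d) / 2)) / κ - Real.tan (κ * (x - (a + d) / 2)) / κ ∧
      (1 - (κ * (d - a)) ^ 2 / 8) ^ 2 * (Real.tan (κ * (y - (a + d) / 2)) / κ -
        Real.tan (κ * (x - (a + d) / 2)) / κ) ≤ y - x := by
  set m := (a + d) / 2 with hm
  have hcos : ∀ t ∈ Icc x y, 1 - (κ * (d - a)) ^ 2 / 8 ≤ Real.cos (κ * (t - m)) := by
    intro t ht
    refine le_trans ?_ (Real.one_sub_sq_div_two_le_cos (x := κ * (t - m)))
    have h1 : |κ * (t - m)| ≤ |κ * (d - a) / 2| := by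
      rw [abs_of_nonneg (a := κ * (d - a) / 2)
        (by have : 0 ≤ d - a := by linarith [ht.1, ht.2]
            positivity), abs_mul, abs_of_pos hκ, mul_div_assoc]
      gcongr
      rw [abs_le]
      constructor <;> rw [hm] <;> linarith [ht.1, ht.2]
    have := sq_le_sq.2 h1
    linarith
  have hda : 0 ≤ κ * (d - a) := by
    have : 0 ≤ d - a := by linarith
    positivity
  have hc0 : 0 < 1 - (κ * (d - a)) ^ 2 / 8 := by nlinarith
  have hder : ∀ t ∈ Icc x y, HasDerivAt (fun x => Real.tan (κ * (x - m)) / κ)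
      (1 / Real.cos (κ * (t - m)) ^ 2) t := by
    intro t ht
    have h1 : HasDerivAt (fun x => κ * (x - m)) κ t := by
      simpa using ((hasDerivAt_id t).sub_const m).const_mul κ
    have h2 := ((Real.hasDerivAt_tan (hc0.trans_le (hcos t ht)).ne').comp t h1).div_const κ
    refine h2.congr_deriv ?_
    field_simp
  obtain ⟨ξ, hξ, he⟩ := exists_hasDerivAt_eq_slope (fun x => Real.tan (κ * (x - m)) / κ) _ hxy
    (fun t ht => (hder t ht).continuousAt.continuousWithinAt)
    (fun t ht => hder t (Ioo_subset_Icc_self ht))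
  rw [eq_div_iff (by linarith)] at he
  have hlow := hcos ξ (Ioo_subset_Icc_self hξ)
  have hcp := hc0.trans_le hlow
  have hle1 := Real.cos_le_one (κ * (ξ - m))
  rw [← he]
  have hyx : 0 < y - x := by linarith
  constructor
  · have : 1 ≤ 1 / Real.cos (κ * (ξ - m)) ^ 2 := by
      rw [le_div_iff₀ (by positivity), one_mul]
      exact pow_le_one₀ hcp.le hle1
    nlinarith
  · have : (1 - (κ * (d - a)) ^ 2 / 8) ^ 2 * (1 / Real.cos (κ * (ξ - m)) ^ 2) ≤ 1 := by
      rw [mul_one_div, div_le_one (by positivity)]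
      exact pow_le_pow_left₀ hc0.le hlow 2
    nlinarith

theorem exp_mul_drat_le {F F1 F2 F3 : ℝ → ℝ} {a b c d κ : ℝ} (hκ : 0 < κ)
    (hab : a < b) (hbc : b < c) (hcd : c < d) (hκd : κ * (d - a) ≤ 1)
    (hF : ∀ x, HasDerivAt F (F1 x) x) (hF1 : ∀ x, HasDerivAt F1 (F2 x) x)
    (hF2 : ∀ x, HasDerivAt F2 (F3 x) x) (hmono : StrictMono F)
    (hpos : ∀ x ∈ Ioo a d, 0 < F1 x)
    (hS : ∀ x ∈ Ioo a d, F3 x * F1 x - 3 / 2 * F2 x ^ 2 ≤ 2 * κ ^ 2 * F1 x ^ 2) :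
    Real.exp (-(κ ^ 2 * (d - a) ^ 2)) * drat a b c d ≤ drat (F a) (F b) (F c) (F d) := by
  have key := cross_le_tan hκ hab hbc hcd hκd hF hF1 hF2 hmono hpos hS rfl
  have s1 := (tan_slope_bounds hκ hκd le_rfl le_rfl (hab.trans (hbc.trans hcd))).1
  have s2 := (tan_slope_bounds hκ hκd hab.le hcd.le hbc).1
  have s3 := (tan_slope_bounds hκ hκd le_rfl (hbc.trans hcd).le hab)
  have s4 := (tan_slope_bounds hκ hκd (hab.trans hbc).le le_rfl hcd)
  set g : ℝ → ℝ := fun x => Real.tan (κ * (x - (a + d) / 2)) / κ with hg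
  change (g d - g a) * (g c - g b) * _ ≤ _ * ((g b - g a) * (g d - g c)) at key
  change d - a ≤ g d - g a at s1
  change c - b ≤ g c - g b at s2
  change b - a ≤ g b - g a ∧ _ * (g b - g a) ≤ _ at s3
  change d - c ≤ g d - g c ∧ _ * (g d - g c) ≤ _ at s4
  clear_value g
  clear hg
  have hda : 0 < κ * (d - a) := mul_pos hκ (by linarith)
  set e := (1 - (κ * (d - a)) ^ 2 / 8) with he
  have hee : Real.exp (-(κ ^ 2 * (d - a) ^ 2)) ≤ e ^ 4 := by
    have h1 := exp_neg_le_one_sub (y := (κ * (d - a)) ^ 2 / 8) (by positivity) (by nlinarith)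
    calc Real.exp (-(κ ^ 2 * (d - a) ^ 2))
        = Real.exp (-(2 * ((κ * (d - a)) ^ 2 / 8))) ^ 4 := by
          rw [← Real.exp_nat_mul]; congr 1; push_cast; ring
      _ ≤ e ^ 4 := pow_le_pow_left₀ (Real.exp_pos _).le h1 4
  have fab := hmono hab
  have fbc := hmono hbc
  have fcd := hmono hcd
  have hDr : 0 ≤ drat a b c d :=
    div_nonneg (mul_nonneg (by linarith) (by linarith)) (mul_nonneg (by linarith) (by linarith))
  refine (mul_le_mul_of_nonneg_right hee hDr).trans ?_
  rw [drat, drat, ← mul_div_assoc, div_le_div_iff₀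
    (mul_pos (by linarith) (by linarith)) (mul_pos (by linarith) (by linarith))]
  have q1 : (d - a) * (c - b) ≤ (g d - g a) * (g c - g b) :=
    mul_le_mul s1 s2 (by linarith) (by linarith)
  have q2 : (e ^ 2 * (g b - g a)) * (e ^ 2 * (g d - g c)) ≤ (b - a) * (d - c) :=
    mul_le_mul s3.2 s4.2 (mul_nonneg (sq_nonneg _) (by linarith)) (by linarith)
  have P : 0 ≤ (F b - F a) * (F d - F c) := mul_nonneg (by linarith) (by linarith)
  have Q : 0 ≤ (F d - F a) * (F c - F b) := mul_nonneg (by linarith) (by linarith)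
  calc e ^ 4 * ((d - a) * (c - b)) * ((F b - F a) * (F d - F c))
      ≤ e ^ 4 * ((g d - g a) * (g c - g b)) * ((F b - F a) * (F d - F c)) := by gcongr
    _ = e ^ 4 * ((g d - g a) * (g c - g b) * ((F b - F a) * (F d - F c))) := by ring
    _ ≤ e ^ 4 * ((F d - F a) * (F c - F b) * ((g b - g a) * (g d - g c))) := by gcongr
    _ = (F d - F a) * (F c - F b) * ((e ^ 2 * (g b - g a)) * (e ^ 2 * (g d - g c))) := by ring
    _ ≤ _ := by gcongr

/-- `NonFlatAt` with prescribed criticality `d`. -/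
def NonFlatOfOrder (F : ℝ → ℝ) (c d : ℝ) : Prop :=
  ∃ W : Set ℝ, IsOpen W ∧ c ∈ W ∧ ∃ φ : ℝ → ℝ,
    ContDiffOn ℝ 3 φ W ∧ (∀ y ∈ W, deriv φ y ≠ 0) ∧ φ c = 0 ∧
    ∀ y ∈ W, F y = F c + φ y * |φ y| ^ (d - 1)

theorem NonFlatOfOrder.neg {F : ℝ → ℝ} {c d : ℝ} (h : NonFlatOfOrder F c d) :
    NonFlatOfOrder (fun x => -F (-x)) (-c) d := by
  obtain ⟨W, hW, hc, φ, hφ, hφ', h0, he⟩ := h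
  refine ⟨Neg.neg ⁻¹' W, hW.preimage continuous_neg, by simpa using hc, fun x => -φ (-x),
    (hφ.comp contDiff_neg.contDiffOn fun x hx => hx).neg, fun y hy => ?_, by simpa using h0,
    fun y hy => ?_⟩
  · rw [deriv.fun_neg, deriv_comp_neg, neg_neg]
    exact hφ' _ hy
  · have := he (-y) hy
    simp only [neg_neg, abs_neg]
    rw [this]; ring

theorem NonFlatOfOrder.add_int {F : ℝ → ℝ} (hdeg : ∀ (x : ℝ) (m : ℤ), F (x + m) = F x + m)
    {c d : ℝ} (h : NonFlatOfOrder F c d) (m : ℤ) : NonFlatOfOrder F (c + m) d := by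
  obtain ⟨W, hW, hc, φ, hφ, hφ', h0, he⟩ := h
  refine ⟨(fun x => x - m) ⁻¹' W, hW.preimage (by fun_prop), by simpa using hc, fun x => φ (x - m),
    hφ.comp (by fun_prop) fun x hx => hx, fun y hy => ?_, by simpa using h0,
    fun y hy => ?_⟩
  · rw [deriv_comp_sub_const]
    exact hφ' _ hy
  · have h1 := he (y - m) hy
    have h2 := hdeg (y - m) m
    rw [sub_add_cancel] at h2
    rw [hdeg, h2, h1]; ring

theorem nonFlat_right_bounds {F F1 F2 F3 : ℝ → ℝ} (hF : ∀ x, HasDerivAt F (F1 x) x)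
    (hF1 : ∀ x, HasDerivAt F1 (F2 x) x) (hF2 : ∀ x, HasDerivAt F2 (F3 x) x)
    (hmono : StrictMono F) {c d : ℝ} (hd : 1 < d) (h : NonFlatOfOrder F c d) :
    ∃ ε > 0, ∃ k₁ > 0, ∃ k₂ > 0, ∃ κ ≥ 0, ∀ y ∈ Ioo c (c + ε),
      k₁ * (y - c) ^ (d - 1) ≤ F1 y ∧ F1 y ≤ k₂ * (y - c) ^ (d - 1) ∧
      F3 y * F1 y - 3 / 2 * F2 y ^ 2 ≤ κ * F1 y ^ 2 := by
  obtain ⟨W, hW, hc, φ, hφ, hφ', h0, he⟩ := h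
  have c1 : ContDiffOn ℝ 2 (deriv φ) W := hφ.deriv_of_isOpen hW (by norm_num)
  have c2 : ContDiffOn ℝ 1 (deriv (deriv φ)) W := c1.deriv_of_isOpen hW (by norm_num)
  have c3 : ContDiffOn ℝ 0 (deriv (deriv (deriv φ))) W := c2.deriv_of_isOpen hW (by norm_num)
  have d0 : ∀ x ∈ W, HasDerivAt φ (deriv φ x) x := fun x hx =>
    ((hφ.differentiableOn (by norm_num)).differentiableAt (hW.mem_nhds hx)).hasDerivAt
  have d1 : ∀ x ∈ W, HasDerivAt (deriv φ) (deriv (deriv φ) x) x := fun x hx =>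
    ((c1.differentiableOn (by norm_num)).differentiableAt (hW.mem_nhds hx)).hasDerivAt
  have d2 : ∀ x ∈ W, HasDerivAt (deriv (deriv φ)) (deriv (deriv (deriv φ)) x) x := fun x hx =>
    ((c2.differentiableOn (by norm_num)).differentiableAt (hW.mem_nhds hx)).hasDerivAt
  have k3 : ContinuousAt (deriv (deriv (deriv φ))) c :=
    (c3.continuousOn).continuousAt (hW.mem_nhds hc)
  set φ1 := deriv φ
  set φ2 := deriv φ1
  set φ3 := deriv φ2
  have hne : φ1 c ≠ 0 := hφ' c hc
  have k1 : ContinuousAt φ1 c := (d1 c hc).continuousAt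
  have ev1 : ∀ᶠ x in 𝓝 c, |φ1 x - φ1 c| < |φ1 c| / 2 := by
    have := Metric.continuousAt_iff'.1 k1 (|φ1 c| / 2) (by positivity)
    simpa [Real.dist_eq] using this
  have ev3 : ∀ᶠ x in 𝓝 c, |φ3 x - φ3 c| < 1 := by
    have := Metric.continuousAt_iff'.1 k3 1 one_pos
    simpa [Real.dist_eq] using this
  obtain ⟨ε, hε, hball⟩ := Metric.eventually_nhds_iff.1 ((hW.eventually_mem hc).and (ev1.and ev3))
  have hmem : ∀ y ∈ Ico c (c + ε), y ∈ W ∧ |φ1 y - φ1 c| < |φ1 c| / 2 ∧ |φ3 y - φ3 c| < 1 := by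
    intro y hy
    refine hball ?_
    rw [Real.dist_eq, abs_of_nonneg (by linarith [hy.1])]
    linarith [hy.2]
  have hφpos : ∀ y ∈ Ioo c (c + ε), 0 < φ y := by
    intro y hy
    have h1 := he y (hmem y ⟨hy.1.le, hy.2⟩).1
    have h2 := hmono hy.1
    by_contra hle
    have : φ y * |φ y| ^ (d - 1) ≤ 0 :=
      mul_nonpos_of_nonpos_of_nonneg (not_lt.1 hle) (by positivity)
    linarith
  have hmv : ∀ y ∈ Ioo c (c + ε), ∃ ξ ∈ Ioo c y, φ y = φ1 ξ * (y - c) := by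
    intro y hy
    obtain ⟨ξ, hξ, hξe⟩ := exists_hasDerivAt_eq_slope φ φ1 hy.1
      (fun t ht => (d0 t (hmem t ⟨ht.1, ht.2.trans_lt hy.2⟩).1).continuousAt.continuousWithinAt)
      (fun t ht => d0 t (hmem t ⟨ht.1.le, ht.2.trans hy.2⟩).1)
    refine ⟨ξ, hξ, ?_⟩
    rw [eq_div_iff (by linarith [hy.1]), h0, sub_zero] at hξe
    exact hξe.symm
  have hpos : 0 < φ1 c := by
    have hy : c + ε / 2 ∈ Ioo c (c + ε) := ⟨by linarith, by linarith⟩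
    obtain ⟨ξ, hξ, hξe⟩ := hmv _ hy
    have h1 := hφpos _ hy
    have h2 := (hmem ξ ⟨hξ.1.le, hξ.2.trans hy.2⟩).2.1
    by_contra hle
    have h3 : φ1 c < 0 := lt_of_le_of_ne (not_lt.1 hle) hne
    rw [abs_of_neg h3] at h2
    have h4 := (abs_lt.1 h2).2
    have h5 : φ1 ξ < 0 := by linarith
    have h6 := hξ.1
    have h7 := hy.1
    rw [hξe] at h1
    exact absurd h1 (not_lt.2 (mul_nonpos_of_nonpos_of_nonneg h5.le (by linarith)))
  rw [abs_of_pos hpos] at hmem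
  set m₁ := φ1 c / 2 with hm₁
  set m₂ := 3 / 2 * φ1 c with hm₂
  have hm₁p : 0 < m₁ := by rw [hm₁]; linarith
  have hm₂p : 0 < m₂ := by rw [hm₂]; linarith
  have b1 : ∀ y ∈ Ico c (c + ε), m₁ ≤ φ1 y ∧ φ1 y ≤ m₂ := by
    intro y hy
    have := abs_lt.1 (hmem y hy).2.1
    constructor <;> linarith [this.1, this.2]
  have b0 : ∀ y ∈ Ioo c (c + ε), m₁ * (y - c) ≤ φ y ∧ φ y ≤ m₂ * (y - c) := by
    intro y hy
    obtain ⟨ξ, hξ, hξe⟩ := hmv y hy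
    have h1 := b1 ξ ⟨hξ.1.le, hξ.2.trans hy.2⟩
    have h2 : 0 ≤ y - c := by linarith [hy.1]
    rw [hξe]
    exact ⟨mul_le_mul_of_nonneg_right h1.1 h2, mul_le_mul_of_nonneg_right h1.2 h2⟩
  have hsub : Ioo c (c + ε) ⊆ Ico c (c + ε) := Ioo_subset_Ico_self
  have f0 : ∀ y ∈ Ioo c (c + ε), F y = F c + φ y ^ d := by
    intro y hy
    have hp := hφpos y hy
    rw [he y (hmem y (hsub hy)).1, abs_of_pos hp, mul_comm, ← Real.rpow_add_one hp.ne',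
      sub_add_cancel]
  have f1 : ∀ y ∈ Ioo c (c + ε), F1 y = d * φ y ^ (d - 1) * φ1 y := by
    intro y hy
    have h1 : HasDerivAt F (φ1 y * d * φ y ^ (d - 1)) y :=
      (((d0 y (hmem y (hsub hy)).1).rpow_const (p := d)
        (Or.inl (hφpos y hy).ne')).const_add (F c)).congr_of_eventuallyEq
        (Filter.eventuallyEq_of_mem (isOpen_Ioo.mem_nhds hy) f0)
    rw [(hF y).unique h1]; ring
  have f2 : ∀ y ∈ Ioo c (c + ε), F2 y = d * (d - 1) * φ y ^ (d - 2) * φ1 y ^ 2 +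
      d * φ y ^ (d - 1) * φ2 y := by
    intro y hy
    have hw := (hmem y (hsub hy)).1
    have h1 := ((((d0 y hw).rpow_const (p := d - 1)
        (Or.inl (hφpos y hy).ne')).const_mul d).mul (d1 y hw)).congr_of_eventuallyEq
        (Filter.eventuallyEq_of_mem (isOpen_Ioo.mem_nhds hy) f1)
    rw [(hF1 y).unique h1, show d - 1 - 1 = d - 2 by ring]; ring
  have f3 : ∀ y ∈ Ioo c (c + ε), F3 y = d * (d - 1) * (d - 2) * φ y ^ (d - 3) * φ1 y ^ 3 +
      3 * d * (d - 1) * φ y ^ (d - 2) * φ1 y * φ2 y + d * φ y ^ (d - 1) * φ3 y := by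
    intro y hy
    have hw := (hmem y (hsub hy)).1
    have h1 := (((((d0 y hw).rpow_const (p := d - 2)
        (Or.inl (hφpos y hy).ne')).const_mul (d * (d - 1))).mul ((d1 y hw).pow 2)).add
        ((((d0 y hw).rpow_const (p := d - 1)
        (Or.inl (hφpos y hy).ne')).const_mul d).mul (d2 y hw))).congr_of_eventuallyEq
        (Filter.eventuallyEq_of_mem (isOpen_Ioo.mem_nhds hy) f2)
    rw [(hF2 y).unique h1, show d - 2 - 1 = d - 3 by ring, show d - 1 - 1 = d - 2 by ring]
    simp only [Pi.pow_apply]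
    push_cast
    ring
  refine ⟨ε, hε, d * m₁ ^ (d - 1) * m₁, by positivity, d * m₂ ^ (d - 1) * m₂, by positivity,
    (|φ3 c| + 1) / m₁, by positivity, fun y hy => ?_⟩
  have hp := hφpos y hy
  have hyc : 0 < y - c := by linarith [hy.1]
  have hb0 := b0 y hy
  have hb1 := b1 y (hsub hy)
  have hd1 : 0 ≤ d - 1 := by linarith
  refine ⟨?_, ?_, ?_⟩
  · rw [f1 y hy]
    calc d * m₁ ^ (d - 1) * m₁ * (y - c) ^ (d - 1) = d * (m₁ * (y - c)) ^ (d - 1) * m₁ := by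
          rw [Real.mul_rpow hm₁p.le hyc.le]; ring
      _ ≤ _ := by
          gcongr
          · exact hb0.1
          · exact hb1.1
  · rw [f1 y hy]
    calc d * φ y ^ (d - 1) * φ1 y ≤ d * (m₂ * (y - c)) ^ (d - 1) * m₂ := by
          have : 0 ≤ φ1 y := hm₁p.le.trans hb1.1
          gcongr
          · exact hb0.2
          · exact hb1.2
      _ = _ := by rw [Real.mul_rpow hm₂p.le hyc.le]; ring
  · rw [f1 y hy, f2 y hy, f3 y hy]
    have r2 : φ y ^ (d - 2) = φ y ^ (d - 3) * φ y := by
      rw [← Real.rpow_add_one hp.ne']; congr 1; ring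
    have r1 : φ y ^ (d - 1) = φ y ^ (d - 3) * φ y ^ 2 := by
      rw [← Real.rpow_natCast, ← Real.rpow_add hp]; congr 1; push_cast; ring
    rw [r1, r2]
    have hP : 0 < φ y ^ (d - 3) := Real.rpow_pos_of_pos hp _
    set P := φ y ^ (d - 3)
    have h3 : φ3 y ≤ (|φ3 c| + 1) / m₁ * φ1 y := by
      have t1 := (abs_lt.1 (hmem y (hsub hy)).2.2).2
      have t2 := le_abs_self (φ3 c)
      have t3 : |φ3 c| + 1 = (|φ3 c| + 1) / m₁ * m₁ := by field_simp
      have t4 : (|φ3 c| + 1) / m₁ * m₁ ≤ (|φ3 c| + 1) / m₁ * φ1 y := by gcongr; exact hb1.1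
      linarith
    have hφ1p : 0 < φ1 y := hm₁p.trans_le hb1.1
    have e1 : 0 ≤ d ^ 2 * P ^ 2 * φ y ^ 4 * φ1 y * ((|φ3 c| + 1) / m₁ * φ1 y - φ3 y) :=
      mul_nonneg (by positivity) (by linarith)
    have e2 : 0 ≤ d ^ 2 * P ^ 2 * φ y ^ 2 * ((d ^ 2 - 1) / 2 * φ1 y ^ 4) :=
      mul_nonneg (by positivity) (mul_nonneg (by nlinarith) (by positivity))
    have e3 : 0 ≤ d ^ 2 * P ^ 2 * φ y ^ 4 * (3 / 2 * φ2 y ^ 2) := by positivity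
    linear_combination e1 + e2 + e3

/-- Number of the circle points represented by `S` met by the interval `(a, d)`. -/
def critCount (S : Finset ℝ) (a d : ℝ) : ℝ :=
  open Classical in ∑ s ∈ S, if ∃ m : ℤ, s + m ∈ Ioo a d then 1 else 0

/-- Lifts of circle homeomorphisms with power-law critical points (represented by) `S`, described
through their action on cross-ratios. -/
structure CritLift (F : ℝ → ℝ) (S : Finset ℝ) : Prop where
  mono : StrictMono F
  surj : Function.Surjective F
  deg : ∀ x, F (x + 1) = F x + 1
  cross : ∃ K ≥ (0 : ℝ), ∀ a b c d, a < b → b < c → c < d → d ≤ a + 1 →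
    crat (F a) (F b) (F c) (F d) ≤ Real.exp (K * ((d - a) + critCount S a d)) * crat a b c d
  dist : ∃ B ≥ (0 : ℝ), ∃ δ > (0 : ℝ), ∀ a b c d, a < b → b < c → c < d → d - a < δ →
    (∀ s ∈ S, ∀ m : ℤ, s + m ∉ Ioo a d) →
    Real.exp (-(B * (d - a) ^ 2)) * drat a b c d ≤ drat (F a) (F b) (F c) (F d)
  power : ∀ c ∈ S, ∃ p > (1 : ℝ), ∃ ε > 0, ∃ k₁ > 0, ∃ k₂ > 0, ∀ y, |y - c| < ε →
    k₁ * |y - c| ^ p ≤ |F y - F c| ∧ |F y - F c| ≤ k₂ * |y - c| ^ p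

theorem nonFlat_bounds {F F1 F2 F3 : ℝ → ℝ} (hF : ∀ x, HasDerivAt F (F1 x) x)
    (hF1 : ∀ x, HasDerivAt F1 (F2 x) x) (hF2 : ∀ x, HasDerivAt F2 (F3 x) x)
    (hmono : StrictMono F) {c d : ℝ} (hd : 1 < d) (h : NonFlatOfOrder F c d) (hc : F1 c = 0) :
    ∃ ε > 0, ∃ k₁ > 0, ∃ k₂ > 0, ∃ κ ≥ 0, ∀ y, |y - c| < ε →
      k₁ * |y - c| ^ (d - 1) ≤ F1 y ∧ F1 y ≤ k₂ * |y - c| ^ (d - 1) ∧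
      F3 y * F1 y - 3 / 2 * F2 y ^ 2 ≤ κ * F1 y ^ 2 := by
  obtain ⟨ε, hε, k₁, hk₁, k₂, hk₂, κ, hκ, H⟩ := nonFlat_right_bounds hF hF1 hF2 hmono hd h
  have negd : ∀ {f f' : ℝ → ℝ}, (∀ x, HasDerivAt f (f' x) x) →
      ∀ x, HasDerivAt (fun x => f (-x)) (-f' (-x)) x := by
    intro f f' hf x
    exact ((hf (-x)).comp x (hasDerivAt_neg x)).congr_deriv (by ring)
  obtain ⟨ε', hε', k₁', hk₁', k₂', hk₂', κ', hκ', H'⟩ :=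
    nonFlat_right_bounds (F := fun x => -F (-x)) (F1 := fun x => F1 (-x))
      (F2 := fun x => -F2 (-x)) (F3 := fun x => F3 (-x))
      (fun x => ((negd hF x).fun_neg).congr_deriv (neg_neg _)) (fun x => negd hF1 x)
      (fun x => ((negd hF2 x).fun_neg).congr_deriv (neg_neg _))
      (fun x y hxy => neg_lt_neg (hmono (neg_lt_neg hxy))) hd h.neg
  have hd0 : 0 < d - 1 := by linarith
  refine ⟨min ε ε', lt_min hε hε', min k₁ k₁', lt_min hk₁ hk₁', max k₂ k₂', lt_max_of_lt_left hk₂,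
    max κ κ', le_max_of_le_left hκ, fun y hy => ?_⟩
  rcases lt_trichotomy y c with hyc | rfl | hyc
  · rw [abs_of_neg (by linarith)] at hy ⊢
    obtain ⟨h1, h2, h3⟩ := H' (-y) ⟨by linarith, by linarith [min_le_right ε ε']⟩
    simp only [neg_neg, sub_neg_eq_add] at h1 h2 h3
    have hp : 0 < (-(y - c)) ^ (d - 1) := Real.rpow_pos_of_pos (by linarith) _
    rw [show -y + c = -(y - c) by ring] at h1 h2
    refine ⟨le_trans ?_ h1, h2.trans ?_, ?_⟩
    · gcongr; exact min_le_right _ _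
    · gcongr; exact le_max_right _ _
    · have : κ' * F1 y ^ 2 ≤ max κ κ' * F1 y ^ 2 := by gcongr; exact le_max_right _ _
      nlinarith
  · simp only [sub_self, abs_zero, Real.zero_rpow hd0.ne', mul_zero, hc]
    refine ⟨le_rfl, le_rfl, by nlinarith [sq_nonneg (F2 y)]⟩
  · rw [abs_of_pos (by linarith)] at hy ⊢
    obtain ⟨h1, h2, h3⟩ := H y ⟨by linarith, by linarith [min_le_left ε ε']⟩
    have hp : 0 < (y - c) ^ (d - 1) := Real.rpow_pos_of_pos (by linarith) _
    refine ⟨le_trans ?_ h1, h2.trans ?_, h3.trans ?_⟩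
    · gcongr; exact min_le_left _ _
    · gcongr; exact le_max_left _ _
    · gcongr; exact le_max_left _ _

theorem increment_bounds {F F1 : ℝ → ℝ} (hF : ∀ x, HasDerivAt F (F1 x) x) (hmono : StrictMono F)
    {c p ε k₁ k₂ : ℝ} (hp : 0 < p) (hk₁ : 0 < k₁) (hk₂ : 0 < k₂)
    (h : ∀ y, |y - c| < ε → k₁ * |y - c| ^ p ≤ F1 y ∧ F1 y ≤ k₂ * |y - c| ^ p)
    {x y : ℝ} (hxy : x < y) (hx : |x - c| < ε) (hy : |y - c| < ε) :
    k₁ * (1 / 2) ^ p / 4 * ((y - x) * max |x - c| |y - c| ^ p) ≤ F y - F x ∧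
      F y - F x ≤ k₂ * ((y - x) * max |x - c| |y - c| ^ p) := by
  set M := max |x - c| |y - c| with hM
  have hM0 : 0 ≤ M := le_max_of_le_left (abs_nonneg _)
  have mvt : ∀ s t, s < t → ∃ ξ ∈ Ioo s t, F t - F s = F1 ξ * (t - s) := by
    intro s t hst
    obtain ⟨ξ, hξ, he⟩ := exists_hasDerivAt_eq_slope F F1 hst
      (fun u _ => (hF u).continuousAt.continuousWithinAt) (fun u _ => hF u)
    exact ⟨ξ, hξ, by rw [he, div_mul_cancel₀ _ (by linarith)]⟩
  have hxM : |x - c| ≤ M := le_max_left _ _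
  have hyM : |y - c| ≤ M := le_max_right _ _
  have hin : ∀ ξ, x ≤ ξ → ξ ≤ y → |ξ - c| ≤ M := by
    intro ξ h1 h2
    rw [abs_le] at hxM hyM ⊢
    constructor <;> linarith [hxM.1, hyM.2]
  have hMε : M < ε := max_lt hx hy
  constructor
  · obtain ⟨s, hs1, hs2, ξ, hξs, he, hξM⟩ : ∃ s ≤ F y - F x, 0 ≤ s ∧ ∃ ξ,
        (x ≤ ξ ∧ ξ ≤ y) ∧ s = F1 ξ * ((y - x) / 4) ∧ M / 2 ≤ |ξ - c| := by
      rcases le_total |x - c| |y - c| with hle | hle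
      · rw [max_eq_right hle] at hM
        have hyc : 0 ≤ y - c := by
          by_contra hlt
          rw [abs_of_neg (not_le.1 hlt), abs_of_neg (by linarith)] at hle
          linarith
        rw [abs_of_nonneg hyc] at hM hle
        have hx2 := (abs_le.1 hle).1
        obtain ⟨ξ, hξ, he⟩ := mvt (y - (y - x) / 4) y (by linarith)
        refine ⟨F y - F (y - (y - x) / 4), ?_, ?_, ξ, ⟨?_, hξ.2.le⟩, by rw [he]; ring, ?_⟩
        · have := hmono.monotone (show x ≤ y - (y - x) / 4 by linarith)
          linarith
        · have := hmono (show y - (y - x) / 4 < y by linarith)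
          linarith
        · linarith [hξ.1]
        · refine le_trans ?_ (le_abs_self _)
          linarith [hξ.1]
      · rw [max_eq_left hle] at hM
        have hxc : x - c ≤ 0 := by
          by_contra hlt
          rw [abs_of_pos (not_le.1 hlt), abs_of_pos (by linarith)] at hle
          linarith
        rw [abs_of_nonpos hxc] at hM hle
        have hy2 := (abs_le.1 hle).2
        obtain ⟨ξ, hξ, he⟩ := mvt x (x + (y - x) / 4) (by linarith)
        refine ⟨F (x + (y - x) / 4) - F x, ?_, ?_, ξ, ⟨hξ.1.le, ?_⟩, by rw [he]; ring, ?_⟩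
        · have := hmono.monotone (show x + (y - x) / 4 ≤ y by linarith)
          linarith
        · have := hmono (show x < x + (y - x) / 4 by linarith)
          linarith
        · linarith [hξ.2]
        · refine le_trans ?_ (neg_le_abs _)
          linarith [hξ.2]
    refine le_trans ?_ hs1
    rw [he]
    have h1 := (h ξ ((hin ξ hξs.1 hξs.2).trans_lt hMε)).1
    have h2 : (1 / 2) ^ p * M ^ p ≤ |ξ - c| ^ p := by
      rw [← Real.mul_rpow (by norm_num) hM0]
      exact Real.rpow_le_rpow (by linarith) (by linarith) hp.le
    have h3 : k₁ * ((1 / 2) ^ p * M ^ p) ≤ F1 ξ := by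
      refine le_trans ?_ h1
      gcongr
    have h4 := mul_le_mul_of_nonneg_right h3 (show 0 ≤ (y - x) / 4 by linarith)
    linarith
  · obtain ⟨ξ, hξ, he⟩ := mvt x y hxy
    have hξM := hin ξ hξ.1.le hξ.2.le
    have h1 := (h ξ (hξM.trans_lt hMε)).2
    have h2 : k₂ * |ξ - c| ^ p ≤ k₂ * M ^ p := by
      gcongr
    rw [he]
    have := mul_le_mul_of_nonneg_right (h1.trans h2) (show 0 ≤ y - x by linarith)
    linarith

theorem periodic_eq_fract {f : ℝ → ℝ} (hf : Function.Periodic f 1) (x : ℝ) :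
    f x = f (Int.fract x) := by
  have := hf.sub_int_mul_eq (x := x) ⌊x⌋
  rw [mul_one] at this
  exact this.symm

theorem deg_add_int {F : ℝ → ℝ} (hdeg : ∀ x, F (x + 1) = F x + 1) (x : ℝ) (m : ℤ) :
    F (x + m) = F x + m := by
  have hp : Function.Periodic (fun x => F x - x) 1 := by
    intro x; simp only; rw [hdeg]; ring
  have := hp.int_mul m x
  simp only [mul_one] at this
  linarith

theorem periodic_deriv {F F1 : ℝ → ℝ} {e : ℝ} (hdeg : ∀ x, F (x + 1) = F x + e)
    (hF : ∀ x, HasDerivAt F (F1 x) x) : Function.Periodic F1 1 := by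
  intro x
  have h1 := (hF (x + 1)).comp_add_const x 1
  have h2 : HasDerivAt (fun x => F (x + 1)) (F1 x) x := by
    simp only [hdeg]
    exact (hF x).add_const e
  exact h1.unique h2

/-- Global upper bound for the Schwarzian derivative. -/
theorem exists_schwarzian_bound {F F1 F2 F3 : ℝ → ℝ} (hF : ∀ x, HasDerivAt F (F1 x) x)
    (hF1 : ∀ x, HasDerivAt F1 (F2 x) x) (hF2 : ∀ x, HasDerivAt F2 (F3 x) x)
    (hF3 : Continuous F3) (hmono : StrictMono F) (hdeg : ∀ x, F (x + 1) = F x + 1)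
    (hcrit : ∀ c, F1 c = 0 → ∃ d > 1, NonFlatOfOrder F c d) :
    ∃ κ > 0, ∀ x, F3 x * F1 x - 3 / 2 * F2 x ^ 2 ≤ 2 * κ ^ 2 * F1 x ^ 2 := by
  have cF1 : Continuous F1 := continuous_iff_continuousAt.2 fun x => (hF1 x).continuousAt
  have cF2 : Continuous F2 := continuous_iff_continuousAt.2 fun x => (hF2 x).continuousAt
  have p1 : Function.Periodic F1 1 := periodic_deriv hdeg hF
  have p2 : Function.Periodic F2 1 := periodic_deriv (e := 0) (by simpa using p1) hF1
  have p3 : Function.Periodic F3 1 := periodic_deriv (e := 0) (by simpa using p2) hF2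
  obtain ⟨C, hC⟩ : ∃ C, ∀ x ∈ Icc (0 : ℝ) 1,
      F3 x * F1 x - 3 / 2 * F2 x ^ 2 ≤ C * F1 x ^ 2 := by
    refine isCompact_Icc.induction_on
      (p := fun s => ∃ C, ∀ x ∈ s, F3 x * F1 x - 3 / 2 * F2 x ^ 2 ≤ C * F1 x ^ 2)
      ⟨0, by simp⟩ ?_ ?_ ?_
    · rintro s t hst ⟨C, hC⟩
      exact ⟨C, fun x hx => hC x (hst hx)⟩
    · rintro s t ⟨C, hC⟩ ⟨C', hC'⟩
      refine ⟨max C C', fun x hx => ?_⟩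
      have hsq := sq_nonneg (F1 x)
      rcases hx with hx | hx
      · exact (hC x hx).trans (by gcongr; exact le_max_left _ _)
      · exact (hC' x hx).trans (by gcongr; exact le_max_right _ _)
    · intro x₀ _
      by_cases h0 : F1 x₀ = 0
      · obtain ⟨d, hd, hnf⟩ := hcrit x₀ h0
        obtain ⟨ε, hε, k₁, -, k₂, -, κ, -, H⟩ := nonFlat_bounds hF hF1 hF2 hmono hd hnf h0
        refine ⟨Metric.ball x₀ ε, mem_nhdsWithin_of_mem_nhds (Metric.ball_mem_nhds _ hε), κ, ?_⟩
        intro x hx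
        exact (H x (by simpa [Real.dist_eq] using hx)).2.2
      · have hcont : ContinuousAt (fun x => (F3 x * F1 x - 3 / 2 * F2 x ^ 2) / F1 x ^ 2) x₀ := by
          refine ContinuousAt.div ?_ ?_ (pow_ne_zero 2 h0) <;> fun_prop
        have e1 := hcont.eventually_lt_const (lt_add_one _)
        have e2 := cF1.continuousAt.eventually_ne h0
        refine ⟨_, mem_nhdsWithin_of_mem_nhds (e1.and e2),
          (F3 x₀ * F1 x₀ - 3 / 2 * F2 x₀ ^ 2) / F1 x₀ ^ 2 + 1, fun x hx => ?_⟩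
        have h1 := hx.1.le
        rwa [div_le_iff₀ (by have := hx.2; positivity)] at h1
  refine ⟨√(|C| + 1), by positivity, fun x => ?_⟩
  rw [Real.sq_sqrt (by positivity), periodic_eq_fract p1 x, periodic_eq_fract p2 x,
    periodic_eq_fract p3 x]
  refine (hC _ ⟨Int.fract_nonneg x, (Int.fract_lt_one x).le⟩).trans ?_
  gcongr
  linarith [le_abs_self C, abs_nonneg C]

/-- The slope of `F` on a subinterval is controlled by the slope on the whole interval. -/
theorem exists_slope_bound {F F1 F2 F3 : ℝ → ℝ} (hF : ∀ x, HasDerivAt F (F1 x) x)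
    (hF1 : ∀ x, HasDerivAt F1 (F2 x) x) (hF2 : ∀ x, HasDerivAt F2 (F3 x) x)
    (hmono : StrictMono F) (hdeg : ∀ x, F (x + 1) = F x + 1)
    (hcrit : ∀ c, F1 c = 0 → ∃ d > 1, NonFlatOfOrder F c d) :
    ∃ C ≥ 1, ∀ x y u v, y ≤ x + 1 → x ≤ u → u < v → v ≤ y →
      (F v - F u) * (y - x) ≤ C * ((F y - F x) * (v - u)) := by
  have cF1 : Continuous F1 := continuous_iff_continuousAt.2 fun x => (hF1 x).continuousAt
  have cF : Continuous F := continuous_iff_continuousAt.2 fun x => (hF x).continuousAt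
  have p1 : Function.Periodic F1 1 := periodic_deriv hdeg hF
  obtain ⟨L, hL⟩ : ∃ L, ∀ x, F1 x ≤ L := by
    obtain ⟨L, hL⟩ := isCompact_Icc.exists_bound_of_continuousOn (s := Icc (0 : ℝ) 1)
      cF1.continuousOn
    refine ⟨L, fun x => ?_⟩
    rw [periodic_eq_fract p1 x]
    exact (le_abs_self _).trans (hL _ ⟨Int.fract_nonneg x, (Int.fract_lt_one x).le⟩)
  have mvt : ∀ s t, s < t → ∃ ξ ∈ Ioo s t, F t - F s = F1 ξ * (t - s) := by
    intro s t hst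
    obtain ⟨ξ, hξ, he⟩ := exists_hasDerivAt_eq_slope F F1 hst
      (fun u _ => (hF u).continuousAt.continuousWithinAt) (fun u _ => hF u)
    exact ⟨ξ, hξ, by rw [he, div_mul_cancel₀ _ (by linarith)]⟩
  have F1nn : ∀ x, 0 ≤ F1 x := fun x => by
    rw [← (hF x).deriv]; exact hmono.monotone.deriv_nonneg
  obtain ⟨C, hC⟩ : ∃ C, ∀ z ∈ Icc (0 : ℝ) 1 ×ˢ Icc (0 : ℝ) 2, ∀ u v, z.1 ≤ u → u < v → v ≤ z.2 →
      (F v - F u) * (z.2 - z.1) ≤ C * ((F z.2 - F z.1) * (v - u)) := by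
    refine (isCompact_Icc.prod isCompact_Icc).induction_on
      (p := fun s => ∃ C, ∀ z ∈ s, ∀ u v, z.1 ≤ u → u < v → v ≤ z.2 →
      (F v - F u) * (z.2 - z.1) ≤ C * ((F z.2 - F z.1) * (v - u))) ⟨0, by simp⟩ ?_ ?_ ?_
    · rintro s t hst ⟨C, hC⟩
      exact ⟨C, fun x hx => hC x (hst hx)⟩
    · rintro s t ⟨C, hC⟩ ⟨C', hC'⟩
      refine ⟨max C C', fun z hz u v h1 h2 h3 => ?_⟩
      have hnn : 0 ≤ (F z.2 - F z.1) * (v - u) :=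
        mul_nonneg (by linarith [hmono.monotone (h1.trans (h2.le.trans h3))]) (by linarith)
      rcases hz with hz | hz
      · exact (hC z hz u v h1 h2 h3).trans (by gcongr; exact le_max_left _ _)
      · exact (hC' z hz u v h1 h2 h3).trans (by gcongr; exact le_max_right _ _)
    · rintro ⟨x₀, y₀⟩ _
      rcases lt_trichotomy x₀ y₀ with hlt | rfl | hlt
      · set η := (y₀ - x₀) / 3 with hη
        have hη0 : 0 < η := by rw [hη]; linarith
        have he : 0 < F (y₀ - η) - F (x₀ + η) := by
          have := hmono (show x₀ + η < y₀ - η by rw [hη]; linarith)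
          linarith
        refine ⟨Ioo (x₀ - η) (x₀ + η) ×ˢ Ioo (y₀ - η) (y₀ + η), mem_nhdsWithin_of_mem_nhds
          ((isOpen_Ioo.prod isOpen_Ioo).mem_nhds ⟨⟨by linarith, by linarith⟩,
            ⟨by linarith, by linarith⟩⟩),
          L * (y₀ - x₀ + 2 * η) / (F (y₀ - η) - F (x₀ + η)), ?_⟩
        rintro ⟨x, y⟩ ⟨hx, hy⟩ u v h1 h2 h3
        simp only at hx hy h1 h3 ⊢
        obtain ⟨ξ, -, hξ⟩ := mvt u v h2
        have hL0 : 0 ≤ L := (F1nn 0).trans (hL 0)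
        have a1 : F v - F u ≤ L * (v - u) := by
          rw [hξ]
          have := hL ξ
          have : 0 ≤ v - u := by linarith
          gcongr
        have a2 : F (y₀ - η) - F (x₀ + η) ≤ F y - F x := by
          have := hmono.monotone hy.1.le
          have := hmono.monotone hx.2.le
          linarith
        have a3 : 0 ≤ F v - F u := by linarith [hmono h2]
        calc (F v - F u) * (y - x) ≤ L * (v - u) * (y₀ - x₀ + 2 * η) := by
              have : 0 ≤ y - x := by linarith
              have : 0 ≤ v - u := by linarith
              gcongr
              linarith [hx.1, hy.2]
          _ = L * (y₀ - x₀ + 2 * η) / (F (y₀ - η) - F (x₀ + η)) *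
              ((F (y₀ - η) - F (x₀ + η)) * (v - u)) := by field_simp
          _ ≤ _ := by
              have : 0 ≤ v - u := by linarith
              have : 0 ≤ y₀ - x₀ + 2 * η := by linarith
              gcongr
      · by_cases h0 : F1 x₀ = 0
        · obtain ⟨d, hd, hnf⟩ := hcrit x₀ h0
          obtain ⟨ε, hε, k₁, hk₁, k₂, hk₂, κ, -, H⟩ := nonFlat_bounds hF hF1 hF2 hmono hd hnf h0
          refine ⟨Metric.ball x₀ ε ×ˢ Metric.ball x₀ ε, mem_nhdsWithin_of_mem_nhds
            (prod_mem_nhds (Metric.ball_mem_nhds _ hε) (Metric.ball_mem_nhds _ hε)),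
            k₂ / (k₁ * (1 / 2) ^ (d - 1) / 4), ?_⟩
          rintro ⟨x, y⟩ ⟨hx, hy⟩ u v h1 h2 h3
          simp only [Metric.mem_ball, Real.dist_eq] at hx hy h1 h3 ⊢
          have H' := fun y hy => And.intro (H y hy).1 (H y hy).2.1
          have huv : max |u - x₀| |v - x₀| ≤ max |x - x₀| |y - x₀| := by
            have e1 := neg_le_abs (x - x₀)
            have e2 := le_abs_self (y - x₀)
            have e3 := le_max_left |x - x₀| |y - x₀|
            have e4 := le_max_right |x - x₀| |y - x₀|
            refine max_le (abs_le.2 ⟨?_, ?_⟩) (abs_le.2 ⟨?_, ?_⟩) <;> linarith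
          have hMε : max |x - x₀| |y - x₀| < ε := max_lt hx hy
          have b1 := (increment_bounds hF hmono (by linarith) hk₁ hk₂ H' (by linarith) hx hy).1
          have b2 := (increment_bounds hF hmono (by linarith) hk₁ hk₂ H' h2
            (((le_max_left _ _).trans huv).trans_lt hMε)
            (((le_max_right _ _).trans huv).trans_lt hMε)).2
          have hk : 0 < k₁ * (1 / 2) ^ (d - 1) / 4 := by positivity
          have hmp : max |u - x₀| |v - x₀| ^ (d - 1) ≤ max |x - x₀| |y - x₀| ^ (d - 1) :=
            Real.rpow_le_rpow (le_max_of_le_left (abs_nonneg _)) huv (by linarith)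
          have hvu : 0 ≤ v - u := by linarith
          have hyx : 0 ≤ y - x := by linarith
          set q := k₁ * (1 / 2) ^ (d - 1) / 4
          calc (F v - F u) * (y - x)
              ≤ k₂ * ((v - u) * max |u - x₀| |v - x₀| ^ (d - 1)) * (y - x) := by gcongr
            _ ≤ k₂ * ((v - u) * max |x - x₀| |y - x₀| ^ (d - 1)) * (y - x) := by gcongr
            _ = k₂ / q * ((q * ((y - x) * max |x - x₀| |y - x₀| ^ (d - 1))) * (v - u)) := by
                field_simp
            _ ≤ _ := by gcongr
        · have hp : 0 < F1 x₀ := lt_of_le_of_ne (F1nn x₀) (Ne.symm h0)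
          have e1 := cF1.continuousAt.eventually (lt_mem_nhds (show F1 x₀ / 2 < F1 x₀ by linarith))
          have e2 := cF1.continuousAt.eventually (gt_mem_nhds (show F1 x₀ < 2 * F1 x₀ by linarith))
          obtain ⟨ε, hε, hball⟩ := Metric.eventually_nhds_iff.1 (e1.and e2)
          refine ⟨Metric.ball x₀ ε ×ˢ Metric.ball x₀ ε, mem_nhdsWithin_of_mem_nhds
            (prod_mem_nhds (Metric.ball_mem_nhds _ hε) (Metric.ball_mem_nhds _ hε)), 4, ?_⟩
          rintro ⟨x, y⟩ ⟨hx, hy⟩ u v h1 h2 h3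
          simp only [Metric.mem_ball, Real.dist_eq] at hx hy h1 h3 ⊢
          have hin : ∀ ξ, x ≤ ξ → ξ ≤ y → F1 x₀ / 2 < F1 ξ ∧ F1 ξ < 2 * F1 x₀ := by
            intro ξ t1 t2
            refine hball ?_
            rw [Real.dist_eq]
            rw [abs_lt] at hx hy ⊢
            constructor <;> linarith [hx.1, hy.2]
          obtain ⟨ξ, mξ, hξ⟩ := mvt u v h2
          obtain ⟨ζ, mζ, hζ⟩ := mvt x y (by linarith)
          have i1 := (hin ξ (by linarith [mξ.1]) (by linarith [mξ.2])).2
          have i2 := (hin ζ mζ.1.le mζ.2.le).1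
          rw [hξ, hζ]
          have hvu : 0 ≤ (v - u) * (y - x) := mul_nonneg (by linarith) (by linarith)
          have := mul_le_mul_of_nonneg_right (show F1 ξ ≤ 4 * F1 ζ by linarith) hvu
          linarith
      · refine ⟨{z | z.2 < z.1}, mem_nhdsWithin_of_mem_nhds
          ((isOpen_lt continuous_snd continuous_fst).mem_nhds hlt), 0, ?_⟩
        rintro z hz u v h1 h2 h3
        have hz' : z.2 < z.1 := hz
        linarith
  refine ⟨max C 1, le_max_right _ _, fun x y u v h1 h2 h3 h4 => ?_⟩
  have hs : ∀ t, F t = F (t - ⌊x⌋) + ⌊x⌋ := by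
    intro t
    have := deg_add_int hdeg (t - ⌊x⌋) ⌊x⌋
    rw [← this, sub_add_cancel]
  have hfl := Int.floor_le x
  have hfl2 := (Int.lt_floor_add_one x).le
  have := hC (x - ⌊x⌋, y - ⌊x⌋) ⟨⟨by linarith, by linarith⟩, ⟨by linarith, by linarith⟩⟩
    (u - ⌊x⌋) (v - ⌊x⌋) (sub_le_sub_right h2 _) (sub_lt_sub_right h3 _)
    (sub_le_sub_right h4 _)
  simp only [sub_sub_sub_cancel_right] at this
  rw [hs v, hs u, hs y, hs x]
  simp only [add_sub_add_right_eq_sub]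
  refine this.trans ?_
  have h5 := hmono.monotone (show x - ⌊x⌋ ≤ y - ⌊x⌋ by linarith)
  have : 0 ≤ (F (y - ⌊x⌋) - F (x - ⌊x⌋)) * (v - u) := mul_nonneg (by linarith) (by linarith)
  gcongr
  exact le_max_left _ _

theorem crat_pos {a b c d : ℝ} (hab : a < b) (hbc : b < c) (hcd : c < d) : 0 < crat a b c d := by
  have h1 : 0 < b - a := by linarith
  have h2 : 0 < d - c := by linarith
  have h3 : 0 < c - a := by linarith
  have h4 : 0 < d - b := by linarith
  unfold crat
  positivity

theorem drat_pos {a b c d : ℝ} (hab : a < b) (hbc : b < c) (hcd : c < d) : 0 < drat a b c d := by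
  have h1 : 0 < b - a := by linarith
  have h2 : 0 < d - c := by linarith
  have h3 : 0 < d - a := by linarith
  have h4 : 0 < c - b := by linarith
  unfold drat
  positivity

theorem crat_eq_inv {a b c d : ℝ} (hab : a < b) (hcd : c < d) :
    crat a b c d = (1 + drat a b c d)⁻¹ := by
  have h1 : b - a ≠ 0 := by linarith
  have h2 : d - c ≠ 0 := by linarith
  unfold crat drat
  have h3 : 1 + (d - a) * (c - b) / ((b - a) * (d - c)) =
      ((c - a) * (d - b)) / ((b - a) * (d - c)) := by
    field_simp
    ring
  rw [h3, inv_div]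

theorem crat_neg (a b c d : ℝ) : crat (-d) (-c) (-b) (-a) = crat a b c d := by
  unfold crat
  congr 1 <;> ring

theorem drat_neg (a b c d : ℝ) : drat (-d) (-c) (-b) (-a) = drat a b c d := by
  unfold drat
  congr 1 <;> ring

theorem crat_add (a b c d e : ℝ) : crat (a + e) (b + e) (c + e) (d + e) = crat a b c d := by
  unfold crat
  simp only [add_sub_add_right_eq_sub]

theorem drat_add (a b c d e : ℝ) : drat (a + e) (b + e) (c + e) (d + e) = drat a b c d := by
  unfold drat
  simp only [add_sub_add_right_eq_sub]

theorem critCount_nonneg (S : Finset ℝ) (a d : ℝ) : 0 ≤ critCount S a d := by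
  classical
  unfold critCount
  exact Finset.sum_nonneg fun s _ => by split_ifs <;> norm_num

theorem one_le_critCount {S : Finset ℝ} {a d s : ℝ} (hs : s ∈ S) {m : ℤ} (hm : s + (m : ℝ) ∈ Ioo a d) :
    1 ≤ critCount S a d := by
  classical
  unfold critCount
  refine le_trans ?_ (Finset.single_le_sum (f := fun s : ℝ => if ∃ m : ℤ, s + m ∈ Ioo a d then (1 : ℝ)
    else 0) (fun s _ => by split_ifs <;> norm_num) hs)
  simp only [if_pos (⟨m, hm⟩ : ∃ m : ℤ, s + (m : ℝ) ∈ Ioo a d), le_refl]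

theorem critCount_neg (S : Finset ℝ) (a d : ℝ) :
    critCount (S.image Neg.neg) (-d) (-a) = critCount S a d := by
  classical
  unfold critCount
  rw [Finset.sum_image neg_injective.injOn]
  refine Finset.sum_congr rfl fun s _ => ?_
  congr 1
  refine propext ⟨?_, ?_⟩
  · rintro ⟨m, h1, h2⟩
    exact ⟨-m, by push_cast; linarith, by push_cast; linarith⟩
  · rintro ⟨m, h1, h2⟩
    exact ⟨-m, by push_cast; linarith, by push_cast; linarith⟩

theorem CritLift.add_int {F : ℝ → ℝ} {S : Finset ℝ} (h : CritLift F S) (k : ℤ) :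
    CritLift (fun x => F x + k) S where
  mono := fun x y hxy => add_lt_add_left (h.mono hxy) _
  surj := fun y => by
    obtain ⟨x, hx⟩ := h.surj (y - k)
    exact ⟨x, by simp [hx]⟩
  deg := fun x => by rw [h.deg]; ring
  cross := by
    obtain ⟨K, hK, H⟩ := h.cross
    exact ⟨K, hK, fun a b c d h1 h2 h3 h4 => by rw [crat_add]; exact H a b c d h1 h2 h3 h4⟩
  dist := by
    obtain ⟨B, hB, δ, hδ, H⟩ := h.dist
    exact ⟨B, hB, δ, hδ, fun a b c d h1 h2 h3 h4 h5 => by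
      rw [drat_add (F a)]; exact H a b c d h1 h2 h3 h4 h5⟩
  power := by
    intro c hc
    simpa only [add_sub_add_right_eq_sub] using h.power c hc

theorem CritLift.reflect {F : ℝ → ℝ} {S : Finset ℝ} (h : CritLift F S) :
    CritLift (fun x => -F (-x)) (S.image Neg.neg) where
  mono := fun x y hxy => neg_lt_neg (h.mono (neg_lt_neg hxy))
  surj := fun y => by
    obtain ⟨x, hx⟩ := h.surj (-y)
    exact ⟨-x, by simp [hx]⟩
  deg := fun x => by
    have := h.deg (-(x + 1))
    rw [show -(x + 1) + 1 = -x by ring] at this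
    linarith
  cross := by
    obtain ⟨K, hK, H⟩ := h.cross
    refine ⟨K, hK, fun a b c d h1 h2 h3 h4 => ?_⟩
    have := H (-d) (-c) (-b) (-a) (by linarith) (by linarith) (by linarith) (by linarith)
    have e := critCount_neg S (-d) (-a)
    rw [neg_neg, neg_neg] at e
    rw [e, ← crat_neg a b c d, ← crat_neg (-F (-a))]
    simpa only [neg_neg, neg_sub_neg] using this
  dist := by
    obtain ⟨B, hB, δ, hδ, H⟩ := h.dist
    refine ⟨B, hB, δ, hδ, fun a b c d h1 h2 h3 h4 h5 => ?_⟩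
    have := H (-d) (-c) (-b) (-a) (by linarith) (by linarith) (by linarith) (by linarith) ?_
    · rw [← drat_neg a b c d, ← drat_neg (-F (-a))]
      simpa only [neg_neg, neg_sub_neg] using this
    · intro s hs m hm
      refine h5 (-s) (Finset.mem_image_of_mem _ hs) (-m) ?_
      push_cast
      exact ⟨by linarith [hm.2], by linarith [hm.1]⟩
  power := by
    intro c hc
    obtain ⟨s, hs, rfl⟩ := Finset.mem_image.1 hc
    obtain ⟨p, hp, ε, hε, k₁, hk₁, k₂, hk₂, H⟩ := h.power s hs
    refine ⟨p, hp, ε, hε, k₁, hk₁, k₂, hk₂, fun y hy => ?_⟩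
    have e1 : |y - -s| = |-y - s| := by rw [← abs_neg]; congr 1; ring
    have e2 : |-F (-y) - -F (- -s)| = |F (-y) - F s| := by
      rw [← abs_neg, neg_neg]; congr 1; ring
    rw [e1] at hy ⊢
    rw [e2]
    exact H _ hy

theorem critLift_of_contDiff {F : ℝ → ℝ} {S : Finset ℝ} (hF : ContDiff ℝ 3 F) (hmono : StrictMono F)
    (hsurj : Function.Surjective F) (hdeg : ∀ x, F (x + 1) = F x + 1)
    (hcrit : ∀ x, deriv F x = 0 ↔ ∃ s ∈ S, ∃ m : ℤ, x = s + m)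
    (hnf : ∀ s ∈ S, NonFlatAt F s) : CritLift F S := by
  have hdi := deg_add_int hdeg
  set F1 := deriv F with hF1d
  set F2 := deriv F1 with hF2d
  set F3 := deriv F2 with hF3d
  have c1 : ContDiff ℝ 2 F1 := (contDiff_succ_iff_deriv.1 (show ContDiff ℝ (2 + 1) F by
    norm_num; exact hF)).2.2
  have c2 : ContDiff ℝ 1 F2 := (contDiff_succ_iff_deriv.1 (show ContDiff ℝ (1 + 1) F1 by
    norm_num; exact c1)).2.2
  have h0 : ∀ x, HasDerivAt F (F1 x) x := fun x =>
    (hF.differentiable (by norm_num) x).hasDerivAt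
  have h1 : ∀ x, HasDerivAt F1 (F2 x) x := fun x =>
    (c1.differentiable (by norm_num) x).hasDerivAt
  have h2 : ∀ x, HasDerivAt F2 (F3 x) x := fun x =>
    (c2.differentiable (by norm_num) x).hasDerivAt
  have h3 : Continuous F3 := c2.continuous_deriv le_rfl
  clear_value F3 F2
  have hnf1 : ∀ s ∈ S, ∃ d > 1, NonFlatOfOrder F s d := by
    intro s hs
    obtain ⟨d, hd, W, hW, hcW, φ, a1, -, a2, a3, a4⟩ := hnf s hs
    exact ⟨d, hd, W, hW, hcW, φ, a1, a2, a3, a4⟩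
  have hnf' : ∀ c, F1 c = 0 → ∃ d > 1, NonFlatOfOrder F c d := by
    intro c hc
    obtain ⟨s, hs, m, rfl⟩ := (hcrit c).1 hc
    obtain ⟨d, hd, h⟩ := hnf1 s hs
    exact ⟨d, hd, h.add_int hdi m⟩
  have F1nn : ∀ x, 0 ≤ F1 x := fun x => by
    rw [hF1d]; exact hmono.monotone.deriv_nonneg
  clear_value F1
  obtain ⟨κ, hκ, hS⟩ := exists_schwarzian_bound h0 h1 h2 h3 hmono hdeg hnf'
  obtain ⟨C, hC, hslope⟩ := exists_slope_bound h0 h1 h2 hmono hdeg hnf'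
  have hdist : ∀ a b c d, a < b → b < c → c < d → d - a < 1 / κ →
      (∀ s ∈ S, ∀ m : ℤ, s + m ∉ Ioo a d) →
      Real.exp (-(κ ^ 2 * (d - a) ^ 2)) * drat a b c d ≤ drat (F a) (F b) (F c) (F d) := by
    intro a b c d hab hbc hcd hda hfree
    refine exp_mul_drat_le hκ hab hbc hcd ?_ h0 h1 h2 hmono ?_ fun x _ => hS x
    · rw [lt_div_iff₀ hκ] at hda
      linarith
    · intro x hx
      refine lt_of_le_of_ne (F1nn x) fun h => ?_
      obtain ⟨s, hs, m, rfl⟩ := (hcrit x).1 h.symm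
      exact hfree s hs m hx
  refine ⟨hmono, hsurj, hdeg, ?_, ⟨κ ^ 2, by positivity, 1 / κ, by positivity, hdist⟩, ?_⟩
  · have hlog : 0 ≤ Real.log C := Real.log_nonneg hC
    have hcc : ∀ a b c d, a < b → b < c → c < d → d ≤ a + 1 →
        crat (F a) (F b) (F c) (F d) ≤ C ^ 2 * crat a b c d := by
      intro a b c d hab hbc hcd hda
      have s1 := hslope a c a b (by linarith) le_rfl hab hbc.le
      have s2 := hslope b d c d (by linarith) hbc.le hcd le_rfl
      have fab := hmono hab
      have fbc := hmono hbc
      have fcd := hmono hcd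
      unfold crat
      have p1 : 0 < c - a := by linarith
      have p2 : 0 < d - b := by linarith
      have p3 : 0 < F c - F a := by linarith
      have p4 : 0 < F d - F b := by linarith
      have t1 : (F b - F a) / (F c - F a) ≤ C * ((b - a) / (c - a)) := by
        rw [← mul_div_assoc, div_le_div_iff₀ p3 p1]
        linarith
      have t2 : (F d - F c) / (F d - F b) ≤ C * ((d - c) / (d - b)) := by
        rw [← mul_div_assoc, div_le_div_iff₀ p4 p2]
        linarith
      have t3 := mul_le_mul t1 t2 (div_nonneg (by linarith) p4.le)
        (mul_nonneg (by linarith) (div_nonneg (by linarith) p1.le))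
      calc _ = (F b - F a) / (F c - F a) * ((F d - F c) / (F d - F b)) := by
            rw [div_mul_div_comm]
        _ ≤ _ := t3
        _ = _ := by rw [mul_mul_mul_comm, div_mul_div_comm]; ring
    refine ⟨κ ^ 2 + 2 * Real.log C * κ + 2 * Real.log C, by positivity,
      fun a b c d hab hbc hcd hda => ?_⟩
    have hcn := critCount_nonneg S a d
    have hp := crat_pos hab hbc hcd
    have hda0 : 0 < d - a := by linarith
    by_cases hsm : d - a < 1 / κ ∧ ∀ s ∈ S, ∀ m : ℤ, s + m ∉ Ioo a d
    · have hd := hdist a b c d hab hbc hcd hsm.1 hsm.2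
      have q1 := drat_pos hab hbc hcd
      have q2 := drat_pos (hmono hab) (hmono hbc) (hmono hcd)
      rw [crat_eq_inv (hmono hab) (hmono hcd), crat_eq_inv hab hcd]
      set s := κ ^ 2 * (d - a) ^ 2
      have hs : s ≤ (κ ^ 2 + 2 * Real.log C * κ + 2 * Real.log C) * (d - a + critCount S a d) := by
        have e1 : (d - a) ^ 2 ≤ d - a := by nlinarith
        have e2 : s ≤ κ ^ 2 * (d - a) := by
          simp only [s]; gcongr
        have e3 : 0 ≤ (2 * Real.log C * κ + 2 * Real.log C) * (d - a) := by positivity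
        have e4 : 0 ≤ (κ ^ 2 + 2 * Real.log C * κ + 2 * Real.log C) * critCount S a d := by
          positivity
        linarith
      have hs0 : 0 ≤ s := by positivity
      clear_value s
      refine le_trans ?_ (mul_le_mul_of_nonneg_right (Real.exp_le_exp.2 hs) (by positivity))
      rw [inv_le_iff_one_le_mul₀ (by positivity)]
      have e1 : Real.exp (-s) ≤ 1 := Real.exp_le_one_iff.2 (by linarith)
      have e2 : Real.exp (-s) * (1 + drat a b c d) ≤ 1 + drat (F a) (F b) (F c) (F d) := by linarith
      have e3 : Real.exp s * Real.exp (-s) = 1 := by rw [← Real.exp_add]; simp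
      calc (1 : ℝ) = Real.exp s * (1 + drat a b c d)⁻¹ *
            (Real.exp (-s) * (1 + drat a b c d)) := by
            have : (1 + drat a b c d)⁻¹ * (1 + drat a b c d) = 1 :=
              inv_mul_cancel₀ (by linarith)
            linear_combination (-1 : ℝ) * e3 - Real.exp s * Real.exp (-s) * this
        _ ≤ _ := by gcongr
    · refine (hcc a b c d hab hbc hcd hda).trans ?_
      refine mul_le_mul_of_nonneg_right ?_ hp.le
      have : C ^ 2 = Real.exp (2 * Real.log C) := by
        rw [two_mul, Real.exp_add, Real.exp_log (by linarith)]; ring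
      rw [this]
      refine Real.exp_le_exp.2 ?_
      have e1 : 0 ≤ κ ^ 2 * (d - a + critCount S a d) := by positivity
      have e2 : 0 ≤ 2 * Real.log C * κ * critCount S a d := by positivity
      have e3 : 0 ≤ 2 * Real.log C * (d - a) := by positivity
      have e5 : 0 ≤ 2 * Real.log C * critCount S a d := by positivity
      have e6 : 0 ≤ 2 * Real.log C * κ * (d - a) := by positivity
      rw [not_and_or] at hsm
      rcases hsm with hsm | hsm
      · rw [not_lt, div_le_iff₀ hκ] at hsm
        have e4 := mul_le_mul_of_nonneg_left hsm (show 0 ≤ 2 * Real.log C by positivity)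
        linarith
      · push Not at hsm
        obtain ⟨s, hs, m, hm⟩ := hsm
        have e4 := mul_le_mul_of_nonneg_left (one_le_critCount hs hm)
          (show 0 ≤ 2 * Real.log C by positivity)
        linarith
  · intro c hc
    have hF1c : F1 c = 0 := (hcrit c).2 ⟨c, hc, 0, by simp⟩
    obtain ⟨d, hd, hnfc⟩ := hnf1 c hc
    obtain ⟨ε, hε, k₁, hk₁, k₂, hk₂, _, -, H⟩ := nonFlat_bounds h0 h1 h2 hmono hd hnfc hF1c
    have H' := fun y hy => And.intro (H y hy).1 (H y hy).2.1
    have hcc : |c - c| < ε := by simpa using hε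
    have hpw : ∀ t : ℝ, 0 < t → t * t ^ (d - 1) = t ^ d := by
      intro t ht
      nth_rewrite 1 [← Real.rpow_one t]
      rw [← Real.rpow_add ht]
      congr 1
      ring
    refine ⟨d, hd, ε, hε, k₁ * (1 / 2) ^ (d - 1) / 4, by positivity, k₂, hk₂, fun y hy => ?_⟩
    rcases lt_trichotomy y c with hyc | rfl | hyc
    · have := increment_bounds h0 hmono (by linarith) hk₁ hk₂ H' hyc hy hcc
      rw [sub_self, abs_zero, max_eq_left (abs_nonneg _)] at this
      rw [abs_sub_comm (F y), abs_of_pos (sub_pos.2 (hmono hyc)), abs_sub_comm y,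
        abs_of_pos (sub_pos.2 hyc)]
      rw [abs_sub_comm y, abs_of_pos (sub_pos.2 hyc), hpw _ (sub_pos.2 hyc)] at this
      exact this
    · simp [Real.zero_rpow (by linarith : d ≠ 0)]
    · have := increment_bounds h0 hmono (by linarith) hk₁ hk₂ H' hyc hcc hy
      rw [sub_self, abs_zero, max_eq_right (abs_nonneg _)] at this
      rw [abs_of_pos (sub_pos.2 (hmono hyc)), abs_of_pos (sub_pos.2 hyc)]
      rw [abs_of_pos (sub_pos.2 hyc), hpw _ (sub_pos.2 hyc)] at this
      exact this

/-- `Φ` is a monotone degree-one map semiconjugating `F` to the translation by the irrational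
number `ρ`. -/
structure RotFactor (F Φ : ℝ → ℝ) (ρ : ℝ) : Prop where
  irr : Irrational ρ
  mono : Monotone Φ
  deg : ∀ x, Φ (x + 1) = Φ x + 1
  conj : ∀ x, Φ (F x) = Φ x + ρ

/-- The deck-translated iterate `F ^ q - p`. -/
def mover (F : ℝ → ℝ) (q : ℕ) (p : ℤ) (x : ℝ) : ℝ := F^[q] x - p

theorem iterate_add_int {F : ℝ → ℝ} (hdeg : ∀ x, F (x + 1) = F x + 1) (n : ℕ) (x : ℝ) (m : ℤ) :
    F^[n] (x + m) = F^[n] x + m := by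
  induction n generalizing x with
  | zero => rfl
  | succ n ih => rw [Function.iterate_succ_apply, Function.iterate_succ_apply, deg_add_int hdeg, ih]

theorem iterate_sub_int {F : ℝ → ℝ} (hdeg : ∀ x, F (x + 1) = F x + 1) (n : ℕ) (x : ℝ) (m : ℤ) :
    F^[n] (x - m) = F^[n] x - m := by
  have := iterate_add_int hdeg n x (-m)
  push_cast at this
  simpa only [sub_eq_add_neg] using this

theorem mover_iterate {F : ℝ → ℝ} (hdeg : ∀ x, F (x + 1) = F x + 1) (q : ℕ) (p : ℤ) (n : ℕ)
    (x : ℝ) : mover F q p (F^[n] x) = F^[n] (mover F q p x) := by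
  unfold mover
  rw [iterate_sub_int hdeg, ← Function.iterate_add_apply, ← Function.iterate_add_apply, add_comm]

theorem mover_add_int {F : ℝ → ℝ} (hdeg : ∀ x, F (x + 1) = F x + 1) (q : ℕ) (p : ℤ) (x : ℝ)
    (m : ℤ) : mover F q p (x + m) = mover F q p x + m := by
  unfold mover
  rw [iterate_add_int hdeg]
  ring

theorem mover_strictMono {F : ℝ → ℝ} (hF : StrictMono F) (q : ℕ) (p : ℤ) :
    StrictMono (mover F q p) := fun _ _ h => sub_lt_sub_right (hF.iterate q h) _

theorem mover_surjective {F : ℝ → ℝ} (hF : Function.Surjective F) (q : ℕ) (p : ℤ) :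
    Function.Surjective (mover F q p) := fun y => by
  obtain ⟨x, hx⟩ := hF.iterate q (y + p)
  exact ⟨x, by simp [mover, hx]⟩

theorem RotFactor.add_int {F Φ : ℝ → ℝ} {ρ : ℝ} (h : RotFactor F Φ ρ) (x : ℝ) (m : ℤ) :
    Φ (x + m) = Φ x + m := deg_add_int h.deg x m

theorem RotFactor.iterate {F Φ : ℝ → ℝ} {ρ : ℝ} (h : RotFactor F Φ ρ) (n : ℕ) (x : ℝ) :
    Φ (F^[n] x) = Φ x + n * ρ := by
  induction n with
  | zero => simp
  | succ n ih => rw [Function.iterate_succ_apply', h.conj, ih]; push_cast; ring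

theorem RotFactor.mover {F Φ : ℝ → ℝ} {ρ : ℝ} (h : RotFactor F Φ ρ) (q : ℕ) (p : ℤ) (x : ℝ) :
    Φ (mover F q p x) = Φ x + (q * ρ - p) := by
  have := h.add_int (F^[q] x) (-p)
  rw [h.iterate] at this
  push_cast at this
  rw [_root_.mover, sub_eq_add_neg, this]
  ring

theorem RotFactor.lt_of_lt {F Φ : ℝ → ℝ} {ρ : ℝ} (h : RotFactor F Φ ρ) {x y : ℝ} (hxy : Φ x < Φ y) :
    x < y := h.mono.reflect_lt hxy

theorem RotFactor.reflect {F Φ : ℝ → ℝ} {ρ : ℝ} (h : RotFactor F Φ ρ) :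
    RotFactor (fun x => -F (-x)) (fun x => -Φ (-x)) (-ρ) where
  irr := h.irr.neg
  mono := fun x y hxy => neg_le_neg (h.mono (neg_le_neg hxy))
  deg := fun x => by
    have := h.deg (-(x + 1))
    rw [show -(x + 1) + 1 = -x by ring] at this
    linarith
  conj := fun x => by
    simp only [neg_neg, h.conj]
    ring

theorem iterate_reflect (F : ℝ → ℝ) (n : ℕ) (x : ℝ) :
    (fun x => -F (-x))^[n] x = -F^[n] (-x) := by
  induction n with
  | zero => simp
  | succ n ih => rw [Function.iterate_succ_apply', ih, Function.iterate_succ_apply', neg_neg]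

theorem mover_reflect (F : ℝ → ℝ) (q : ℕ) (p : ℤ) (x : ℝ) :
    mover (fun x => -F (-x)) q (-p) x = -mover F q p (-x) := by
  unfold mover
  rw [iterate_reflect]
  push_cast
  ring

/-- Intervals with pairwise disjoint interiors modulo one. -/
def SepMod (n : ℕ) (s t : ℕ → ℝ) : Prop :=
  ∀ i < n, ∀ j < n, i ≠ j → ∀ m : ℤ, t i ≤ s j + m ∨ t j + m ≤ s i

theorem SepMod.sum_le {n : ℕ} {s t : ℕ → ℝ} (h : SepMod n s t)
    (hst : ∀ i < n, s i ≤ t i ∧ t i ≤ s i + 1) :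
    ∑ i ∈ Finset.range n, (t i - s i) ≤ 2 := by
  set I : ℕ → Set ℝ := fun i => Ico (s i - ⌊s i⌋) (t i - ⌊s i⌋) with hI
  have hdisj : Set.Pairwise (↑(Finset.range n)) (Function.onFun Disjoint I) := by
    intro i hi j hj hij
    simp only [Finset.coe_range, mem_Iio] at hi hj
    refine Set.disjoint_left.2 fun x hx hy => ?_
    have := h i hi j hj hij (⌊s i⌋ - ⌊s j⌋)
    push_cast at this
    rcases this with h1 | h1
    · linarith [hx.2, hy.1]
    · linarith [hx.1, hy.2]
  have hsub : (⋃ i ∈ Finset.range n, I i) ⊆ Ico (0 : ℝ) 2 := by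
    refine iUnion₂_subset fun i hi x hx => ?_
    have h1 := Int.floor_le (s i)
    have h2 := Int.lt_floor_add_one (s i)
    have h3 := (hst i (Finset.mem_range.1 hi)).2
    exact ⟨by linarith [hx.1], by linarith [hx.2]⟩
  have hvol : ∑ i ∈ Finset.range n, volume (I i) ≤ volume (Ico (0 : ℝ) 2) := by
    rw [← measure_biUnion_finset hdisj fun i _ => measurableSet_Ico]
    exact measure_mono hsub
  have e : ∀ i ∈ Finset.range n, volume (I i) = ENNReal.ofReal (t i - s i) := by
    intro i _
    rw [hI, Real.volume_Ico]
    congr 1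
    ring
  rw [Finset.sum_congr rfl e, ← ENNReal.ofReal_sum_of_nonneg (fun i hi => sub_nonneg.2
    (hst i (Finset.mem_range.1 hi)).1), Real.volume_Ico, sub_zero,
    ENNReal.ofReal_le_ofReal_iff (by norm_num)] at hvol
  exact hvol

/-- Number of the circle points represented by `S` met by the interval `[a, d)`. -/
def hitCount (S : Finset ℝ) (a d : ℝ) : ℝ :=
  open Classical in ∑ s ∈ S, if ∃ m : ℤ, s + m ∈ Ico a d then 1 else 0

theorem SepMod.sum_hitCount_le {n : ℕ} {s t : ℕ → ℝ} (h : SepMod n s t) (S : Finset ℝ) :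
    ∑ i ∈ Finset.range n, hitCount S (s i) (t i) ≤ S.card := by
  classical
  unfold hitCount
  rw [Finset.sum_comm, Finset.card_eq_sum_ones, Nat.cast_sum]
  refine Finset.sum_le_sum fun c _ => ?_
  rw [Finset.sum_boole]
  refine Nat.cast_le.2 (Finset.card_le_one.2 fun i hi j hj => ?_)
  simp only [Finset.mem_filter, Finset.mem_range] at hi hj
  obtain ⟨hi, m, hm⟩ := hi
  obtain ⟨hj, k, hk⟩ := hj
  by_contra hij
  have := h i hi j hj hij (m - k)
  push_cast at this
  rcases this with h1 | h1
  · linarith [hm.2, hk.1]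
  · linarith [hm.1, hk.2]

theorem critCount_le_hitCount {S : Finset ℝ} {a b c d : ℝ} :
    critCount S a d ≤ hitCount S a b + hitCount S b c + hitCount S c d := by
  classical
  unfold critCount hitCount
  rw [← Finset.sum_add_distrib, ← Finset.sum_add_distrib]
  refine Finset.sum_le_sum fun s _ => ?_
  by_cases h : ∃ m : ℤ, s + m ∈ Ioo a d
  · rw [if_pos h]
    obtain ⟨m, h1, h2⟩ := h
    have nn : ∀ u v : ℝ, 0 ≤ if ∃ m : ℤ, s + (m : ℝ) ∈ Ico u v then (1 : ℝ) else 0 := by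
      intro u v; split_ifs <;> norm_num
    have n1 := nn a b
    have n2 := nn b c
    have n3 := nn c d
    rcases lt_or_ge (s + m) b with hb | hb
    · rw [if_pos (⟨m, h1.le, hb⟩ : ∃ m : ℤ, s + (m : ℝ) ∈ Ico a b)]
      linarith
    · rcases lt_or_ge (s + m) c with hc | hc
      · rw [if_pos (⟨m, hb, hc⟩ : ∃ m : ℤ, s + (m : ℝ) ∈ Ico b c)]
        linarith
      · rw [if_pos (⟨m, hc, h2⟩ : ∃ m : ℤ, s + (m : ℝ) ∈ Ico c d)]
        linarith
  · rw [if_neg h]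
    split_ifs <;> norm_num

/-- Iterates of an interval are disjoint up to time `n` if its rotation width is small. -/
theorem sepMod_iterate {F Φ : ℝ → ℝ} {ρ : ℝ} (hmono : StrictMono F)
    (hdeg : ∀ x, F (x + 1) = F x + 1) (h : RotFactor F Φ ρ) {n : ℕ} {x y : ℝ}
    (hsep : ∀ k, 0 < k → k < n → ∀ m : ℤ,
      Φ y - Φ x < |k * ρ + m| ∨ F^[k] x + m = y ∨ F^[k] y + m = x) :
    SepMod n (fun i => F^[i] x) (fun i => F^[i] y) := by
  have key : ∀ k, 0 < k → k < n → ∀ m : ℤ, y ≤ F^[k] x + m ∨ F^[k] y + m ≤ x := by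
    intro k hk hkn m
    rcases hsep k hk hkn m with h1 | h1 | h1
    · rcases lt_abs.1 h1 with h2 | h2
      · left
        refine (h.lt_of_lt ?_).le
        rw [h.add_int, h.iterate]
        linarith
      · right
        refine (h.lt_of_lt ?_).le
        rw [h.add_int, h.iterate]
        linarith
    · exact Or.inl h1.ge
    · exact Or.inr h1.le
  have key2 : ∀ i j, i < j → j < n → ∀ m : ℤ,
      F^[i] y ≤ F^[j] x + m ∨ F^[j] y + m ≤ F^[i] x := by
    intro i j hij hj m
    obtain ⟨k, rfl⟩ := Nat.exists_eq_add_of_lt hij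
    have e : ∀ u, F^[i + k + 1] u + m = F^[i] (F^[k + 1] u + m) := by
      intro u
      rw [iterate_add_int hdeg, ← Function.iterate_add_apply, add_assoc]
    rw [e, e, (hmono.iterate i).le_iff_le, (hmono.iterate i).le_iff_le]
    exact key (k + 1) (by omega) (by omega) m
  intro i hi j hj hij m
  rcases lt_or_gt_of_ne hij with hlt | hlt
  · exact key2 i j hlt hj m
  · have := key2 j i hlt hi (-m)
    push_cast at this
    rcases this with h1 | h1
    · right; linarith
    · left; linarith

theorem iterate_le_add_one {F : ℝ → ℝ} (hmono : StrictMono F) (hdeg : ∀ x, F (x + 1) = F x + 1)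
    {x y : ℝ} (hxy : y ≤ x + 1) (n : ℕ) : F^[n] y ≤ F^[n] x + 1 := by
  have := iterate_add_int hdeg n x 1
  push_cast at this
  rw [← this]
  exact (hmono.iterate n).monotone hxy

/-- Cross-ratios are quasi-nonincreasing along iterates with bounded multiplicity. -/
theorem CritLift.exists_cross_bound {F : ℝ → ℝ} {S : Finset ℝ} (hF : CritLift F S) :
    ∃ E ≥ (1 : ℝ), ∀ (n : ℕ) (a b c d : ℝ), a < b → b < c → c < d → d ≤ a + 1 →
      SepMod n (fun i => F^[i] a) (fun i => F^[i] b) →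
      SepMod n (fun i => F^[i] b) (fun i => F^[i] c) →
      SepMod n (fun i => F^[i] c) (fun i => F^[i] d) →
      ∀ i ≤ n, crat (F^[i] a) (F^[i] b) (F^[i] c) (F^[i] d) ≤ E * crat a b c d := by
  obtain ⟨K, hK, H⟩ := hF.cross
  refine ⟨Real.exp (K * (6 + 3 * S.card)), Real.one_le_exp (by positivity), ?_⟩
  intro n a b c d hab hbc hcd hda s1 s2 s3 i hi
  have mi := fun i => hF.mono.iterate i
  have step : ∀ i, crat (F^[i] a) (F^[i] b) (F^[i] c) (F^[i] d) ≤
      Real.exp (K * ∑ k ∈ Finset.range i,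
        ((F^[k] d - F^[k] a) + critCount S (F^[k] a) (F^[k] d))) * crat a b c d := by
    intro i
    induction i with
    | zero => simp
    | succ i ih =>
      have h1 := H _ _ _ _ (mi i hab) (mi i hbc) (mi i hcd)
        (iterate_le_add_one hF.mono hF.deg hda i)
      rw [Finset.sum_range_succ, mul_add, Real.exp_add]
      simp only [Function.iterate_succ_apply']
      refine h1.trans ?_
      have := mul_le_mul_of_nonneg_left ih
        (Real.exp_pos (K * ((F^[i] d - F^[i] a) + critCount S (F^[i] a) (F^[i] d)))).le
      linarith
  refine (step i).trans (mul_le_mul_of_nonneg_right (Real.exp_le_exp.2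
    (mul_le_mul_of_nonneg_left ?_ hK)) (crat_pos hab hbc hcd).le)
  have bd : ∀ u v, a ≤ u → u < v → v ≤ d →
      SepMod n (fun i => F^[i] u) (fun i => F^[i] v) →
      ∑ k ∈ Finset.range i, ((F^[k] v - F^[k] u) + hitCount S (F^[k] u) (F^[k] v))
        ≤ 2 + S.card := by
    intro u v h1 h2 h3 hs
    have hs' : SepMod i (fun i => F^[i] u) (fun i => F^[i] v) :=
      fun j hj k hk => hs j (by omega) k (by omega)
    rw [Finset.sum_add_distrib]
    exact add_le_add (hs'.sum_le fun k _ => ⟨(mi k h2).le,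
      iterate_le_add_one hF.mono hF.deg (by linarith) k⟩) (hs'.sum_hitCount_le S)
  have b1 := bd a b le_rfl hab (by linarith) s1
  have b2 := bd b c hab.le hbc hcd.le s2
  have b3 := bd c d (by linarith) hcd le_rfl s3
  calc _ ≤ ∑ k ∈ Finset.range i, (((F^[k] b - F^[k] a) + hitCount S (F^[k] a) (F^[k] b)) +
          ((F^[k] c - F^[k] b) + hitCount S (F^[k] b) (F^[k] c)) +
          ((F^[k] d - F^[k] c) + hitCount S (F^[k] c) (F^[k] d))) := by
        refine Finset.sum_le_sum fun k _ => ?_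
        have := critCount_le_hitCount (S := S) (a := F^[k] a) (b := F^[k] b) (c := F^[k] c)
          (d := F^[k] d)
        linarith
    _ ≤ 6 + 3 * S.card := by
        rw [Finset.sum_add_distrib, Finset.sum_add_distrib]
        linarith

/-- Distortion of the cross-ratio `drat` along critical-point-free iterates. -/
theorem drat_iterate_ge {F : ℝ → ℝ} {S : Finset ℝ} {B δ : ℝ} (hB : 0 ≤ B) (hmono : StrictMono F)
    (H : ∀ a b c d, a < b → b < c → c < d → d - a < δ →
      (∀ s ∈ S, ∀ m : ℤ, s + m ∉ Ioo a d) →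
      Real.exp (-(B * (d - a) ^ 2)) * drat a b c d ≤ drat (F a) (F b) (F c) (F d))
    {a b c d ε σ : ℝ} (hab : a < b) (hbc : b < c) (hcd : c < d) (n : ℕ) (hε0 : 0 ≤ ε)
    (hε : ∀ i < n, F^[i] d - F^[i] a ≤ ε) (hεδ : ε < δ)
    (hσ : ∑ i ∈ Finset.range n, (F^[i] d - F^[i] a) ≤ σ)
    (hfree : ∀ i < n, ∀ s ∈ S, ∀ m : ℤ, s + m ∉ Ioo (F^[i] a) (F^[i] d)) :
    Real.exp (-(B * (ε * σ))) * drat a b c d ≤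
      drat (F^[n] a) (F^[n] b) (F^[n] c) (F^[n] d) := by
  have mi := fun i => hmono.iterate i
  have step : ∀ i ≤ n, Real.exp (-(B * (ε * ∑ k ∈ Finset.range i, (F^[k] d - F^[k] a)))) *
      drat a b c d ≤ drat (F^[i] a) (F^[i] b) (F^[i] c) (F^[i] d) := by
    intro i hi
    induction i with
    | zero => simp
    | succ i ih =>
      have h1 := H _ _ _ _ (mi i hab) (mi i hbc) (mi i hcd)
        ((hε i (by omega)).trans_lt hεδ) (hfree i (by omega))
      have h2 := ih (by omega)
      simp only [Function.iterate_succ_apply']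
      refine le_trans ?_ h1
      have h3 := mul_le_mul_of_nonneg_left h2 (Real.exp_pos (-(B * (F^[i] d - F^[i] a) ^ 2))).le
      refine le_trans ?_ h3
      rw [← mul_assoc (Real.exp _), ← Real.exp_add]
      refine mul_le_mul_of_nonneg_right (Real.exp_le_exp.2 ?_) (drat_pos hab hbc hcd).le
      rw [Finset.sum_range_succ]
      have h4 : 0 < F^[i] d - F^[i] a := sub_pos.2 (mi i (by linarith))
      have h5 : (F^[i] d - F^[i] a) ^ 2 ≤ ε * (F^[i] d - F^[i] a) := by
        rw [sq]
        exact mul_le_mul_of_nonneg_right (hε i (by omega)) h4.le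
      have h6 := mul_le_mul_of_nonneg_left h5 hB
      linarith
  refine le_trans (mul_le_mul_of_nonneg_right (Real.exp_le_exp.2 ?_) (drat_pos hab hbc hcd).le)
    (step n le_rfl)
  gcongr

theorem Irrational.int_mul_add_eq_zero {ρ : ℝ} (hρ : Irrational ρ) {a b : ℤ}
    (h : a * ρ + b = 0) : a = 0 ∧ b = 0 := by
  have ha : a = 0 := by
    by_contra ha
    refine hρ ⟨(-b : ℚ) / a, ?_⟩
    have : (a : ℝ) ≠ 0 := by exact_mod_cast ha
    push_cast
    field_simp
    linarith
  subst ha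
  simp only [Int.cast_zero, zero_mul, zero_add, Int.cast_eq_zero] at h
  exact ⟨rfl, h⟩

theorem exists_min_pos_offset (θ : ℕ → ℝ) {q : ℕ} (hq : 0 < q) :
    ∃ i < q, ∃ k : ℤ, 0 < θ i + k ∧ ∀ j < q, ∀ l : ℤ, 0 < θ j + l → θ i + k ≤ θ j + l := by
  obtain ⟨i, hi, hmin⟩ := Finset.exists_min_image (Finset.range q)
    (fun i => θ i + ((⌊-θ i⌋ + 1 : ℤ) : ℝ)) ⟨0, Finset.mem_range.2 hq⟩
  refine ⟨i, Finset.mem_range.1 hi, ⌊-θ i⌋ + 1, ?_, fun j hj l hl => ?_⟩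
  · have := Int.lt_floor_add_one (-θ i)
    push_cast
    linarith
  · refine (hmin j (Finset.mem_range.2 hj)).trans ?_
    have : ⌊-θ j⌋ < l := Int.floor_lt.2 (by linarith)
    have : ((⌊-θ j⌋ + 1 : ℤ) : ℝ) ≤ l := by exact_mod_cast this
    linarith

/-- `q ρ - p` is a small positive best approximation. -/
structure GoodMover (ρ : ℝ) (q : ℕ) (p : ℤ) : Prop where
  q_pos : 0 < q
  pos : 0 < q * ρ - p
  small : q * ρ - p < 1 / 8
  best : ∀ i : ℕ, 0 < i → i < q → ∀ m : ℤ, q * ρ - p < |i * ρ + m|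

theorem GoodMover.exists_return {ρ : ℝ} (hρ : Irrational ρ) {q : ℕ} {p : ℤ}
    (h : GoodMover ρ q p) : ∃ n, q < n ∧
      (∀ k : ℕ, 0 < k → k < n → ∀ m : ℤ, q * ρ - p < |k * ρ + m| ∨ (k = q ∧ m = -p)) ∧
      ∀ T : ℝ, ∃ i < n, ∃ k : ℤ, T < i * ρ + k ∧ i * ρ + k < T + 2 * (q * ρ - p) := by
  classical
  obtain ⟨hq, hβ, hβ8, hbest⟩ := h
  set β := q * ρ - p with hβd
  have hex : ∃ k : ℕ, 0 < k ∧ ∃ m : ℤ, |k * ρ + m| < β := by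
    obtain ⟨n, hn⟩ := exists_nat_one_div_lt hβ
    obtain ⟨k, hk, -, hk2⟩ := Real.exists_nat_abs_mul_sub_round_le ρ (Nat.succ_pos n)
    refine ⟨k, hk, -round (k * ρ), ?_⟩
    push_cast at hk2 ⊢
    rw [← sub_eq_add_neg]
    refine hk2.trans_lt (lt_of_le_of_lt ?_ hn)
    gcongr
    linarith
  obtain ⟨hn0, m₀, hm₀⟩ := Nat.find_spec hex
  set n := Nat.find hex with hnd
  have hmin : ∀ k : ℕ, 0 < k → k < n → ∀ m : ℤ, β ≤ |k * ρ + m| := by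
    intro k hk hkn m
    by_contra hlt
    exact Nat.find_min hex hkn ⟨hk, m, not_le.1 hlt⟩
  have hqn : q < n := by
    rcases lt_trichotomy q n with h | h | h
    · exact h
    · exfalso
      rw [← h] at hm₀
      have e : (q : ℝ) * ρ + m₀ = β + (p + m₀ : ℤ) := by rw [hβd]; push_cast; ring
      rw [e] at hm₀
      rcases lt_trichotomy (p + m₀) 0 with hz | hz | hz
      · have : ((p + m₀ : ℤ) : ℝ) ≤ -1 := by exact_mod_cast (by omega : p + m₀ ≤ -1)
        have := neg_le_abs (β + (p + m₀ : ℤ))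
        linarith
      · rw [hz, Int.cast_zero, add_zero] at hm₀
        linarith [le_abs_self β]
      · have : (1 : ℝ) ≤ ((p + m₀ : ℤ) : ℝ) := by exact_mod_cast hz
        have := le_abs_self (β + (p + m₀ : ℤ))
        linarith
    · exact absurd hm₀ (not_lt.2 (hbest n hn0 h m₀).le)
  have hγ : n * ρ + m₀ < 0 := by
    by_contra hge
    rw [not_lt] at hge
    have hne : (n : ℝ) * ρ + m₀ ≠ 0 := by
      intro h0
      have := hρ.int_mul_add_eq_zero (a := n) (b := m₀) (by push_cast; exact h0)
      omega
    have hpos : 0 < (n : ℝ) * ρ + m₀ := lt_of_le_of_ne hge (Ne.symm hne)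
    rw [abs_of_pos hpos] at hm₀
    have := hmin (n - q) (by omega) (by omega) (m₀ + p)
    rw [Nat.cast_sub hqn.le] at this
    push_cast at this
    rw [abs_of_neg (by linarith)] at this
    linarith
  rw [abs_of_neg hγ] at hm₀
  refine ⟨n, hqn, fun k hk hkn m => ?_, fun T => ?_⟩
  · rcases lt_or_eq_of_le (hmin k hk hkn m) with h1 | h1
    · exact Or.inl h1
    · right
      rcases abs_cases ((k : ℝ) * ρ + m) with ⟨h2, -⟩ | ⟨h2, -⟩
      · have := hρ.int_mul_add_eq_zero (a := k - q) (b := m + p) (by push_cast; linarith)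
        omega
      · have := hρ.int_mul_add_eq_zero (a := k + q) (b := m - p) (by push_cast; linarith)
        omega
  · obtain ⟨i, hi, k, hpos, hle⟩ := exists_min_pos_offset (fun i => i * ρ - T) hn0
    refine ⟨i, hi, k, by linarith, ?_⟩
    by_contra hge
    rw [not_lt] at hge
    rcases le_or_gt q i with hqi | hqi
    · have := hle (i - q) (by omega) (k + p)
      rw [Nat.cast_sub hqi] at this
      push_cast at this
      have := this (by linarith)
      linarith
    · have := hle (i + n - q) (by omega) (k + m₀ + p)
      rw [Nat.cast_sub (by omega)] at this
      push_cast at this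
      have := this (by linarith)
      linarith

theorem le_mul_of_crat_ge {a b c d E : ℝ} (hab : a < b) (hbc : b < c) (hcd : c < d)
    (h : 1 ≤ E * crat a b c d) : c - b ≤ E * (b - a) ∧ c - b ≤ E * (d - c) := by
  have p1 : 0 < b - a := by linarith
  have p2 : 0 < c - b := by linarith
  have p3 : 0 < d - c := by linarith
  have hc := crat_pos hab hbc hcd
  have hE : 0 < E := by
    by_contra hE
    have := mul_nonpos_of_nonpos_of_nonneg (not_lt.1 hE) hc.le
    linarith
  unfold crat at h
  rw [← mul_div_assoc, one_le_div (by apply mul_pos <;> linarith)] at h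
  constructor
  · have h1 : (c - b) * (d - c) ≤ (c - a) * (d - b) := by nlinarith
    have h2 : (c - b) * (d - c) ≤ (E * (b - a)) * (d - c) := by linarith
    exact le_of_mul_le_mul_right h2 p3
  · have h1 : (c - b) * (b - a) ≤ (c - a) * (d - b) := by nlinarith
    have h2 : (c - b) * (b - a) ≤ (E * (d - c)) * (b - a) := by linarith
    exact le_of_mul_le_mul_right h2 p1

theorem one_le_mul_crat {a b c d C C' : ℝ} (hab : a < b) (hbc : b < c) (hcd : c < d)
    (h1 : c - b ≤ C * (b - a)) (h2 : c - b ≤ C' * (d - c)) :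
    1 ≤ ((1 + C) * (1 + C')) * crat a b c d := by
  have p1 : 0 < b - a := by linarith
  have p2 : 0 < c - b := by linarith
  have p3 : 0 < d - c := by linarith
  unfold crat
  rw [← mul_div_assoc, one_le_div (by apply mul_pos <;> linarith)]
  have := mul_le_mul (show c - a ≤ (1 + C) * (b - a) by linarith)
    (show d - b ≤ (1 + C') * (d - c) by linarith) (by linarith) (by linarith)
  linarith

theorem mover_sepMod {F Φ : ℝ → ℝ} {ρ : ℝ} (hmono : StrictMono F)
    (hdeg : ∀ x, F (x + 1) = F x + 1) (h : RotFactor F Φ ρ) {n q : ℕ} {p : ℤ}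
    (hn : ∀ k : ℕ, 0 < k → k < n → ∀ m : ℤ, q * ρ - p < |k * ρ + m| ∨ (k = q ∧ m = -p)) (x : ℝ) :
    SepMod n (fun i => F^[i] x) (fun i => F^[i] (mover F q p x)) := by
  refine sepMod_iterate hmono hdeg h fun k hk hkn m => ?_
  rcases hn k hk hkn m with h1 | ⟨rfl, rfl⟩
  · left
    rw [h.mover]
    linarith
  · right; left
    unfold mover
    push_cast
    ring

theorem lt_mover {F Φ : ℝ → ℝ} {ρ : ℝ} (h : RotFactor F Φ ρ) {q : ℕ} {p : ℤ}
    (hβ : 0 < q * ρ - p) (x : ℝ) : x < mover F q p x := by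
  refine h.lt_of_lt ?_
  rw [h.mover]
  linarith

/-- Uniform comparability of adjacent fundamental domains of a closest-return map. -/
theorem CritLift.exists_comparable {F Φ : ℝ → ℝ} {S : Finset ℝ} {ρ : ℝ} (hF : CritLift F S)
    (h : RotFactor F Φ ρ) : ∃ C ≥ (1 : ℝ), ∀ (q : ℕ) (p : ℤ), GoodMover ρ q p → ∀ x,
      mover F q p (mover F q p x) - mover F q p x ≤ C * (mover F q p x - x) ∧
      mover F q p x - x ≤ C * (mover F q p (mover F q p x) - mover F q p x) := by
  obtain ⟨E, hE, hcr⟩ := hF.exists_cross_bound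
  set b := 4 * E with hb
  have hb1 : 1 ≤ b := by linarith
  refine ⟨(1 + 4 * b ^ 10) * (1 + 4 * b ^ 10) * E, ?_, ?_⟩
  · have : 0 ≤ b ^ 10 := by positivity
    have h1 : 1 ≤ (1 + 4 * b ^ 10) * (1 + 4 * b ^ 10) := by nlinarith
    nlinarith
  intro q p hqp
  obtain ⟨n, hqn, hn, hhit⟩ := hqp.exists_return h.irr
  set A := mover F q p with hA
  have mA : StrictMono A := mover_strictMono hF.mono q p
  have sA : Function.Surjective A := mover_surjective hF.surj q p
  have ltA : ∀ x, x < A x := lt_mover h hqp.pos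
  have ΦA : ∀ x, Φ (A x) = Φ x + (q * ρ - p) := h.mover q p
  have intA : ∀ x (m : ℤ), A (x + m) = A x + m := mover_add_int hF.deg q p
  have itA : ∀ k x, A (F^[k] x) = F^[k] (A x) := fun k x => mover_iterate hF.deg q p k x
  have hAq : ∀ x, A x = F^[q] x - p := fun x => rfl
  have hsep : ∀ x, SepMod n (fun i => F^[i] x) (fun i => F^[i] (A x)) :=
    mover_sepMod hF.mono hF.deg h hn
  clear_value A
  have hβ := hqp.pos
  have hβ8 := hqp.small
  set β := q * ρ - p with hβd
  have hA3 : ∀ x, A (A (A x)) ≤ x + 1 := fun x => (h.lt_of_lt (by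
    rw [ΦA, ΦA, ΦA, h.deg]; linarith)).le
  have hcr' : ∀ x, ∀ i ≤ n, crat (F^[i] x) (F^[i] (A x)) (F^[i] (A (A x))) (F^[i] (A (A (A x)))) ≤
      E * crat x (A x) (A (A x)) (A (A (A x))) := fun x i hi =>
    hcr n _ _ _ _ (ltA _) (ltA _) (ltA _) (hA3 x) (hsep _) (hsep _) (hsep _) i hi
  have hcrA : ∀ x, crat (A x) (A (A x)) (A (A (A x))) (A (A (A (A x)))) ≤
      E * crat x (A x) (A (A x)) (A (A (A x))) := by
    intro x
    have e := crat_add (F^[q] x) (F^[q] (A x)) (F^[q] (A (A x))) (F^[q] (A (A (A x)))) (-p)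
    simp only [← sub_eq_add_neg] at e
    rw [← hAq x, ← hAq (A x), ← hAq (A (A x)), ← hAq (A (A (A x)))] at e
    rw [e]
    exact hcr' x q hqn.le
  -- a shortest fundamental domain
  have cA : Continuous A := mA.monotone.continuous_of_surjective sA
  obtain ⟨z, -, hz⟩ := isCompact_Icc.exists_isMinOn (nonempty_Icc.2 (zero_le_one' ℝ))
    (cA.sub continuous_id).continuousOn
  have hzmin : ∀ x, A z - z ≤ A x - x := by
    intro x
    have h1 : A z - z ≤ A (Int.fract x) - Int.fract x :=
      hz ⟨Int.fract_nonneg x, (Int.fract_lt_one x).le⟩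
    have h2 := intA (Int.fract x) ⌊x⌋
    rw [Int.fract_add_floor] at h2
    have h3 := Int.fract_add_floor x
    linarith
  obtain ⟨z1, hz1⟩ := sA z
  obtain ⟨z2, hz2⟩ := sA z1
  obtain ⟨z3, hz3⟩ := sA z2
  obtain ⟨z4, hz4⟩ := sA z3
  obtain ⟨z5, hz5⟩ := sA z4
  have k0 : 1 ≤ 4 * crat z1 z (A z) (A (A z)) := by
    have := one_le_mul_crat (C := 1) (C' := 1) (hz1 ▸ ltA z1) (ltA z) (ltA (A z))
      (by have := hzmin z1; rw [hz1] at this; linarith) (by have := hzmin (A z); linarith)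
    linarith
  have k1 : 1 ≤ b * crat z2 z1 z (A z) := by
    have := hcrA z2
    simp only [hz2, hz1] at this
    rw [hb]; linarith
  have k2 : 1 ≤ b ^ 2 * crat z3 z2 z1 z := by
    have h1 := hcrA z3
    simp only [hz3, hz2, hz1] at h1
    have h2 := mul_le_mul_of_nonneg_left h1 (show 0 ≤ b by linarith)
    have h3 : 0 ≤ b * E * crat z3 z2 z1 z := mul_nonneg (by positivity)
      (crat_pos (hz3 ▸ ltA z3) (hz2 ▸ ltA z2) (hz1 ▸ ltA z1)).le
    have h4 : b ^ 2 * crat z3 z2 z1 z = 4 * (b * E * crat z3 z2 z1 z) := by rw [hb]; ring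
    linarith
  have k3 : 1 ≤ b ^ 3 * crat z4 z3 z2 z1 := by
    have h1 := hcrA z4
    simp only [hz4, hz3, hz2, hz1] at h1
    have h2 := mul_le_mul_of_nonneg_left h1 (show 0 ≤ b ^ 2 by positivity)
    have h3 : 0 ≤ b ^ 2 * E * crat z4 z3 z2 z1 := mul_nonneg (by positivity)
      (crat_pos (hz4 ▸ ltA z4) (hz3 ▸ ltA z3) (hz2 ▸ ltA z2)).le
    have h4 : b ^ 3 * crat z4 z3 z2 z1 = 4 * (b ^ 2 * E * crat z4 z3 z2 z1) := by rw [hb]; ring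
    linarith
  have k4 : 1 ≤ b ^ 4 * crat z5 z4 z3 z2 := by
    have h1 := hcrA z5
    simp only [hz5, hz4, hz3, hz2] at h1
    have h2 := mul_le_mul_of_nonneg_left h1 (show 0 ≤ b ^ 3 by positivity)
    have h3 : 0 ≤ b ^ 3 * E * crat z5 z4 z3 z2 := mul_nonneg (by positivity)
      (crat_pos (hz5 ▸ ltA z5) (hz4 ▸ ltA z4) (hz3 ▸ ltA z3)).le
    have h4 : b ^ 4 * crat z5 z4 z3 z2 = 4 * (b ^ 3 * E * crat z5 z4 z3 z2) := by rw [hb]; ring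
    linarith
  have l1 : z1 < z := hz1 ▸ ltA z1
  have l2 : z2 < z1 := hz2 ▸ ltA z2
  have l3 : z3 < z2 := hz3 ▸ ltA z3
  have l4 : z4 < z3 := hz4 ▸ ltA z4
  have l5 : z5 < z4 := hz5 ▸ ltA z5
  have hm : 0 < A z - z := sub_pos.2 (ltA z)
  have d1 : z - z1 ≤ b * (A z - z) := (le_mul_of_crat_ge l2 l1 (ltA z) k1).2
  have d2 : z1 - z2 ≤ b ^ 2 * (z - z1) := (le_mul_of_crat_ge l3 l2 l1 k2).2
  have d3 : z2 - z3 ≤ b ^ 3 * (z1 - z2) := (le_mul_of_crat_ge l4 l3 l2 k3).2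
  have d4 : z3 - z4 ≤ b ^ 4 * (z2 - z3) := (le_mul_of_crat_ge l5 l4 l3 k4).2
  have hlen : z - z4 ≤ 4 * b ^ 10 * (A z - z) := by
    have e2 : z1 - z2 ≤ b ^ 3 * (A z - z) := d2.trans (by
      have := mul_le_mul_of_nonneg_left d1 (show 0 ≤ b ^ 2 by positivity); linarith)
    have e3 : z2 - z3 ≤ b ^ 6 * (A z - z) := d3.trans (by
      have := mul_le_mul_of_nonneg_left e2 (show 0 ≤ b ^ 3 by positivity); linarith)
    have e4 : z3 - z4 ≤ b ^ 10 * (A z - z) := d4.trans (by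
      have := mul_le_mul_of_nonneg_left e3 (show 0 ≤ b ^ 4 by positivity); linarith)
    have p1 : b * (A z - z) ≤ b ^ 10 * (A z - z) :=
      mul_le_mul_of_nonneg_right (le_self_pow₀ hb1 (by norm_num)) hm.le
    have p3 : b ^ 3 * (A z - z) ≤ b ^ 10 * (A z - z) :=
      mul_le_mul_of_nonneg_right (pow_le_pow_right₀ hb1 (by norm_num)) hm.le
    have p6 : b ^ 6 * (A z - z) ≤ b ^ 10 * (A z - z) :=
      mul_le_mul_of_nonneg_right (pow_le_pow_right₀ hb1 (by norm_num)) hm.le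
    linarith
  have main : ∀ x, 1 ≤ ((1 + 4 * b ^ 10) * (1 + 4 * b ^ 10) * E) *
      crat x (A x) (A (A x)) (A (A (A x))) := by
    intro x
    obtain ⟨i, hi, k, hk1, hk2⟩ := hhit (Φ z - 3 * β - Φ (A x))
    have ΦF : Φ (F^[i] (A x) + k) = Φ (A x) + i * ρ + k := by rw [h.add_int, h.iterate]
    have Φz : Φ z = Φ z4 + 4 * β := by rw [← hz1, ← hz2, ← hz3, ← hz4, ΦA, ΦA, ΦA, ΦA]; ring
    have a1 : z4 < F^[i] (A x) + k := h.lt_of_lt (by rw [ΦF]; linarith)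
    have a2 : A (F^[i] (A x)) + k < z := by
      refine h.lt_of_lt ?_
      rw [← intA, ΦA, ΦF]; linarith
    have hshort : A (F^[i] (A x)) - F^[i] (A x) ≤ 4 * b ^ 10 * (A z - z) := by linarith
    have lk := one_le_mul_crat (C := 4 * b ^ 10) (C' := 4 * b ^ 10)
      (ltA (F^[i] x)) (ltA (A (F^[i] x))) (ltA (A (A (F^[i] x))))
      (by
        rw [itA i x]
        have h1 := mul_le_mul_of_nonneg_left (hzmin (F^[i] x)) (show 0 ≤ 4 * b ^ 10 by positivity)
        rw [itA i x] at h1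
        linarith)
      (by
        rw [itA i x]
        have h1 := mul_le_mul_of_nonneg_left (hzmin (A (F^[i] (A x))))
          (show 0 ≤ 4 * b ^ 10 by positivity)
        linarith)
    simp only [itA] at lk
    have := mul_le_mul_of_nonneg_left (hcr' x i hi.le)
      (show 0 ≤ (1 + 4 * b ^ 10) * (1 + 4 * b ^ 10) by positivity)
    linarith
  intro x
  constructor
  · exact (le_mul_of_crat_ge (ltA _) (ltA _) (ltA _) (main x)).1
  · obtain ⟨y, rfl⟩ := sA x
    exact (le_mul_of_crat_ge (ltA _) (ltA _) (ltA _) (main y)).2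

/-- Absence of wandering intervals. -/
theorem CritLift.strictMono_factor {F Φ : ℝ → ℝ} {S : Finset ℝ} {ρ : ℝ} (hF : CritLift F S)
    (h : RotFactor F Φ ρ)
    (hgood : ∀ ε > (0 : ℝ), ∃ (q : ℕ) (p : ℤ), GoodMover ρ q p ∧ q * ρ - p < ε) :
    StrictMono Φ := by
  obtain ⟨C, hC, hcomp⟩ := hF.exists_comparable h
  refine fun a b hab => lt_of_le_of_ne (h.mono hab.le) fun heq => ?_
  set P : Set ℝ := {y | Φ y = Φ a} with hP
  have hbdd : BddAbove P := by
    refine ⟨a + 1, fun y hy => ?_⟩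
    by_contra hlt
    have h1 := h.mono (not_le.1 hlt).le
    rw [h.deg] at h1
    have h2 : Φ y = Φ a := hy
    linarith
  have hne : P.Nonempty := ⟨a, rfl⟩
  set ε := (b - a) / (2 * C) with hεd
  have hε : 0 < ε := div_pos (by linarith) (by linarith)
  have haS : a ≤ sSup P := le_csSup hbdd rfl
  have hgap : Φ a < Φ (sSup P + ε) := by
    refine lt_of_le_of_ne (h.mono (by linarith)) fun he => ?_
    have := le_csSup hbdd (show sSup P + ε ∈ P from he.symm)
    linarith
  obtain ⟨q, p, hqp, hβ⟩ := hgood _ (sub_pos.2 hgap)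
  obtain ⟨y, hyP, hyb, hys⟩ : ∃ y ∈ P, b ≤ y ∧ sSup P - ε < y := by
    obtain ⟨y, hy, hlt⟩ := exists_lt_of_lt_csSup hne (show sSup P - ε < sSup P by linarith)
    rcases le_total b y with hle | hle
    · exact ⟨y, hy, hle, hlt⟩
    · exact ⟨b, heq.symm, le_rfl, hlt.trans_le hle⟩
  have hyP' : Φ y = Φ a := hyP
  obtain ⟨z, hz⟩ := mover_surjective hF.surj q p y
  have h1 := (hcomp q p hqp z).2
  rw [hz] at h1
  have h2 : mover F q p y < sSup P + ε := h.lt_of_lt (by rw [h.mover]; linarith)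
  have h3 : z < a := h.lt_of_lt (by
    have := h.mover q p z
    rw [hz] at this
    have := hqp.pos
    linarith)
  have h4 : C * (mover F q p y - y) < C * (2 * ε) :=
    mul_lt_mul_of_pos_left (by linarith) (by linarith)
  have h5 : C * (2 * ε) = b - a := by
    rw [hεd]
    field_simp
  linarith

theorem exists_modulus {Φ : ℝ → ℝ} (hΦ : StrictMono Φ) (hdeg : ∀ x, Φ (x + 1) = Φ x + 1)
    {ε : ℝ} (hε : 0 < ε) : ∃ η > (0 : ℝ), ∀ x y, Φ y - Φ x < η → y - x < ε := by
  obtain ⟨N, hN⟩ := exists_nat_gt (2 / ε)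
  have hN0 : (0 : ℝ) < N := lt_trans (by positivity) hN
  have hN0' : 0 < N := by exact_mod_cast hN0
  rw [div_lt_iff₀ hε] at hN
  obtain ⟨k, -, hmin⟩ := Finset.exists_min_image (Finset.range N)
    (fun k => Φ (((k : ℝ) + 1) / N) - Φ ((k : ℝ) / N)) ⟨0, Finset.mem_range.2 hN0'⟩
  refine ⟨_, sub_pos.2 (hΦ (show (k : ℝ) / N < (k + 1) / N by gcongr; linarith)), ?_⟩
  intro x y hxy
  by_contra hge
  rw [not_lt] at hge
  set l := ⌈x * N⌉ with hl
  have hl1 : x * N ≤ l := Int.le_ceil _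
  have hl2 : (l : ℝ) < x * N + 1 := Int.ceil_lt_add_one _
  have hx : x ≤ (l : ℝ) / N := by rwa [le_div_iff₀ hN0]
  have hy : ((l : ℝ) + 1) / N ≤ y := by
    rw [div_le_iff₀ hN0]
    have := mul_le_mul_of_nonneg_right hge hN0.le
    linarith
  obtain ⟨r, hr⟩ := Int.eq_ofNat_of_zero_le (Int.emod_nonneg l (show (N : ℤ) ≠ 0 by omega))
  have hrN : r < N := by
    have := Int.emod_lt_of_pos l (show (0 : ℤ) < N by omega)
    omega
  have hdiv : (l : ℝ) = r + N * (l / (N : ℤ) : ℤ) := by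
    have := Int.emod_add_mul_ediv l N
    rw [hr] at this
    exact_mod_cast this.symm
  have e1 : (l : ℝ) / N = r / N + (l / (N : ℤ) : ℤ) := by
    rw [hdiv]
    field_simp
  have e2 : ((l : ℝ) + 1) / N = (r + 1) / N + (l / (N : ℤ) : ℤ) := by
    rw [add_div, e1]
    ring
  have h1 := hΦ.monotone hx
  have h2 := hΦ.monotone hy
  rw [e1, deg_add_int hdeg] at h1
  rw [e2, deg_add_int hdeg] at h2
  have := hmin r (Finset.mem_range.2 hrN)
  linarith

/-- A power law is incompatible with unbounded growth of the distortion-controlled sequence. -/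
theorem power_bound {p C η k : ℝ} (hp : 1 < p) (hC : 1 ≤ C) (hη : 0 < η) (hk : 0 < k) :
    ∃ Λ ≥ (1 : ℝ), ∀ (m : ℕ) (a b U : ℕ → ℝ), StrictMono a → StrictMono b → StrictMono U →
      a 0 = 0 → b 0 = 0 → U 0 = 0 → (∀ j, a j ≤ C * b j) → (∀ j, b j ≤ C * a j) →
      (∀ j, a (j + 2) ≤ C * a (j + 1)) →
      (∀ r, 1 ≤ r → r ≤ m → k * (a r / a 1) ^ p ≤ U r / U 1) →
      (∀ r, 1 < r → r < m → η * drat 0 (U 1) (U r) (U m) ≤ drat 0 (b 1) (b r) (b m)) →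
      a m ≤ Λ * a 1 := by
  obtain ⟨T, hT1, hT⟩ : ∃ T > (1 : ℝ), ∀ t ≥ T, 2 * C ^ 2 * t < η * (k * t ^ p - 1) := by
    have ht := tendsto_rpow_atTop (show 0 < p - 1 by linarith)
    obtain ⟨T, hT⟩ := eventually_atTop.1
      (ht.eventually_ge_atTop ((2 * C ^ 2 + η + 1) / (η * k)))
    refine ⟨max T 2, lt_max_of_lt_right one_lt_two, fun t htT => ?_⟩
    have h1 : (1 : ℝ) ≤ t := by linarith [le_max_right T 2]
    have h2 := hT t ((le_max_left _ _).trans htT)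
    rw [div_le_iff₀ (by positivity)] at h2
    have h3 : t ^ p = t ^ (p - 1) * t := by
      rw [← Real.rpow_add_one (by linarith)]
      ring_nf
    have h4 := mul_le_mul_of_nonneg_right h2 (show 0 ≤ t by linarith)
    have h5 : η * 1 ≤ η * t := mul_le_mul_of_nonneg_left h1 hη.le
    rw [h3]
    linarith
  have hΛ : 1 ≤ 2 * C ^ 3 * T := by
    have : 1 ≤ C ^ 3 := one_le_pow₀ hC
    nlinarith
  refine ⟨2 * C ^ 3 * T, hΛ, fun m a b U ha hb hU a0 b0 U0 hab hba hstep hpow hd => ?_⟩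
  by_contra hlt
  rw [not_le] at hlt
  have a1 : 0 < a 1 := a0 ▸ ha zero_lt_one
  have b1 : 0 < b 1 := b0 ▸ hb zero_lt_one
  have U1 : 0 < U 1 := U0 ▸ hU zero_lt_one
  have hex : ∃ r, T * a 1 ≤ a r := ⟨m, by
    have : T * a 1 ≤ 2 * C ^ 3 * T * a 1 := by
      have : 1 ≤ C ^ 3 := one_le_pow₀ hC
      have : 0 < T * a 1 := by positivity
      nlinarith
    linarith⟩
  classical
  set r := Nat.find hex with hr
  have hrT : T * a 1 ≤ a r := Nat.find_spec hex
  have hr1 : 1 < r := by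
    by_contra hr1
    have : a r ≤ a 1 := ha.monotone (not_lt.1 hr1)
    nlinarith
  obtain ⟨s, hs⟩ : ∃ s, r = s + 2 := ⟨r - 2, by omega⟩
  have hsT : a (s + 1) < T * a 1 := not_le.1 (Nat.find_min hex (by omega))
  have hrC : a r ≤ C * (T * a 1) := by
    rw [hs]
    exact (hstep s).trans (mul_le_mul_of_nonneg_left hsT.le (by linarith))
  clear_value r
  have hC2 : 1 ≤ C ^ 2 := one_le_pow₀ hC
  have hCT : 0 < C * (T * a 1) := by positivity
  have hrm : r < m := by
    refine ha.lt_iff_lt.1 ?_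
    have : C * (T * a 1) * 1 ≤ C * (T * a 1) * (2 * C ^ 2) :=
      mul_le_mul_of_nonneg_left (by linarith) hCT.le
    linarith
  have ar : 0 < a r := a0 ▸ ha (by omega)
  have br : b 1 < b r := hb hr1
  have brm : b r < b m := hb hrm
  have Ur : U 1 < U r := hU hr1
  have Urm : U r < U m := hU hrm
  have key := hd r hr1 hrm
  have hp1 := hpow r hr1.le hrm.le
  have hT2 := hT (a r / a 1) (by rw [ge_iff_le, le_div_iff₀ a1]; exact hrT)
  have hL : U r / U 1 - 1 ≤ drat 0 (U 1) (U r) (U m) := by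
    unfold drat
    rw [div_sub_one U1.ne', div_le_div_iff₀ U1 (by apply mul_pos <;> linarith)]
    have : 0 ≤ (U r - U 1) * U 1 * U r := by
      apply mul_nonneg (mul_nonneg _ _) <;> linarith
    linarith
  have hbr : 2 * b r ≤ b m := by
    have h1 : b r ≤ C * (C * (T * a 1)) := (hba r).trans (mul_le_mul_of_nonneg_left hrC (by linarith))
    have h2 : C * (C * (C * (T * a 1))) * 2 ≤ C * b m := by linarith [hab m]
    have h3 : C * (2 * (C * (C * (T * a 1)))) ≤ C * b m := by linarith
    have := le_of_mul_le_mul_left h3 (by linarith)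
    linarith
  have hbb : b r / b 1 ≤ C ^ 2 * (a r / a 1) := by
    rw [← mul_div_assoc, div_le_div_iff₀ b1 a1]
    have h1 := mul_le_mul (hba r) (hab 1) a1.le (by positivity)
    linarith
  have hR : drat 0 (b 1) (b r) (b m) ≤ 2 * (b r / b 1) := by
    unfold drat
    rw [← mul_div_assoc, div_le_div_iff₀ (by apply mul_pos <;> linarith) b1]
    have h1 : b m * (b r - b 1) ≤ 2 * (b m - b r) * b r := by
      have h2 : b m * (b r - b 1) ≤ b m * b r := mul_le_mul_of_nonneg_left (by linarith) (by linarith)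
      have h3 : b m * b r ≤ 2 * (b m - b r) * b r :=
        mul_le_mul_of_nonneg_right (by linarith) (by linarith)
      linarith
    have := mul_le_mul_of_nonneg_right h1 b1.le
    linarith
  have h1 := mul_le_mul_of_nonneg_left hL hη.le
  have h2 := mul_le_mul_of_nonneg_left hp1 hη.le
  linarith

theorem CritLift.exists_orbit_bound {F Φ : ℝ → ℝ} {S : Finset ℝ} {ρ : ℝ} (hF : CritLift F S)
    (h : RotFactor F Φ ρ) (hΦ : StrictMono Φ) {c : ℝ} (hc : c ∈ S) {C : ℝ} (hC : 1 ≤ C) :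
    ∃ Λ ≥ (1 : ℝ), ∃ η > (0 : ℝ), ∀ (q : ℕ) (p : ℤ) (m : ℕ) (γ : ℝ), 0 < q → 0 < γ → m * γ < η →
      (∀ i : ℕ, 0 < i → i < q → ∀ k : ℤ, m * γ < |i * ρ + k|) →
      (∀ s ∈ S, ∀ i : ℕ, 0 < i → i < q → ∀ k : ℤ, m * γ < |Φ c - Φ s + i * ρ + k|) →
      ∀ x : ℕ → ℝ, StrictMono x → x 0 = c → (∀ j : ℕ, Φ (x j) = Φ c + j * γ) →
      (∀ j, mover F q p (x j) - mover F q p c ≤ C * (x j - c)) →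
      (∀ j, x j - c ≤ C * (mover F q p (x j) - mover F q p c)) →
      (∀ j, x (j + 2) - c ≤ C * (x (j + 1) - c)) →
      x m - c ≤ Λ * (x 1 - c) := by
  obtain ⟨B, hB, δ, hδ, hdist⟩ := hF.dist
  obtain ⟨e, he, ε, hε, k₁, hk₁, k₂, hk₂, hpow⟩ := hF.power c hc
  obtain ⟨Λ, hΛ, hbound⟩ := power_bound he hC (Real.exp_pos (-(B * (δ / 2 * 2))))
    (div_pos hk₁ hk₂)
  obtain ⟨η, hη, hmod⟩ := exists_modulus hΦ h.deg (show 0 < min (min ε (δ / 2)) 1 by positivity)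
  refine ⟨Λ, hΛ, η, hη, fun q p m γ hq hγ hm hsep hcrit x hx hx0 hΦx hA1 hA2 hst => ?_⟩
  have hlen : ∀ u v, Φ v - Φ u ≤ m * γ → v - u < ε ∧ v - u < δ / 2 ∧ v - u < 1 := by
    intro u v huv
    have := hmod u v (by linarith)
    simpa only [lt_min_iff, and_assoc] using this
  have mA := mover_strictMono hF.mono q p
  have hle : ∀ r ≤ m, Φ (x r) - Φ c ≤ m * γ := by
    intro r hr
    have : (r : ℝ) * γ ≤ m * γ := mul_le_mul_of_nonneg_right (by exact_mod_cast hr) hγ.le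
    rw [hΦx]
    linarith
  have hcx : ∀ r, 0 < r → c < x r := fun r hr => hx0 ▸ hx hr
  refine hbound m (fun j => x j - c) (fun j => mover F q p (x j) - mover F q p c)
    (fun j => F (x j) - F c) (fun i j hij => sub_lt_sub_right (hx hij) _)
    (fun i j hij => sub_lt_sub_right (mA (hx hij)) _)
    (fun i j hij => sub_lt_sub_right (hF.mono (hx hij)) _)
    (by simp [hx0]) (by simp [hx0]) (by simp [hx0]) hA2 hA1 hst ?_ ?_
  · intro r hr hrm
    have u1 : 0 < x 1 - c := sub_pos.2 (hcx 1 one_pos)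
    have ur : 0 < x r - c := sub_pos.2 (hcx r hr)
    have v1 : 0 < F (x 1) - F c := sub_pos.2 (hF.mono (hcx 1 one_pos))
    have vr : 0 < F (x r) - F c := sub_pos.2 (hF.mono (hcx r hr))
    have h1 := (hpow (x 1) (by rw [abs_of_pos u1]; exact (hlen _ _ (hle 1 (hr.trans hrm))).1)).2
    have h2 := (hpow (x r) (by rw [abs_of_pos ur]; exact (hlen _ _ (hle r hrm)).1)).1
    rw [abs_of_pos u1, abs_of_pos v1] at h1
    rw [abs_of_pos ur, abs_of_pos vr] at h2
    rw [Real.div_rpow ur.le u1.le, div_mul_div_comm]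
    exact div_le_div₀ vr.le h2 v1 h1
  · intro r hr hrm
    have o1 : F c < F (x 1) := hF.mono (hcx 1 one_pos)
    have o2 : F (x 1) < F (x r) := hF.mono (hx hr)
    have o3 : F (x r) < F (x m) := hF.mono (hx hrm)
    have hit : ∀ i y, F^[i] (F y) = F^[i + 1] y := fun i y => (Function.iterate_succ_apply F i y).symm
    have hΦd : ∀ i, Φ (F^[i] (x m)) - Φ (F^[i] c) = m * γ := fun i => by
      rw [h.iterate, h.iterate, hΦx]
      ring
    have hsepm : SepMod (q - 1) (fun i => F^[i] (F c)) (fun i => F^[i] (F (x m))) := by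
      refine sepMod_iterate hF.mono hF.deg h fun k hk hkq l => Or.inl ?_
      rw [h.conj, h.conj, hΦx]
      have := hsep k hk (by omega) l
      linarith
    have hsum : ∑ i ∈ Finset.range (q - 1), (F^[i] (F (x m)) - F^[i] (F c)) ≤ 2 :=
      hsepm.sum_le fun i _ => by
        have hlt := (hF.mono.iterate (i + 1)) (hcx m (by omega))
        have := (hlen _ _ (hΦd (i + 1)).le).2.2
        simp only [hit]
        constructor <;> linarith
    have key := drat_iterate_ge hB hF.mono hdist o1 o2 o3 (q - 1) (ε := δ / 2) (σ := 2) (by linarith)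
      (fun i _ => by rw [hit, hit]; exact (hlen _ _ (hΦd (i + 1)).le).2.1.le) (by linarith) hsum
      (fun i hi s hs k hk => by
        rw [hit, hit] at hk
        have k1 := hΦ hk.1
        have k2 := hΦ hk.2
        rw [h.add_int, h.iterate] at k1 k2
        rw [hΦx] at k2
        have := hcrit s hs (i + 1) (by omega) (by omega) (-k)
        push_cast at this k1 k2
        rw [abs_of_neg (by linarith)] at this
        linarith)
    have hq' : ∀ y, F^[q - 1] (F y) = mover F q p y + p := fun y => by
      rw [hit, Nat.sub_add_cancel hq, mover]
      ring
    simp only [hq', drat_add] at key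
    have e1 := drat_add 0 (F (x 1) - F c) (F (x r) - F c) (F (x m) - F c) (F c)
    have e2 := drat_add 0 (mover F q p (x 1) - mover F q p c) (mover F q p (x r) - mover F q p c)
      (mover F q p (x m) - mover F q p c) (mover F q p c)
    simp only [zero_add, sub_add_cancel] at e1 e2
    rw [← e1, ← e2]
    exact key

/-- Near a critical point, boundedly many steps of a closest-return map are seen as one. -/
theorem CritLift.exists_power_comparison {F Φ : ℝ → ℝ} {S : Finset ℝ} {ρ : ℝ} (hF : CritLift F S)
    (h : RotFactor F Φ ρ) (hΦ : StrictMono Φ) {c : ℝ} (hc : c ∈ S) :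
    ∃ Λ ≥ (1 : ℝ), ∃ η > (0 : ℝ), ∀ (q : ℕ) (p : ℤ) (m : ℕ), GoodMover ρ q p →
      m * (q * ρ - p) < η →
      (∀ s ∈ S, ∀ i : ℕ, 0 < i → i < q → ∀ k : ℤ, m * (q * ρ - p) < |Φ c - Φ s + i * ρ + k|) →
      ∀ x : ℕ → ℝ, x 0 = c →
        ((∀ j, x (j + 1) = mover F q p (x j)) → x m - c ≤ Λ * (x 1 - c)) ∧
        ((∀ j, mover F q p (x (j + 1)) = x j) → c - x m ≤ Λ * (c - x 1)) := by
  obtain ⟨C, hC, hcomp⟩ := hF.exists_comparable h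
  obtain ⟨Λ₁, hΛ₁, η₁, hη₁, H₁⟩ := hF.exists_orbit_bound h hΦ hc (show 1 ≤ 1 + C by linarith)
  have hΦr : StrictMono fun x => -Φ (-x) := fun x y hxy => neg_lt_neg (hΦ (neg_lt_neg hxy))
  obtain ⟨Λ₂, hΛ₂, η₂, hη₂, H₂⟩ := hF.reflect.exists_orbit_bound h.reflect hΦr
    (Finset.mem_image_of_mem _ hc) (show 1 ≤ 1 + C by linarith)
  refine ⟨max Λ₁ Λ₂, le_max_of_le_left hΛ₁, min η₁ η₂, lt_min hη₁ hη₂, ?_⟩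
  intro q p m hqp hm hcrit x hx0
  have hβ := hqp.pos
  have ltA := lt_mover h hβ
  have hsep : ∀ i : ℕ, 0 < i → i < q → ∀ k : ℤ, m * (q * ρ - p) < |i * ρ + k| := by
    intro i hi hiq k
    have := hcrit c hc i hi hiq k
    simpa using this
  constructor
  · intro hx
    have hmono : StrictMono x := strictMono_nat_of_lt_succ fun j => by rw [hx]; exact ltA _
    have hpos : ∀ j, 0 ≤ x j - c := fun j => sub_nonneg.2 (hx0 ▸ hmono.monotone (Nat.zero_le j))
    have d1 : ∀ j, x (j + 1) - x 1 ≤ C * (x j - c) := by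
      intro j
      induction j with
      | zero => simp [hx0]
      | succ j ih =>
        have := (hcomp q p hqp (x j)).1
        rw [← hx, ← hx] at this
        linarith
    have d2 : ∀ j, x j - c ≤ C * (x (j + 1) - x 1) := by
      intro j
      induction j with
      | zero => simp [hx0]
      | succ j ih =>
        have := (hcomp q p hqp (x j)).2
        rw [← hx, ← hx] at this
        linarith
    have hc1 : mover F q p c = x 1 := by rw [← hx0, ← hx]
    have key := H₁ q p m _ hqp.q_pos hβ (hm.trans_le (min_le_left _ _)) hsep hcrit x hmono hx0
      (fun j => by
        induction j with
        | zero => simp [hx0]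
        | succ j ih => rw [hx, h.mover, ih]; push_cast; ring)
      (fun j => by rw [← hx, hc1]; linarith [d1 j, hpos j])
      (fun j => by
        rw [← hx, hc1]
        have := hmono.monotone (show 1 ≤ j + 1 by omega)
        linarith [d2 j])
      (fun j => by
        have := hmono.monotone (show 1 ≤ j + 1 by omega)
        linarith [d1 (j + 1)])
    exact key.trans (mul_le_mul_of_nonneg_right (le_max_left _ _) (hpos 1))
  · intro hx
    have hanti : StrictAnti x := strictAnti_nat_of_succ_lt fun j => by
      have := ltA (x (j + 1))
      rwa [hx] at this
    have hpos : ∀ j, 0 ≤ c - x j := fun j => sub_nonneg.2 (hx0 ▸ hanti.antitone (Nat.zero_le j))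
    have d1 : ∀ j, mover F q p c - mover F q p (x j) ≤ C * (c - x j) := by
      intro j
      induction j with
      | zero => simp [hx0]
      | succ j ih =>
        have := (hcomp q p hqp (x (j + 1))).1
        rw [hx] at this ⊢
        linarith
    have d2 : ∀ j, c - x j ≤ C * (mover F q p c - mover F q p (x j)) := by
      intro j
      induction j with
      | zero => simp [hx0]
      | succ j ih =>
        have := (hcomp q p hqp (x (j + 1))).2
        rw [hx] at this ⊢
        linarith
    have d3 : ∀ j, x 1 - x (j + 1) ≤ C * (c - x j) := by
      intro j
      induction j with
      | zero => simp [hx0]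
      | succ j ih =>
        have := (hcomp q p hqp (x (j + 2))).2
        rw [hx, hx] at this
        linarith
    have mA := mover_strictMono hF.mono q p
    have key := H₂ q (-p) m (q * ρ - p) hqp.q_pos hβ (hm.trans_le (min_le_right _ _))
      (fun i hi hiq k => by
        have := hsep i hi hiq (-k)
        rw [← abs_neg] at this
        convert this using 2
        push_cast
        ring)
      (fun t ht i hi hiq k => by
        obtain ⟨s, hs, rfl⟩ := Finset.mem_image.1 ht
        have := hcrit s hs i hi hiq (-k)
        rw [← abs_neg] at this
        convert this using 2
        push_cast
        simp only [neg_neg]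
        ring)
      (fun j => -x j) (fun i j hij => neg_lt_neg (hanti hij)) (by rw [hx0])
      (fun j => by
        simp only [neg_neg]
        induction j with
        | zero => simp [hx0]
        | succ j ih =>
          have := h.mover q p (x (j + 1))
          rw [hx] at this
          push_cast
          linarith)
      (fun j => by
        simp only [mover_reflect, neg_neg]
        linarith [d1 j, hpos j])
      (fun j => by
        simp only [mover_reflect, neg_neg]
        have := mA.monotone (sub_nonneg.1 (hpos j))
        linarith [d2 j])
      (fun j => by
        have := hanti.antitone (show 1 ≤ j + 1 by omega)
        linarith [d3 (j + 1)])
    have := mul_le_mul_of_nonneg_right (le_max_right Λ₁ Λ₂) (hpos 1)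
    linarith

/-- The previous best approximation, which lies on the other side. -/
theorem GoodMover.exists_prev {ρ : ℝ} (hρ : Irrational ρ) {q : ℕ} {p : ℤ}
    (h : GoodMover ρ q p) (hq : 8 < q) : ∃ (q' : ℕ) (p' : ℤ), 0 < q' ∧ q' < q ∧
      GoodMover (-ρ) q' (-p') ∧ p' - q' * ρ ≤ 1 / q ∧
      ∀ i : ℕ, 0 < i → i < q → ∀ m : ℤ, p' - q' * ρ < |i * ρ + m| ∨ (i = q' ∧ m = -p') := by
  obtain ⟨q', hq', hmin⟩ := Finset.exists_min_image (Finset.Ioo 0 q)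
    (fun i => |i * ρ - round (i * ρ)|) ⟨1, Finset.mem_Ioo.2 (by omega)⟩
  rw [Finset.mem_Ioo] at hq'
  set p' := round (q' * ρ) with hp'
  have hle : ∀ i : ℕ, 0 < i → i < q → ∀ m : ℤ, |q' * ρ - p'| ≤ |i * ρ + m| := by
    intro i hi hiq m
    refine (hmin i (Finset.mem_Ioo.2 ⟨hi, hiq⟩)).trans ?_
    have := round_le ((i : ℝ) * ρ) (-m)
    push_cast at this
    rwa [sub_neg_eq_add] at this
  clear_value p'
  have hβ := h.best q' hq'.1 hq'.2 (-p')
  push_cast at hβ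
  rw [← sub_eq_add_neg] at hβ
  have hneg : q' * ρ - p' < 0 := by
    by_contra hge
    rw [not_lt] at hge
    rw [abs_of_nonneg hge] at hβ
    have h1 := hle (q - q') (by omega) (by omega) (p' - p)
    rw [abs_of_nonneg hge, Nat.cast_sub hq'.2.le] at h1
    push_cast at h1
    rw [abs_of_neg (by linarith)] at h1
    linarith [h.pos]
  have habs : |q' * ρ - p'| = p' - q' * ρ := by rw [abs_of_neg hneg]; ring
  rw [habs] at hle
  have hstrict : ∀ i : ℕ, 0 < i → i < q → ∀ m : ℤ,
      p' - q' * ρ < |i * ρ + m| ∨ (i = q' ∧ m = -p') := by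
    intro i hi hiq m
    rcases lt_or_eq_of_le (hle i hi hiq m) with h1 | h1
    · exact Or.inl h1
    · right
      rcases abs_cases ((i : ℝ) * ρ + m) with ⟨h2, -⟩ | ⟨h2, -⟩
      · have := hρ.int_mul_add_eq_zero (a := i + q') (b := m - p') (by push_cast; linarith)
        omega
      · have := hρ.int_mul_add_eq_zero (a := i - q') (b := m + p') (by push_cast; linarith)
        omega
  have hqR : (8 : ℝ) < q := by exact_mod_cast hq
  have hsmall : p' - q' * ρ ≤ 1 / q := by
    obtain ⟨k, hk, hkq, hk2⟩ := Real.exists_nat_abs_mul_sub_round_le ρ (show 0 < q - 1 by omega)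
    have h1 := hle k hk (by omega) (-round (k * ρ))
    push_cast at h1
    rw [← sub_eq_add_neg] at h1
    refine h1.trans (hk2.trans_eq ?_)
    rw [Nat.cast_sub (by omega)]
    simp
  refine ⟨q', p', hq'.1, hq'.2, ⟨hq'.1, by push_cast; linarith, ?_, ?_⟩, hsmall, hstrict⟩
  · have : (1 : ℝ) / q < 1 / 8 := by
      apply one_div_lt_one_div_of_lt <;> linarith
    push_cast
    linarith
  · intro i hi hiq m
    rcases hstrict i hi (by omega) (-m) with h1 | h1
    · rw [← abs_neg] at h1
      push_cast at h1 ⊢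
      rw [show (i : ℝ) * -ρ + m = -(i * ρ + -m) by ring]
      linarith
    · omega

theorem exists_small_step (w : ℕ → ℝ) (a : ℕ) {n : ℕ} (hn : 0 < n) {μ : ℝ}
    (h : w (a + n) - w a ≤ n * μ) : ∃ j < n, w (a + j + 1) - w (a + j) ≤ μ := by
  have hs := Finset.sum_range_sub (fun j => w (a + j)) n
  obtain ⟨j, hj, hle⟩ := Finset.exists_le_of_sum_le (s := Finset.range n)
    (f := fun j => w (a + (j + 1)) - w (a + j)) (g := fun _ => μ)
    ⟨0, Finset.mem_range.2 hn⟩ (by rw [hs]; simpa using h)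
  exact ⟨j, Finset.mem_range.1 hj, hle⟩

theorem drat_shift_le {a b c d δa δb δc δd Λ E : ℝ} (hab : a < b) (hcd : c < d)
    (h0 : 0 ≤ δa) (h1 : δa ≤ δb) (h2 : 0 < δb) (h3 : δb ≤ c - b) (h4 : c - b ≤ Λ * δb)
    (h5 : 0 < δc) (hE : 1 ≤ E) (h6 : 2 * E * δc ≤ δb) (h7 : d - b ≤ E * δd) :
    drat (a + δa) (b + δb) (c + δc) (d + δd) ≤ (1 - 1 / (2 * Λ)) * drat a b c d := by
  have hE0 : 0 < E := by linarith
  have hΛ : 0 < Λ := by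
    by_contra hΛ
    have := mul_nonpos_of_nonpos_of_nonneg (not_lt.1 hΛ) h2.le
    linarith
  have hc2 : 2 * δc ≤ δb := by
    have : 2 * δc * 1 ≤ 2 * δc * E := mul_le_mul_of_nonneg_left hE (by linarith)
    linarith
  have hd2 : 2 * δc ≤ δd := by
    refine le_of_mul_le_mul_left (?_ : E * (2 * δc) ≤ E * δd) hE0
    linarith
  have e : ∀ a b c d : ℝ, drat a b c d = ((d - a) / (d - c)) * ((c - b) / (b - a)) := by
    intro a b c d
    unfold drat
    rw [div_mul_div_comm, mul_comm (d - c)]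
  rw [e, e, mul_left_comm]
  refine mul_le_mul ?_ ?_ (div_nonneg (by linarith) (by linarith))
    (div_nonneg (by linarith) (by linarith))
  · rw [div_le_div_iff₀ (by linarith) (by linarith)]
    have k1 : δc * (d - c) ≤ δc * (E * δd) := mul_le_mul_of_nonneg_left (by linarith) h5.le
    have k2 : δd * (2 * E * δc) ≤ δd * (c - a) := mul_le_mul_of_nonneg_left (by linarith) (by linarith)
    have k3 : 2 * δc * (c - a) ≤ δd * (c - a) := mul_le_mul_of_nonneg_right hd2 (by linarith)
    have k4 : 0 ≤ δa * (d - c) := mul_nonneg h0 (by linarith)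
    linarith
  · rw [← mul_div_assoc]
    refine div_le_div₀ ?_ ?_ (by linarith) (by linarith)
    · refine mul_nonneg ?_ (by linarith)
      rw [sub_nonneg, div_le_one (by positivity)]
      have : 1 ≤ Λ := by
        refine le_of_mul_le_mul_right (?_ : 1 * δb ≤ Λ * δb) h2
        linarith
      linarith
    · have k1 : 1 / (2 * Λ) * (c - b) ≤ 1 / (2 * Λ) * (Λ * δb) :=
        mul_le_mul_of_nonneg_left h4 (by positivity)
      have k2 : 1 / (2 * Λ) * (Λ * δb) = δb / 2 := by field_simp
      linarith

/-- The gap to the left of the critical point between consecutive closest returns is bounded by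
the fundamental domain on its right. -/
theorem CritLift.exists_left_gap_bound {F Φ : ℝ → ℝ} {x₀ : ℝ} {ρ : ℝ} (hF : CritLift F {x₀})
    (h : RotFactor F Φ ρ) (hΦ : StrictMono Φ) : ∃ E ≥ (1 : ℝ), ∃ N : ℕ,
      ∀ (q : ℕ) (p : ℤ) (q' : ℕ) (p' : ℤ), N ≤ q → GoodMover ρ q p → q' < q →
        GoodMover (-ρ) q' (-p') → p' - q' * ρ ≤ 1 / q →
        (∀ i : ℕ, 0 < i → i < q → ∀ m : ℤ, p' - q' * ρ < |i * ρ + m| ∨ (i = q' ∧ m = -p')) →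
        ∀ i < q, ∀ (k : ℤ) (e : ℝ), F^[i] e = x₀ + k →
          e - mover F q' p' e ≤ E * (mover F q p e - e) := by
  obtain ⟨C, hC, hcomp⟩ := hF.exists_comparable h
  obtain ⟨C', hC', hcomp'⟩ := hF.reflect.exists_comparable h.reflect
  obtain ⟨Λ, hΛ, η, hη, hpc⟩ := hF.exists_power_comparison h hΦ (Finset.mem_singleton_self x₀)
  obtain ⟨E, hE, hcross⟩ := hF.exists_cross_bound
  set D := (1 + C) * Λ * C with hD
  have hD0 : 1 ≤ D := by
    have := one_le_mul_of_one_le_of_one_le (one_le_mul_of_one_le_of_one_le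
      (show 1 ≤ 1 + C by linarith) hΛ) hC
    exact this
  clear_value D
  obtain ⟨N, hN⟩ := exists_nat_gt (1 / η)
  have hE1 : 1 ≤ (1 + C') * (1 + D) * E := one_le_mul_of_one_le_of_one_le
    (one_le_mul_of_one_le_of_one_le (by linarith) (by linarith)) hE
  refine ⟨(1 + C') * (1 + D) * E, hE1, N, ?_⟩
  intro q p q' p' hNq hqp hq'q hqp' hsmall hstrict i hiq k e he
  set A := mover F q p with hA
  set A' := mover F q' p' with hA'
  have mA : StrictMono A := mover_strictMono hF.mono q p
  have sA : Function.Surjective A := mover_surjective hF.surj q p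
  have mA' : StrictMono A' := mover_strictMono hF.mono q' p'
  have ΦA : ∀ x, Φ (A x) = Φ x + (q * ρ - p) := h.mover q p
  have ΦA' : ∀ x, Φ (A' x) = Φ x + (q' * ρ - p') := h.mover q' p'
  have ltA : ∀ x, x < A x := lt_mover h hqp.pos
  set β := q * ρ - p with hβd
  set β' := p' - q' * ρ with hβ'd
  have hβ : 0 < β := hqp.pos
  have hβ' : 0 < β' := by have := hqp'.pos; push_cast at this; linarith
  have hβ'8 : β' < 1 / 8 := by have := hqp'.small; push_cast at this; linarith
  have hβ8 : β < 1 / 8 := hqp.small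
  have ΦA'' : ∀ x, Φ (A' x) = Φ x - β' := fun x => by rw [ΦA', hβ'd]; ring
  have ltA' : ∀ x, A' x < x := fun x => h.lt_of_lt (by rw [ΦA'']; linarith)
  have hββ' : β < β' := by
    have := hqp.best q' hqp'.q_pos hq'q (-p')
    push_cast at this
    rwa [abs_of_neg (by linarith), show -((q' : ℝ) * ρ + -p') = β' by rw [hβ'd]; ring] at this
  -- comparison at the critical point
  have hgap : x₀ - A' x₀ ≤ D * (A x₀ - x₀) := by
    obtain ⟨m, hm1, hm2, hm0⟩ : ∃ m : ℕ, m * β < β' ∧ β' ≤ (m + 1) * β ∧ 0 < m := by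
      have h1 : 1 < ⌈β' / β⌉₊ := Nat.lt_ceil.2 (by rw [Nat.cast_one, lt_div_iff₀ hβ]; linarith)
      have h2 := Nat.le_ceil (β' / β)
      have h3 := Nat.ceil_lt_add_one (div_pos hβ' hβ).le
      refine ⟨⌈β' / β⌉₊ - 1, ?_, ?_, by omega⟩
      · rw [← lt_div_iff₀ hβ, Nat.cast_sub h1.le, Nat.cast_one]
        linarith
      · rw [← div_le_iff₀ hβ, Nat.cast_sub h1.le, Nat.cast_one]
        linarith
    set x : ℕ → ℝ := fun j => (Function.surjInv sA)^[j] x₀ with hx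
    have hx0 : x 0 = x₀ := rfl
    have hxA : ∀ j, A (x (j + 1)) = x j := fun j => by
      simp only [hx, Function.iterate_succ_apply']
      exact Function.surjInv_eq sA _
    clear_value x
    have hηβ : m * β < η := by
      have h1 : (1 : ℝ) / q < η := by
        have hNq' : (N : ℝ) ≤ q := by exact_mod_cast hNq
        have hq0 : (0 : ℝ) < q := lt_of_lt_of_le (lt_trans (by positivity) hN) hNq'
        rw [div_lt_iff₀ hq0]
        rw [div_lt_iff₀ hη] at hN
        have := mul_le_mul_of_nonneg_right hNq' hη.le
        linarith
      linarith
    have key := (hpc q p m hqp hηβ (fun s hs j hj hjq l => by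
      rw [Finset.mem_singleton] at hs
      subst hs
      rw [sub_self, zero_add]
      rcases hstrict j hj hjq l with h1 | ⟨rfl, rfl⟩
      · linarith
      · push_cast
        rw [abs_of_neg (by linarith)]
        linarith) x hx0).2 hxA
    have hanti : StrictAnti x := strictAnti_nat_of_succ_lt fun j => by
      have := ltA (x (j + 1))
      rwa [hxA] at this
    have hΦx : ∀ j : ℕ, Φ (x j) = Φ x₀ - j * β := by
      intro j
      induction j with
      | zero => simp [hx0]
      | succ j ih =>
        have := ΦA (x (j + 1))
        rw [hxA] at this
        push_cast
        linarith
    have h1 : x (m + 1) ≤ A' x₀ := hΦ.le_iff_le.1 (by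
      rw [hΦx, ΦA'']
      push_cast
      linarith)
    have h2 : x m - x (m + 1) ≤ C * (x₀ - x m) := by
      obtain ⟨l, rfl⟩ : ∃ l, m = l + 1 := ⟨m - 1, by omega⟩
      have h3 := (hcomp q p hqp (x (l + 2))).2
      rw [← hA, hxA, hxA] at h3
      have h4 : C * (x l - x (l + 1)) ≤ C * (x₀ - x (l + 1)) :=
        mul_le_mul_of_nonneg_left (by linarith [hx0 ▸ hanti.antitone (Nat.zero_le l)]) (by linarith)
      linarith
    have h3 := (hcomp q p hqp (x 1)).2
    rw [← hA, hxA, hx0] at h3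
    have h4 : (1 + C) * (x₀ - x m) ≤ (1 + C) * (Λ * (x₀ - x 1)) :=
      mul_le_mul_of_nonneg_left key (by linarith)
    have h5 : (1 + C) * Λ * (x₀ - x 1) ≤ (1 + C) * Λ * (C * (A x₀ - x₀)) :=
      mul_le_mul_of_nonneg_left h3 (by positivity)
    rw [hD]
    linarith
  have hgap' : x₀ - A' x₀ ≤ C' * (A' x₀ - A' (A' x₀)) := by
    have := (hcomp' q' (-p') hqp' (-x₀)).2
    simp only [mover_reflect, neg_neg] at this
    rw [← hA'] at this
    linarith
  have hcr := one_le_mul_crat (ltA' (A' x₀)) (ltA' x₀) (ltA x₀) hgap' hgap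
  -- transport to the preimage of the critical point
  have sepL : ∀ y, SepMod q (fun i => F^[i] (A' y)) (fun i => F^[i] y) := by
    intro y
    refine sepMod_iterate hF.mono hF.deg h fun j hj hjq l => ?_
    rcases hstrict j hj hjq l with h1 | ⟨rfl, rfl⟩
    · left
      rw [ΦA'']
      linarith
    · right; right
      rw [hA', mover]
      push_cast
      ring
  have sepR : SepMod q (fun i => F^[i] e) (fun i => F^[i] (A e)) := by
    refine sepMod_iterate hF.mono hF.deg h fun j hj hjq l => Or.inl ?_
    rw [ΦA]
    have := hqp.best j hj hjq l
    linarith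
  have hle : A e ≤ A' (A' e) + 1 := (h.lt_of_lt (by
    rw [h.deg, ΦA, ΦA'', ΦA'']; linarith)).le
  have htr := hcross q _ _ _ _ (ltA' (A' e)) (ltA' e) (ltA e) hle (sepL _) (sepL _) sepR i hiq.le
  have c1 : F^[i] (A e) = A x₀ + k := by
    rw [hA, ← mover_iterate hF.deg, he, mover_add_int hF.deg]
  have c2 : F^[i] (A' e) = A' x₀ + k := by
    rw [hA', ← mover_iterate hF.deg, he, mover_add_int hF.deg]
  have c3 : F^[i] (A' (A' e)) = A' (A' x₀) + k := by
    rw [hA', ← mover_iterate hF.deg, ← hA', c2, hA', mover_add_int hF.deg]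
  rw [he, c1, c2, c3, crat_add] at htr
  have := mul_le_mul_of_nonneg_left htr (show 0 ≤ (1 + C') * (1 + D) by positivity)
  refine (le_mul_of_crat_ge (ltA' (A' e)) (ltA' e) (ltA e) ?_).2
  linarith

/-- A unicritical map admits no long, geometrically short stretch of a closest-return orbit that
stays away from the critical orbit. -/
theorem CritLift.exists_no_short_stretch {F Φ : ℝ → ℝ} {x₀ : ℝ} {ρ : ℝ} (hF : CritLift F {x₀})
    (h : RotFactor F Φ ρ) (hΦ : StrictMono Φ) {Λ : ℝ} (hΛ : 1 ≤ Λ) : ∃ K₀ : ℕ,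
      ∀ (K q : ℕ) (p : ℤ), K₀ ≤ K → K₀ ≤ q → GoodMover ρ q p →
        (∀ i : ℕ, 0 < i → i < q → ∀ m : ℤ, K * (q * ρ - p) < |i * ρ + m|) →
        ∀ z₀ : ℝ, (∀ i < q, ∀ k : ℤ, K * (q * ρ - p) < |Φ z₀ - Φ x₀ + i * ρ + k|) →
        ∀ w : ℕ → ℝ, (∀ j, mover F q p (w j) = w (j + 1)) → w K = z₀ →
          w (2 * K) - w K ≤ Λ * (w (K + 1) - w K) → w K - w 0 ≤ Λ * (w (K + 1) - w K) →
          False := by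
  obtain ⟨E, hE, N₁, hleft⟩ := hF.exists_left_gap_bound h hΦ
  obtain ⟨B, hB, δ, hδ, hdist⟩ := hF.dist
  obtain ⟨ε, hε, hεδ, hεB⟩ : ∃ ε > (0 : ℝ), ε < δ ∧ B * (ε * 4) < 1 / (2 * Λ) := by
    refine ⟨min (δ / 2) (1 / (16 * Λ * (B + 1))), lt_min (by linarith) (by positivity),
      (min_le_left _ _).trans_lt (by linarith), ?_⟩
    have h1 : B * (min (δ / 2) (1 / (16 * Λ * (B + 1))) * 4) ≤ B * (1 / (16 * Λ * (B + 1)) * 4) :=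
      mul_le_mul_of_nonneg_left (mul_le_mul_of_nonneg_right (min_le_right _ _) (by norm_num)) hB
    refine h1.trans_lt ?_
    rw [show B * (1 / (16 * Λ * (B + 1)) * 4) = (4 * B) / (16 * Λ * (B + 1)) by ring,
      div_lt_div_iff₀ (by positivity) (by positivity)]
    have : 0 ≤ B * Λ := by positivity
    linarith
  obtain ⟨η, hη, hmod⟩ := exists_modulus hΦ h.deg hε
  obtain ⟨N₂, hN₂⟩ := exists_nat_gt (2 / η)
  obtain ⟨N₃, hN₃⟩ := exists_nat_gt (2 * Λ * E + 1)
  refine ⟨max (max N₁ N₂) (max N₃ 9), ?_⟩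
  intro K q p hK hq hqp hsep z₀ hz w hw hwK hR hL
  have hN₁q : N₁ ≤ q := ((le_max_left _ _).trans (le_max_left _ _)).trans hq
  have hN₂q : N₂ ≤ q := ((le_max_right _ _).trans (le_max_left _ _)).trans hq
  have hN₃K : N₃ ≤ K := ((le_max_left _ _).trans (le_max_right _ _)).trans hK
  have h9K : 9 ≤ K := ((le_max_right _ _).trans (le_max_right _ _)).trans hK
  have h9q : 9 ≤ q := ((le_max_right _ _).trans (le_max_right _ _)).trans hq
  obtain ⟨q', p', hq'0, hq'q, hqp', hsmall, hstrict⟩ := hqp.exists_prev h.irr (by omega)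
  have hE' := hleft q p q' p' hN₁q hqp hq'q hqp' hsmall hstrict
  have hAq : ∀ x, F^[q] x = mover F q p x + p := fun x => by rw [mover]; ring
  set A := mover F q p with hA
  set A' := mover F q' p' with hA'
  have mA : StrictMono A := mover_strictMono hF.mono q p
  have ΦA : ∀ x, Φ (A x) = Φ x + (q * ρ - p) := h.mover q p
  have ΦA' : ∀ x, Φ (A' x) = Φ x + (q' * ρ - p') := h.mover q' p'
  have ltA : ∀ x, x < A x := lt_mover h hqp.pos
  clear_value A A'
  have hβ : 0 < q * ρ - p := hqp.pos
  have hβ' : 0 < p' - q' * ρ := by have := hqp'.pos; push_cast at this; linarith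
  have hβ'8 : p' - q' * ρ < 1 / 8 := by have := hqp'.small; push_cast at this; linarith
  have hKβ' : K * (q * ρ - p) < p' - q' * ρ := by
    have := hsep q' hq'0 hq'q (-p')
    push_cast at this
    rwa [abs_of_neg (by linarith), show -((q' : ℝ) * ρ + -p') = p' - q' * ρ by ring] at this
  have eβ : (q : ℝ) * ρ = (q * ρ - p) + p := by ring
  have eβ' : (q' : ℝ) * ρ = p' - (p' - q' * ρ) := by ring
  set β : ℝ := q * ρ - p with hβd
  set β' : ℝ := p' - q' * ρ with hβ'd
  clear_value β β'
  have hKR : (9 : ℝ) ≤ K := by exact_mod_cast h9K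
  have hβK : β ≤ K * β := by
    have : 1 * β ≤ K * β := mul_le_mul_of_nonneg_right (by linarith) hβ.le
    linarith
  -- the closest preimage of the critical point on the right
  obtain ⟨i, hi, k, hτ, hmin⟩ := exists_min_pos_offset (fun i => Φ x₀ - i * ρ - Φ z₀) hqp.q_pos
  obtain ⟨e, he⟩ := hF.surj.iterate i (x₀ + k)
  have hΦe : Φ e = Φ z₀ + (Φ x₀ - i * ρ - Φ z₀ + k) := by
    have := h.iterate i e
    rw [he, h.add_int] at this
    linarith
  have hoff : ∀ j < q, ∀ l : ℤ, K * β < |Φ x₀ - j * ρ - Φ z₀ + l| := by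
    intro j hj l
    have := hz j hj (-l)
    rw [← abs_neg] at this
    push_cast at this
    convert this using 2
    ring
  have hEe := hE' i hi k e he
  have hτK := hoff i hi k
  set τ : ℝ := Φ x₀ - i * ρ - Φ z₀ + k with hτd
  rw [abs_of_pos hτ] at hτK
  have hτβ' : τ < β' := by
    by_contra hge
    rw [not_lt] at hge
    rcases le_or_gt q' i with hqi | hqi
    · have e1 : Φ x₀ - ((i - q' : ℕ) : ℝ) * ρ - Φ z₀ + ((k - p' : ℤ) : ℝ) = τ - β' := by
        rw [Nat.cast_sub hqi, hτd]
        push_cast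
        linarith
      rcases hge.lt_or_eq with h1 | h1
      · have h2 := hmin (i - q') (by omega) (k - p') (by rw [e1]; linarith)
        rw [e1] at h2
        linarith
      · have h2 := hoff (i - q') (by omega) (k - p')
        rw [e1, h1, sub_self, abs_zero] at h2
        linarith
    · have e1 : Φ x₀ - ((i + q - q' : ℕ) : ℝ) * ρ - Φ z₀ + ((k - p' + p : ℤ) : ℝ) = τ - β' - β := by
        rw [Nat.cast_sub (by omega), hτd]
        push_cast
        linarith
      rcases lt_or_ge 0 (τ - β' - β) with h1 | h1
      · have h2 := hmin (i + q - q') (by omega) (k - p' + p) (by rw [e1]; exact h1)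
        rw [e1] at h2
        linarith
      · have h2 := hoff (i + q - q') (by omega) (k - p' + p)
        rw [e1, abs_of_nonpos h1] at h2
        linarith
  clear_value τ
  have hΦw : ∀ j : ℕ, Φ (w j) = Φ z₀ + (j - K) * β := by
    have h0 : ∀ j : ℕ, Φ (w j) = Φ (w 0) + j * β := by
      intro j
      induction j with
      | zero => simp
      | succ j ih => rw [← hw, ΦA, ih]; push_cast; ring
    intro j
    have h1 := h0 K
    rw [hwK] at h1
    rw [h0 j, h1]
    ring
  have mw : StrictMono w := strictMono_nat_of_lt_succ fun j => by rw [← hw]; exact ltA _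
  set L := w (K + 1) - w K with hLd
  have hL0 : 0 < L := sub_pos.2 (mw (Nat.lt_succ_self K))
  have hwe : ∀ j ≤ 2 * K, w j < e := by
    intro j hj
    refine h.lt_of_lt ?_
    rw [hΦw, hΦe]
    have h1 : (j : ℝ) ≤ 2 * K := by exact_mod_cast hj
    have h2 : ((j : ℝ) - K) * β ≤ K * β := mul_le_mul_of_nonneg_right (by linarith) hβ.le
    linarith
  have hA'e : A' e < z₀ := h.lt_of_lt (by rw [ΦA', hΦe]; linarith)
  have hμ : Λ * L ≤ ((K - 1 : ℕ) : ℝ) * (L / (2 * E)) := by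
    have hK3 : (N₃ : ℝ) ≤ K := by exact_mod_cast hN₃K
    rw [Nat.cast_sub (by omega), Nat.cast_one, ← mul_div_assoc, le_div_iff₀ (by linarith)]
    have := mul_le_mul_of_nonneg_right (show 2 * Λ * E ≤ K - 1 by linarith) hL0.le
    linarith
  obtain ⟨j₁, hj₁, hs₁⟩ := exists_small_step w 0 (show 0 < K by omega) (μ := L / (2 * E)) (by
    rw [zero_add]
    refine (hL.trans hμ).trans (mul_le_mul_of_nonneg_right ?_ (by positivity))
    exact_mod_cast Nat.sub_le K 1)
  obtain ⟨j₂, hj₂, hs₂⟩ := exists_small_step w (K + 1) (show 0 < K - 1 by omega)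
    (μ := L / (2 * E)) (by
    rw [show K + 1 + (K - 1) = 2 * K by omega]
    linarith)
  rw [zero_add] at hs₁
  rw [le_div_iff₀ (by linarith)] at hs₁ hs₂
  have o1 : w j₁ < z₀ := hwK ▸ mw hj₁
  have o2 : z₀ < w (K + 1 + j₂) := hwK ▸ mw (by omega)
  have o3 : w (K + 1 + j₂) < e := hwe _ (by omega)
  have t1 : 0 < w (j₁ + 1) - w j₁ := sub_pos.2 (mw (Nat.lt_succ_self _))
  have t2 : 0 < w (K + 1 + j₂ + 1) - w (K + 1 + j₂) := sub_pos.2 (mw (Nat.lt_succ_self _))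
  have t3 : w (K + 1) ≤ w (K + 1 + j₂) := mw.monotone (by omega)
  have t4 : w (K + 1 + j₂) ≤ w (2 * K) := mw.monotone (by omega)
  have hcontr := drat_shift_le (δa := w (j₁ + 1) - w j₁) (δb := L)
    (δc := w (K + 1 + j₂ + 1) - w (K + 1 + j₂)) (δd := A e - e) (Λ := Λ) (E := E) o1 o3 t1.le
    (by
      have : (w (j₁ + 1) - w j₁) * 1 ≤ (w (j₁ + 1) - w j₁) * (2 * E) :=
        mul_le_mul_of_nonneg_left (by linarith) t1.le
      linarith) hL0 (by rw [hLd, hwK]; linarith) (by linarith) t2 hE (by linarith) (by linarith)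
  have a1 : w j₁ + (w (j₁ + 1) - w j₁) = A (w j₁) := by rw [hw]; ring
  have a2 : z₀ + L = A z₀ := by rw [hLd, ← hw, hwK]; ring
  have a3 : w (K + 1 + j₂) + (w (K + 1 + j₂ + 1) - w (K + 1 + j₂)) = A (w (K + 1 + j₂)) := by
    rw [hw]; ring
  have a4 : e + (A e - e) = A e := by ring
  rw [a1, a2, a3, a4] at hcontr
  -- distortion control along the orbit
  have hΦ1 : Φ z₀ - Φ (w j₁) ≤ K * β := by
    rw [hΦw]
    have : 0 ≤ (j₁ : ℝ) * β := by positivity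
    linarith
  have hdisjL : SepMod q (fun i => F^[i] (w j₁)) (fun i => F^[i] z₀) :=
    sepMod_iterate hF.mono hF.deg h fun j hj hjq l => Or.inl (hΦ1.trans_lt (hsep j hj hjq l))
  have hdisjR : SepMod q (fun i => F^[i] z₀) (fun i => F^[i] e) := by
    refine sepMod_iterate hF.mono hF.deg h fun j hj hjq l => Or.inl ?_
    rw [hΦe]
    rcases hstrict j hj hjq l with h1 | ⟨rfl, rfl⟩
    · linarith
    · push_cast
      rw [abs_of_neg (by linarith)]
      linarith
  have hsum : ∑ j ∈ Finset.range q, (F^[j] e - F^[j] (w j₁)) ≤ 4 := by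
    have u1 := hdisjL.sum_le fun j _ => ⟨(hF.mono.iterate j).monotone o1.le,
      iterate_le_add_one hF.mono hF.deg (h.lt_of_lt (by rw [h.deg]; linarith)).le j⟩
    have u2 := hdisjR.sum_le fun j _ => ⟨(hF.mono.iterate j).monotone (o2.trans o3).le,
      iterate_le_add_one hF.mono hF.deg (h.lt_of_lt (by rw [h.deg]; linarith)).le j⟩
    have u3 := add_le_add u1 u2
    rw [← Finset.sum_add_distrib] at u3
    calc _ = _ := Finset.sum_congr rfl fun j _ => by ring
      _ ≤ _ := u3.trans (by norm_num)
  have h2q : 2 / (q : ℝ) < η := by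
    have hNq' : (N₂ : ℝ) ≤ q := by exact_mod_cast hN₂q
    have hq0 : (0 : ℝ) < q := by exact_mod_cast hqp.q_pos
    rw [div_lt_iff₀ hq0]
    rw [div_lt_iff₀ hη] at hN₂
    have := mul_le_mul_of_nonneg_right hNq' hη.le
    linarith
  have hsm : 2 * β' ≤ 2 / (q : ℝ) := by
    have : 2 / (q : ℝ) = 2 * (1 / q) := by ring
    linarith
  have hfin := drat_iterate_ge hB hF.mono hdist o1 o2 o3 q hε.le
    (fun j _ => (hmod _ _ (by rw [h.iterate, h.iterate, hΦe]; linarith)).le) hεδ hsum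
    (fun j hj s hs l hl => by
      rw [Finset.mem_singleton] at hs
      subst hs
      have k1 := hΦ hl.1
      have k2 := hΦ hl.2
      rw [h.add_int, h.iterate] at k1 k2
      rw [hΦe] at k2
      rcases lt_or_ge 0 (Φ s - j * ρ - Φ z₀ + l) with h1 | h1
      · have := hmin j hj l h1
        linarith
      · have := hoff j hj l
        rw [abs_of_nonpos h1] at this
        linarith)
  simp only [hAq, drat_add] at hfin
  have hpos := drat_pos o1 o2 o3
  have hexp := Real.add_one_le_exp (-(B * (ε * 4)))
  have : 1 - 1 / (2 * Λ) < Real.exp (-(B * (ε * 4))) := by linarith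
  have := mul_lt_mul_of_pos_right this hpos
  linarith

theorem exists_goodMover_of_mem_goodPairs {ρ α : ℝ} (h : (ρ, α) ∈ goodPairs) {K : ℕ} (hK : 2 ≤ K) :
    ∃ (q : ℕ) (p : ℤ), K ≤ q ∧ GoodMover ρ q p ∧ K * (q * ρ - p) < 1 / 4 ∧
      (∀ i : ℕ, 0 < i → i < q → ∀ m : ℤ, K * (q * ρ - p) < |i * ρ + m|) ∧
      ∀ i < q, ∀ k : ℤ, K * (q * ρ - p) < |α + i * ρ + k| := by
  obtain ⟨q, hKq, p, hβ, h1, h2⟩ := mem_iInter.1 h.2 K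
  simp only at hβ h1 h2
  have hKR : (2 : ℝ) ≤ K := by exact_mod_cast hK
  have hβK : q * ρ - p ≤ K * (q * ρ - p) := by
    have := mul_le_mul_of_nonneg_right (show (1 : ℝ) ≤ K by linarith) hβ.le
    linarith
  have hsep : ∀ i : ℕ, 0 < i → i < q → ∀ m : ℤ, 2 * K * (q * ρ - p) < |i * ρ + m| := by
    intro i hi hiq m
    have := norm_coe_le_abs_sub_int (i * ρ) (-m)
    push_cast at this
    rw [sub_neg_eq_add] at this
    exact (h1 i hi hiq).trans_le this
  have hhalf : 2 * K * (q * ρ - p) < 1 / 2 := by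
    have := hsep 1 one_pos (by omega) (-round ρ)
    push_cast at this
    rw [one_mul, ← sub_eq_add_neg] at this
    exact this.trans_le (abs_sub_round ρ)
  refine ⟨q, p, hKq, ⟨by omega, hβ, ?_, fun i hi hiq m => ?_⟩, by linarith, fun i hi hiq m => ?_,
    fun i hi k => ?_⟩
  · have := mul_le_mul_of_nonneg_right hKR hβ.le
    linarith
  · linarith [hsep i hi hiq m]
  · linarith [hsep i hi hiq m]
  · have := norm_coe_le_abs_sub_int (α + i * ρ) (-k)
    push_cast at this
    rw [sub_neg_eq_add] at this
    exact (h2 i hi).trans_le this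

theorem doubling_growth {H : ℝ → ℝ} {M : ℝ} (hM : 0 < M)
    (hqs : ∀ x t, 0 < t → H x - H (x - t) ≤ M * (H (x + t) - H x)) (x : ℝ) {t : ℝ} (ht : 0 < t)
    (n : ℕ) : (1 + 1 / M) ^ n * (H (x + t) - H x) ≤ H (x + 2 ^ n * t) - H x := by
  induction n with
  | zero => simp
  | succ n ih =>
    have h1 := hqs (x + 2 ^ n * t) (2 ^ n * t) (by positivity)
    rw [add_sub_cancel_right, add_assoc, ← two_mul, ← mul_assoc, ← pow_succ'] at h1
    have h2 := mul_le_mul_of_nonneg_left ih (show 0 ≤ 1 + 1 / M by positivity)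
    have h3 := mul_le_mul_of_nonneg_left h1 (show 0 ≤ 1 / M by positivity)
    rw [← mul_assoc, one_div_mul_cancel hM.ne', one_mul] at h3
    rw [pow_succ']
    linarith

/-- The conjugacy between a unicritical and a bicritical map cannot be quasisymmetric when the
critical points of the latter are in good position. -/
theorem not_quasisymmetric_of_mem_goodPairs {F G H Φ : ℝ → ℝ} {ρ α x₀ x₁ x₂ : ℝ}
    (hF : CritLift F {x₀}) (hG : CritLift G {x₁, x₂}) (h : RotFactor G Φ ρ)
    (hH : StrictMono H) (sH : Function.Surjective H) (dH : ∀ x, H (x + 1) = H x + 1)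
    (hHF : ∀ x, H (F x) = G (H x)) (n₀ : ℤ) (hx₀ : H x₀ = x₁ + n₀) (n₁ : ℤ)
    (hα : Φ x₂ - Φ x₁ = α + n₁) (hgood : (ρ, α) ∈ goodPairs) {M : ℝ} (hM : 1 < M)
    (hqs₁ : ∀ x t, 0 < t → H (x + t) - H x ≤ M * (H x - H (x - t)))
    (hqs₂ : ∀ x t, 0 < t → H x - H (x - t) ≤ M * (H (x + t) - H x)) : False := by
  classical
  have hsmall : ∀ ε > (0 : ℝ), ∃ (q : ℕ) (p : ℤ), GoodMover ρ q p ∧ q * ρ - p < ε := by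
    intro ε hε
    obtain ⟨K, hK⟩ := exists_nat_gt (1 / ε)
    obtain ⟨q, p, -, hqp, hlt, -⟩ := exists_goodMover_of_mem_goodPairs hgood (le_max_right K 2)
    refine ⟨q, p, hqp, ?_⟩
    have h1 : (1 / ε) * (q * ρ - p) ≤ (max K 2 : ℕ) * (q * ρ - p) :=
      mul_le_mul_of_nonneg_right (hK.le.trans (by exact_mod_cast le_max_left K 2)) hqp.pos.le
    have h2 : (1 / ε) * (q * ρ - p) < 1 := by linarith
    rwa [one_div_mul_eq_div, div_lt_one hε] at h2
  have hΦ : StrictMono Φ := hG.strictMono_factor h hsmall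
  have hf : RotFactor F (Φ ∘ H) ρ := by
    refine ⟨h.irr, h.mono.comp hH.monotone, fun x => ?_, fun x => ?_⟩
    · simp only [Function.comp_apply, dH, h.deg]
    · simp only [Function.comp_apply, hHF, h.conj]
  have hΦH : StrictMono (Φ ∘ H) := hΦ.comp hH
  obtain ⟨C, hC, hcomp⟩ := hG.exists_comparable h
  obtain ⟨Λ, hΛ, η, hη, hpc⟩ := hG.exists_power_comparison h hΦ
    (show x₂ ∈ ({x₁, x₂} : Finset ℝ) by simp)
  obtain ⟨n, hn⟩ := pow_unbounded_of_one_lt (M * (Λ * C))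
    (show 1 < 1 + 1 / M by have : 0 < 1 / M := by positivity
                           linarith)
  obtain ⟨K₀, hK₀⟩ := hF.exists_no_short_stretch hf hΦH (Λ := 2 ^ n) (one_le_pow₀ one_le_two)
  obtain ⟨N, hN⟩ := exists_nat_gt (K₀ / (4 * η))
  obtain ⟨q, p, hKq, hqp, hlt, hsep, hsepα⟩ :=
    exists_goodMover_of_mem_goodPairs hgood (le_max_right (max K₀ N) 2)
  set K' := max (max K₀ N) 2 with hK'
  have hK₀K : K₀ ≤ K' := (le_max_left _ _).trans (le_max_left _ _)
  have hNK : (N : ℝ) ≤ K' := by exact_mod_cast (le_max_right K₀ N).trans (le_max_left _ _)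
  clear_value K'
  have hβ := hqp.pos
  have hββ : K₀ * (q * ρ - p) ≤ K' * (q * ρ - p) :=
    mul_le_mul_of_nonneg_right (by exact_mod_cast hK₀K) hβ.le
  have hη' : K₀ * (q * ρ - p) < η := by
    have h1 : K₀ / (4 * η) * (q * ρ - p) ≤ K' * (q * ρ - p) :=
      mul_le_mul_of_nonneg_right (hN.le.trans hNK) hβ.le
    have h2 : K₀ * (q * ρ - p) / (4 * η) < 1 / 4 := by
      rw [mul_div_right_comm]
      linarith
    rw [div_lt_iff₀ (by positivity)] at h2
    linarith
  have sepK : ∀ i : ℕ, 0 < i → i < q → ∀ m : ℤ, K₀ * (q * ρ - p) < |i * ρ + m| :=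
    fun i hi hiq m => hββ.trans_lt (hsep i hi hiq m)
  have sepα : ∀ i < q, ∀ (k : ℤ) (u : ℝ), u = α + i * ρ + k → K₀ * (q * ρ - p) < |u| :=
    fun i hi k u hu => hu ▸ hββ.trans_lt (hsepα i hi k)
  obtain ⟨z₀, hz₀⟩ := sH x₂
  have hHA : ∀ x, H (mover F q p x) = mover G q p (H x) := by
    intro x
    have h1 : ∀ j x, H (F^[j] x) = G^[j] (H x) := fun j x =>
      (Function.Semiconj.iterate_right (show Function.Semiconj H F G from hHF) j) x
    have h2 := deg_add_int dH (mover F q p x) p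
    have h3 : mover F q p x + p = F^[q] x := by rw [mover]; ring
    rw [h3, h1] at h2
    rw [mover, mover] at *
    linarith
  have sA : Function.Surjective (mover F q p) := mover_surjective hF.surj q p
  set b : ℕ → ℝ := fun j => (Function.surjInv sA)^[j] z₀ with hb
  have hb0 : b 0 = z₀ := rfl
  have hbA : ∀ j, mover F q p (b (j + 1)) = b j := fun j => by
    simp only [hb, Function.iterate_succ_apply']
    exact Function.surjInv_eq sA _
  clear_value b
  set w : ℕ → ℝ := fun j => (mover F q p)^[j] (b K₀) with hwd
  have hw0 : w 0 = b K₀ := rfl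
  have hw : ∀ j, mover F q p (w j) = w (j + 1) := fun j =>
    (Function.iterate_succ_apply' _ _ _).symm
  have hwK : w K₀ = z₀ := by
    have : ∀ j, (mover F q p)^[j] (b j) = z₀ := by
      intro j
      induction j with
      | zero => exact hb0
      | succ j ih => rw [Function.iterate_succ_apply, hbA, ih]
    exact this K₀
  clear_value w
  have hcrit : ∀ s ∈ ({x₁, x₂} : Finset ℝ), ∀ i : ℕ, 0 < i → i < q → ∀ k : ℤ,
      K₀ * (q * ρ - p) < |Φ x₂ - Φ s + i * ρ + k| := by
    intro s hs i hi hiq k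
    simp only [Finset.mem_insert, Finset.mem_singleton] at hs
    rcases hs with rfl | rfl
    · refine sepα i hiq (k + n₁) _ ?_
      push_cast
      linarith
    · rw [sub_self, zero_add]
      exact sepK i hi hiq k
  have hfor := (hpc q p K₀ hqp hη' hcrit (fun j => H (w (K₀ + j))) (by simp [hwK, hz₀])).1
    (fun j => by rw [← hHA, hw]; rfl)
  have hback := (hpc q p K₀ hqp hη' hcrit (fun j => H (b j)) (by simp [hb0, hz₀])).2
    (fun j => by rw [← hHA, hbA])
  have hcb := (hcomp q p hqp (H (b 1))).2
  simp only [← hHA] at hcb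
  rw [hbA, hb0] at hcb
  rw [← two_mul] at hfor
  have hM0 : 0 < M := by linarith
  have ltw : w K₀ < w (K₀ + 1) := by rw [← hw]; exact lt_mover hf hβ _
  set L := w (K₀ + 1) - w K₀ with hL
  have hL0 : 0 < L := sub_pos.2 ltw
  have hzL : z₀ + L = w (K₀ + 1) := by rw [hL, hwK]; ring
  have hzL' : mover F q p z₀ = w (K₀ + 1) := by rw [← hw, hwK]
  have hgrow := doubling_growth hM0 hqs₂ z₀ hL0 n
  rw [hzL] at hgrow
  rw [hzL', hz₀] at hcb
  rw [hz₀] at hgrow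
  have hℓ : 0 < H (w (K₀ + 1)) - x₂ := by
    rw [← hz₀, ← hwK]
    exact sub_pos.2 (hH ltw)
  have hΛC : Λ ≤ M * (Λ * C) := by
    have h1 : Λ * 1 ≤ Λ * C := mul_le_mul_of_nonneg_left hC (by linarith)
    have h2 : 1 * (Λ * C) ≤ M * (Λ * C) := mul_le_mul_of_nonneg_right hM.le (by positivity)
    linarith
  refine hK₀ K₀ q p le_rfl (hK₀K.trans hKq) hqp sepK z₀ (fun i hi k => ?_) w hw hwK ?_ ?_
  · refine sepα i hi (k + n₁ - n₀) _ ?_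
    simp only [Function.comp_apply, hz₀, hx₀, h.add_int]
    push_cast
    linarith
  · by_contra hge
    rw [not_le] at hge
    have h1 := hH (show z₀ + 2 ^ n * L < w (2 * K₀) by rw [← hwK]; linarith)
    have h2 := mul_le_mul_of_nonneg_right (hΛC.trans hn.le) hℓ.le
    linarith
  · by_contra hge
    rw [not_le] at hge
    have h1 := hH (show w 0 < z₀ - 2 ^ n * L by rw [← hwK]; linarith)
    have h2 := mul_lt_mul_of_pos_right hn hℓ
    have h3 := hqs₁ z₀ (2 ^ n * L) (by positivity)
    rw [hz₀] at h3
    rw [← hw0] at hback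
    have h4 : M * (x₂ - H (z₀ - 2 ^ n * L)) ≤ M * (Λ * (x₂ - H (b 1))) :=
      mul_le_mul_of_nonneg_left (by linarith) hM0.le
    have h5 : M * Λ * (x₂ - H (b 1)) ≤ M * Λ * (C * (H (w (K₀ + 1)) - x₂)) :=
      mul_le_mul_of_nonneg_left (by linarith) (by positivity)
    linarith

/-- The representative of a point of the circle in `[0, 1)`. -/
def repr01 (θ : S1) : ℝ := (AddCircle.equivIco 1 0 θ : ℝ)

theorem repr01_mem (θ : S1) : repr01 θ ∈ Ico (0 : ℝ) 1 := by
  have := (AddCircle.equivIco (1 : ℝ) 0 θ).2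
  exact ⟨this.1, this.2.trans_eq (zero_add 1)⟩

theorem coe_repr01 (θ : S1) : ((repr01 θ : ℝ) : S1) = θ := AddCircle.coe_equivIco

theorem measurable_repr01 : Measurable repr01 :=
  measurable_subtype_coe.comp (AddCircle.measurableEquivIco 1 0).measurable

theorem coe_eq_coe_iff_exists_int {x y : ℝ} : (x : S1) = (y : S1) ↔ ∃ m : ℤ, x = y + m := by
  rw [← sub_eq_zero, ← AddCircle.coe_sub, AddCircle.coe_eq_zero_iff]
  refine exists_congr fun m => ?_
  simp only [zsmul_eq_mul, mul_one]
  constructor <;> intro h <;> linarith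

theorem integrable_floor_sub_repr01 (μ : Measure S1) [IsProbabilityMeasure μ] (x : ℝ) :
    Integrable (fun θ => (⌊x - repr01 θ⌋ : ℝ)) μ := by
  refine Integrable.of_bound (C := |x| + 2) ?_ (Eventually.of_forall fun θ => ?_)
  · refine Measurable.aestronglyMeasurable ?_
    exact measurable_from_top.comp (Int.measurable_floor.comp (measurable_const.sub measurable_repr01))
  · have h1 := repr01_mem θ
    have h2 := Int.floor_le (x - repr01 θ)
    have h3 := Int.lt_floor_add_one (x - repr01 θ)
    rw [Real.norm_eq_abs, abs_le]
    have h4 := neg_abs_le x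
    have h5 := le_abs_self x
    constructor <;> linarith [h1.1, h1.2]

/-- The distribution function of the lift of a probability measure on the circle. -/
def cdfLift (μ : Measure S1) (x : ℝ) : ℝ := ∫ θ, (⌊x - repr01 θ⌋ : ℝ) ∂μ

theorem cdfLift_mono (μ : Measure S1) [IsProbabilityMeasure μ] : Monotone (cdfLift μ) :=
  fun x y hxy => integral_mono (integrable_floor_sub_repr01 μ x) (integrable_floor_sub_repr01 μ y)
    fun θ => by
      have : ⌊x - repr01 θ⌋ ≤ ⌊y - repr01 θ⌋ := Int.floor_le_floor (by linarith)
      exact Int.cast_le.2 this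

theorem cdfLift_add_one (μ : Measure S1) [IsProbabilityMeasure μ] (x : ℝ) :
    cdfLift μ (x + 1) = cdfLift μ x + 1 := by
  unfold cdfLift
  have : ∀ θ, (⌊x + 1 - repr01 θ⌋ : ℝ) = ⌊x - repr01 θ⌋ + 1 := fun θ => by
    rw [show x + 1 - repr01 θ = x - repr01 θ + 1 by ring, Int.floor_add_one]
    push_cast
    rfl
  simp only [this]
  rw [integral_add (integrable_floor_sub_repr01 μ x) (integrable_const _)]
  simp

theorem abs_cdfLift_sub_le (μ : Measure S1) [IsProbabilityMeasure μ] (x : ℝ) :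
    |cdfLift μ x - x| ≤ 2 := by
  have h1 : cdfLift μ x ≤ x := by
    have := integral_mono (integrable_floor_sub_repr01 μ x) (integrable_const x) fun θ => by
      have := repr01_mem θ
      have := Int.floor_le (x - repr01 θ)
      simp only
      linarith [(repr01_mem θ).1]
    simpa [cdfLift] using this
  have h2 : x - 2 ≤ cdfLift μ x := by
    have := integral_mono (integrable_const (x - 2)) (integrable_floor_sub_repr01 μ x) fun θ => by
      have := Int.lt_floor_add_one (x - repr01 θ)
      simp only
      linarith [(repr01_mem θ).2]
    simpa [cdfLift] using this
  rw [abs_le]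
  constructor <;> linarith

theorem floor_lift_sub {G : ℝ → ℝ} (hG : StrictMono G) (hdeg : ∀ x, G (x + 1) = G x + 1) (x s : ℝ) :
    ⌊G x - G s⌋ = ⌊x - s⌋ := by
  rw [Int.floor_eq_iff]
  have h1 := Int.floor_le (x - s)
  have h2 := Int.lt_floor_add_one (x - s)
  have h3 : G (s + ⌊x - s⌋) ≤ G x := hG.monotone (by linarith)
  have h4 : G x < G (s + (⌊x - s⌋ + 1 : ℤ)) := hG (by push_cast; linarith)
  rw [deg_add_int hdeg] at h3 h4
  push_cast at h4
  constructor <;> linarith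

theorem exists_cdfLift_conj {g : S1 → S1} {G : ℝ → ℝ} (hG : IsLift g G) (μ : Measure S1)
    [IsProbabilityMeasure μ] (hμ : μ.map g = μ) :
    ∃ r : ℝ, ∀ x, cdfLift μ (G x) = cdfLift μ x + r := by
  have hg : AEMeasurable g μ := by
    by_contra hg
    rw [Measure.map_of_not_aemeasurable hg] at hμ
    exact IsProbabilityMeasure.ne_zero μ hμ.symm
  refine ⟨∫ θ, (G (repr01 θ) - repr01 (g θ)) ∂μ, fun x => ?_⟩
  have hi : Integrable (fun θ => (⌊G x - repr01 θ⌋ : ℝ)) (μ.map g) := by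
    rw [hμ]
    exact integrable_floor_sub_repr01 μ (G x)
  have h1 : cdfLift μ (G x) = ∫ θ, (⌊G x - repr01 (g θ)⌋ : ℝ) ∂μ := by
    unfold cdfLift
    conv_lhs => rw [← hμ]
    exact integral_map hg hi.aestronglyMeasurable
  have h2 : ∀ θ, (⌊G x - repr01 (g θ)⌋ : ℝ) - ⌊x - repr01 θ⌋ = G (repr01 θ) - repr01 (g θ) := by
    intro θ
    obtain ⟨m, hm⟩ := coe_eq_coe_iff_exists_int.1 (show ((repr01 (g θ) : ℝ) : S1) = (G (repr01 θ) : S1) by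
      rw [coe_repr01, ← hG.2.2.2, coe_repr01])
    rw [hm, ← floor_lift_sub hG.1 hG.2.2.1 x (repr01 θ),
      show G x - (G (repr01 θ) + m) = G x - G (repr01 θ) - m by ring, Int.floor_sub_intCast]
    push_cast
    ring
  have hi' : Integrable (fun θ => (⌊G x - repr01 (g θ)⌋ : ℝ)) μ := hi.comp_aemeasurable hg
  rw [h1, ← sub_eq_iff_eq_add', cdfLift, ← integral_sub hi' (integrable_floor_sub_repr01 μ x)]
  exact integral_congr_ae (Eventually.of_forall h2)

theorem cdfLift_rotFactor {g : S1 → S1} {G : ℝ → ℝ} (hG : IsLift g G) (μ : Measure S1)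
    [IsProbabilityMeasure μ] (hμ : μ.map g = μ) {ρ : ℝ} (hρ : Irrational ρ)
    (hlim : Tendsto (fun n : ℕ => G^[n] 0 / (n : ℝ)) atTop (𝓝 ρ)) :
    RotFactor G (cdfLift μ) ρ := by
  obtain ⟨r, hr⟩ := exists_cdfLift_conj hG μ hμ
  have hit : ∀ n : ℕ, cdfLift μ (G^[n] 0) = cdfLift μ 0 + n * r := by
    intro n
    induction n with
    | zero => simp
    | succ n ih => rw [Function.iterate_succ_apply', hr, ih]; push_cast; ring
  have h0 : Tendsto (fun n : ℕ => G^[n] 0 / (n : ℝ) - r) atTop (𝓝 0) := by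
    have hc := tendsto_const_div_atTop_nhds_zero_nat (4 : ℝ)
    refine squeeze_zero_norm' ?_ hc
    filter_upwards [eventually_gt_atTop 0] with n hn
    have hn' : (0 : ℝ) < n := by exact_mod_cast hn
    have h1 := abs_le.1 (abs_cdfLift_sub_le μ (G^[n] 0))
    have h2 := abs_le.1 (abs_cdfLift_sub_le μ 0)
    rw [hit] at h1
    rw [Real.norm_eq_abs, div_sub' hn'.ne', abs_div, abs_of_pos hn']
    refine div_le_div_of_nonneg_right (abs_le.2 ?_) hn'.le
    constructor <;> linarith [h1.1, h1.2, h2.1, h2.2]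
  have hrρ : ρ = r := by
    have := tendsto_nhds_unique (hlim.sub_const r) h0
    linarith
  subst hrρ
  exact ⟨hρ, cdfLift_mono μ, cdfLift_add_one μ, hr⟩

theorem cdfLift_sub_eq (μ : Measure S1) [IsProbabilityMeasure μ] {x y : ℝ} (hxy : x < y)
    (hyx : y < x + 1) :
    MeasurableSet {θ | ∃ k : ℤ, x < repr01 θ + k ∧ repr01 θ + k ≤ y} ∧
    cdfLift μ y - cdfLift μ x = μ.real {θ | ∃ k : ℤ, x < repr01 θ + k ∧ repr01 θ + k ≤ y} := by
  have hm : MeasurableSet {θ | ∃ k : ℤ, x < repr01 θ + k ∧ repr01 θ + k ≤ y} := by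
    simp only [Set.ofPred_exists]
    refine MeasurableSet.iUnion fun k => ?_
    exact (measurableSet_lt measurable_const (measurable_repr01.add_const _)).inter
      (measurableSet_le (measurable_repr01.add_const _) measurable_const)
  refine ⟨hm, ?_⟩
  rw [← integral_indicator_one hm, cdfLift, cdfLift, ← integral_sub (integrable_floor_sub_repr01 μ y)
    (integrable_floor_sub_repr01 μ x)]
  refine integral_congr_ae (Eventually.of_forall fun θ => ?_)
  have a1 := Int.floor_le (x - repr01 θ)
  have a2 := Int.lt_floor_add_one (x - repr01 θ)
  have b1 := Int.floor_le (y - repr01 θ)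
  have b2 := Int.lt_floor_add_one (y - repr01 θ)
  have hle : ⌊x - repr01 θ⌋ ≤ ⌊y - repr01 θ⌋ := Int.floor_le_floor (by linarith)
  have hge : ⌊y - repr01 θ⌋ < ⌊x - repr01 θ⌋ + 2 := by
    have : (⌊y - repr01 θ⌋ : ℝ) < ⌊x - repr01 θ⌋ + 2 := by linarith
    exact_mod_cast this
  by_cases hθ : θ ∈ {θ | ∃ k : ℤ, x < repr01 θ + k ∧ repr01 θ + k ≤ y}
  · rw [indicator_of_mem hθ]
    obtain ⟨k, hk1, hk2⟩ := hθ
    have c1 : ⌊x - repr01 θ⌋ < k := Int.floor_lt.2 (by linarith)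
    have c2 : k ≤ ⌊y - repr01 θ⌋ := Int.le_floor.2 (by linarith)
    have : ⌊y - repr01 θ⌋ = ⌊x - repr01 θ⌋ + 1 := by omega
    simp [this]
  · rw [indicator_of_notMem hθ]
    have : ⌊y - repr01 θ⌋ = ⌊x - repr01 θ⌋ := by
      by_contra hne
      refine hθ ⟨⌊x - repr01 θ⌋ + 1, by push_cast; linarith, ?_⟩
      have : ⌊y - repr01 θ⌋ = ⌊x - repr01 θ⌋ + 1 := by omega
      rw [← this]
      linarith
    simp [this]

theorem measureReal_singleton_eq_zero {G : ℝ → ℝ} (sG : Function.Surjective G) (μ : Measure S1)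
    [IsProbabilityMeasure μ] {ρ : ℝ} (h : RotFactor G (cdfLift μ) ρ) (x : ℝ) :
    μ {(x : S1)} = 0 := by
  have hjump : ∀ y < x, μ.real {(x : S1)} ≤ cdfLift μ x - cdfLift μ y := by
    intro y hy
    have hy' : x - 1 / 2 < x := by linarith
    obtain ⟨-, he⟩ := cdfLift_sub_eq μ (show max y (x - 1 / 2) < x from max_lt hy hy')
      (by linarith [le_max_right y (x - 1 / 2)])
    have h1 := h.mono (le_max_left y (x - 1 / 2))
    have h2 : μ.real {(x : S1)} ≤
        μ.real {θ | ∃ k : ℤ, max y (x - 1 / 2) < repr01 θ + k ∧ repr01 θ + k ≤ x} := by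
      refine measureReal_mono ?_
      rintro θ rfl
      obtain ⟨m, hm⟩ := coe_eq_coe_iff_exists_int.1 (coe_repr01 (x : S1))
      refine ⟨-m, ?_, ?_⟩
      · push_cast
        rw [hm, add_neg_cancel_right]
        exact max_lt hy hy'
      · push_cast
        rw [hm, add_neg_cancel_right]
    linarith
  by_contra hne
  have hpos : 0 < μ.real {(x : S1)} := ENNReal.toReal_pos hne (measure_ne_top _ _)
  obtain ⟨n, hn⟩ := exists_nat_one_div_lt hpos
  obtain ⟨k, hk, -, hk2⟩ := Real.exists_nat_abs_mul_sub_round_le ρ (Nat.succ_pos n)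
  have hlt : |k * ρ - round (k * ρ)| < μ.real {(x : S1)} := by
    refine hk2.trans_lt (lt_of_le_of_lt ?_ hn)
    push_cast
    gcongr
    linarith
  set m := round (k * ρ) with hm
  clear_value m
  have hne0 : (k : ℝ) * ρ - m ≠ 0 := fun h0 => by
    have := h.irr.int_mul_add_eq_zero (a := k) (b := -m) (by push_cast; linarith)
    omega
  rcases lt_or_gt_of_ne hne0 with hneg | hpos'
  · have h1 := h.mover k m x
    have h2 := hjump (mover G k m x) (h.lt_of_lt (by linarith))
    rw [abs_of_neg hneg] at hlt
    linarith
  · obtain ⟨y, rfl⟩ := mover_surjective sG k m x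
    have h1 := h.mover k m y
    have h2 := hjump y (h.lt_of_lt (by linarith))
    rw [abs_of_pos hpos'] at hlt
    linarith

theorem cdfLift_sub_eq_posArc {G : ℝ → ℝ} (sG : Function.Surjective G) (μ : Measure S1)
    [IsProbabilityMeasure μ] {ρ : ℝ} (h : RotFactor G (cdfLift μ) ρ) {x y : ℝ}
    (hne : (x : S1) ≠ (y : S1)) :
    ∃ n : ℤ, cdfLift μ y - cdfLift μ x = (μ (posArc (x : S1) (y : S1))).toReal + n := by
  set t := Int.fract (y - x) with ht
  have hty : t = y - x - ⌊y - x⌋ := rfl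
  have ht0 : 0 < t := by
    refine lt_of_le_of_ne (Int.fract_nonneg _) fun h0 => hne ?_
    refine coe_eq_coe_iff_exists_int.2 ⟨-⌊y - x⌋, ?_⟩
    push_cast
    linarith
  have ht1 : t < 1 := Int.fract_lt_one _
  clear_value t
  have hyt : (y : S1) = ((x + t : ℝ) : S1) := coe_eq_coe_iff_exists_int.2 ⟨⌊y - x⌋, by linarith⟩
  have harc : arcLen (x : S1) (y : S1) = t := by
    unfold arcLen
    rw [hyt, AddCircle.coe_add, add_sub_cancel_left]
    rw [AddCircle.equivIco_coe_eq]
    rw [zero_add]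
    exact ⟨ht0.le, ht1⟩
  obtain ⟨hmeas, he⟩ := cdfLift_sub_eq μ (show x < x + t by linarith) (by linarith)
  have hset : {θ | ∃ k : ℤ, x < repr01 θ + k ∧ repr01 θ + k ≤ x + t} =
      posArc (x : S1) (y : S1) ∪ {(y : S1)} := by
    ext θ
    simp only [posArc, harc, Set.mem_ofPred_eq, mem_union, mem_image, mem_singleton_iff, mem_Ioo]
    constructor
    · rintro ⟨k, hk1, hk2⟩
      have hθ : ((repr01 θ + k : ℝ) : S1) = θ := by
        conv_rhs => rw [← coe_repr01 θ]
        exact coe_eq_coe_iff_exists_int.2 ⟨k, rfl⟩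
      rcases hk2.lt_or_eq with hlt | heq
      · left
        refine ⟨repr01 θ + k - x, ⟨by linarith, by linarith⟩, ?_⟩
        rw [← AddCircle.coe_add, add_sub_cancel, hθ]
      · right
        rw [← hθ, heq, hyt]
    · intro hθ
      obtain ⟨u, hu0, hut, hu⟩ : ∃ u, 0 < u ∧ u ≤ t ∧ ((x + u : ℝ) : S1) = θ := by
        rcases hθ with ⟨u, hu, rfl⟩ | rfl
        · exact ⟨u, hu.1, hu.2.le, AddCircle.coe_add 1 x u⟩
        · exact ⟨t, ht0, le_rfl, hyt.symm⟩
      obtain ⟨m, hm⟩ := coe_eq_coe_iff_exists_int.1 (hu.trans (coe_repr01 θ).symm)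
      exact ⟨m, by linarith, by linarith⟩
  have hnull := measureReal_singleton_eq_zero sG μ h y
  have hμ : μ.real (posArc (x : S1) (y : S1) ∪ {(y : S1)}) =
      (μ (posArc (x : S1) (y : S1))).toReal := by
    rw [measureReal_def]
    congr 1
    exact le_antisymm ((measure_union_le _ _).trans (by rw [hnull, add_zero]))
      (measure_mono subset_union_left)
  refine ⟨⌊y - x⌋, ?_⟩
  have h1 := h.add_int (x + t) ⌊y - x⌋
  rw [show x + t + (⌊y - x⌋ : ℝ) = y by linarith] at h1
  rw [hset, hμ] at he
  linarith

/-- Two lifts of the same circle map differ by an integer translation. -/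
theorem IsLift.exists_eq_add_int {g : S1 → S1} {F G : ℝ → ℝ} (hF : IsLift g F) (hG : IsLift g G) :
    ∃ k : ℤ, ∀ x, F x = G x + k := by
  have hcoe : ∀ x, ∃ m : ℤ, F x = G x + m := fun x =>
    coe_eq_coe_iff_exists_int.1 ((hF.2.2.2 x).symm.trans (hG.2.2.2 x))
  obtain ⟨k, hk⟩ := hcoe 0
  refine ⟨k, fun x => ?_⟩
  have h0 : F (Int.fract x) = G (Int.fract x) + k := by
    obtain ⟨m, hm⟩ := hcoe (Int.fract x)
    have h1 := hF.1.monotone (Int.fract_nonneg x)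
    have h2 := hF.1 (Int.fract_lt_one x)
    have h3 := hG.1.monotone (Int.fract_nonneg x)
    have h4 := hG.1 (Int.fract_lt_one x)
    have h5 := hF.2.2.1 0
    have h6 := hG.2.2.1 0
    rw [zero_add] at h5 h6
    have h7 : (m : ℝ) < k + 1 := by linarith
    have h8 : (k : ℝ) < m + 1 := by linarith
    have h9 : m < k + 1 := by exact_mod_cast h7
    have h10 : k < m + 1 := by exact_mod_cast h8
    rw [hm, show m = k by omega]
  have hx : x = Int.fract x + (⌊x⌋ : ℤ) := (Int.fract_add_floor x).symm
  rw [hx, deg_add_int hF.2.2.1, deg_add_int hG.2.2.1, h0]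
  ring

theorem IsLift.comp {g h : S1 → S1} {G H : ℝ → ℝ} (hG : IsLift g G) (hH : IsLift h H) :
    IsLift (g ∘ h) (G ∘ H) :=
  ⟨hG.1.comp hH.1, hG.2.1.comp hH.2.1,
    fun x => by simp only [Function.comp_apply, hH.2.2.1, hG.2.2.1],
    fun x => by simp only [Function.comp_apply, hH.2.2.2, hG.2.2.2]⟩

theorem not_quasiSymm_of_mem_goodPairs {f g : S1 → S1} {c₀ c₁ c₂ : S1} {ρ : ℝ} {μ : Measure S1}
    [IsProbabilityMeasure μ] (hρ : Irrational ρ) (hf : Unicritical f c₀ 3)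
    (hg : Bicritical g c₁ c₂ 3) (hrot : HasRotNum g ρ) (hμ : μ.map g = μ)
    (hgood : (ρ, (μ (posArc c₁ c₂)).toReal) ∈ goodPairs) {h : S1 → S1}
    (hconj : h ∘ f = g ∘ h) (hc : h c₀ = c₁) : ¬ QuasiSymm h := by
  rintro ⟨H, hH, M, hM, hqs⟩
  obtain ⟨F, x₀, hF, hF3, rfl, hFcrit, hFnf⟩ := hf
  obtain ⟨hne, G₁, x₁, x₂, hG₁, hG3, rfl, rfl, hGcrit, hGnf₁, hGnf₂⟩ := hg
  obtain ⟨G, hG, hlim⟩ := hrot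
  have hcF : CritLift F {x₀} := by
    refine critLift_of_contDiff (by exact_mod_cast hF3) hF.1 hF.2.1 hF.2.2.1 (fun x => ?_) ?_
    · simpa using Set.ext_iff.1 hFcrit x
    · simpa using hFnf
  have hcG₁ : CritLift G₁ {x₁, x₂} := by
    refine critLift_of_contDiff (by exact_mod_cast hG3) hG₁.1 hG₁.2.1 hG₁.2.2.1 (fun x => ?_) ?_
    · simpa using Set.ext_iff.1 hGcrit x
    · simpa using And.intro hGnf₁ hGnf₂
  obtain ⟨k, hk⟩ := hG.exists_eq_add_int hG₁
  have hcG : CritLift G {x₁, x₂} := by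
    rw [show G = fun x => G₁ x + k from funext hk]
    exact hcG₁.add_int k
  obtain ⟨l, hl⟩ := (hG.comp hH).exists_eq_add_int (hconj ▸ hH.comp hF)
  obtain ⟨n₀, hn₀⟩ := coe_eq_coe_iff_exists_int.1 ((hH.2.2.2 x₀).symm.trans hc)
  have hrf := cdfLift_rotFactor hG μ hμ hρ hlim
  obtain ⟨n₁, hn₁⟩ := cdfLift_sub_eq_posArc hG.2.1 μ hrf hne
  refine not_quasisymmetric_of_mem_goodPairs (hcF.add_int l) hcG hrf hH.1 hH.2.1 hH.2.2.1
    (fun x => ?_) n₀ hn₀ n₁ hn₁ hgood hM (fun x t ht => ?_) (fun x t ht => ?_)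
  · rw [deg_add_int hH.2.2.1]
    exact (hl x).symm
  · have hpos : 0 < H x - H (x - t) := sub_pos.2 (hH.1 (by linarith))
    exact (div_le_iff₀ hpos).1 (hqs x t ht).2
  · have hpos : 0 < H x - H (x - t) := sub_pos.2 (hH.1 (by linarith))
    have := (le_div_iff₀ hpos).1 (hqs x t ht).1
    rwa [one_div, inv_mul_le_iff₀ (by linarith)] at this

/-- **Theorem B.** There is a set `𝒢 ⊆ [0,1]²`, containing a residual set and of full Lebesgue
measure, such that whenever `f` is a `C³` unicritical circle map and `g` is a `C³` bi-critical
circle map with the same irrational rotation number `ρ`, and `α` is the `μ_g`-measure of the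
positively oriented arc from `c₁` to `c₂`, if `(ρ,α) ∈ 𝒢` then the conjugacy taking `c₀` to `c₁`
is not quasisymmetric. Moreover `{ρ : (ρ,α) ∈ 𝒢 for some α}` contains `𝔼_∞`. -/
theorem thmB :
    ∃ 𝒢 : Set (ℝ × ℝ), 𝒢 ⊆ Sq ∧
      (Subtype.val ⁻¹' 𝒢 : Set ↥Sq) ∈ residual ↥Sq ∧
      volume (Sq \ 𝒢) = 0 ∧
      (∀ (f g : S1 → S1) (c₀ c₁ c₂ : S1) (ρ : ℝ) (μg : Measure S1),
        Irrational ρ → ρ ∈ Icc (0 : ℝ) 1 →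
        Unicritical f c₀ 3 → Bicritical g c₁ c₂ 3 →
        HasRotNum f ρ → HasRotNum g ρ →
        IsProbabilityMeasure μg → μg.map g = μg →
        (ρ, (μg (posArc c₁ c₂)).toReal) ∈ 𝒢 →
        ∀ h : S1 → S1, IsCircleHomeo h → h ∘ f = g ∘ h → h c₀ = c₁ → ¬ QuasiSymm h) ∧
      Einf ⊆ {ρ : ℝ | ∃ α : ℝ, (ρ, α) ∈ 𝒢} := by
  refine ⟨goodPairs, inter_subset_left, goodPairs_residual, volume_sq_diff_goodPairs, ?_,
    Einf_subset⟩
  intro f g c₀ c₁ c₂ ρ μg hρ _ hf hg _ hrot _ hμ hgood h _ hconj hc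
  exact not_quasiSymm_of_mem_goodPairs hρ hf hg hrot hμ hgood hconj hc
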